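/- Under the conditions q ≤ 1/5, σ ≥ 4, 1 ≤ N_B ≤ qN̄, and α satisfying 1 < α ≤ (1/2)σ²A − 2ln σ and α ≤ ((1/2)σ²A² − ln 5 − 2ln σ)/(A + ln(qα) + 1/(2σ²)) with A = ln(1 + 1/(q(α−1))), the Sampled-with-Rejection Gaussian Mechanism applied to a function of ℓ₂-sensitivity 1 satisfies (α, γ)-RDP with γ = q·p(N_B−1; N̄, q)/(1 − P(N_B−1; N̄, q)) + 2q²α/σ². -/

import Mathlib

open MeasureTheory Real Finset

/-- Density of `N(0, σ²I_d)` on `ℝ^d`. -/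
noncomputable def gaussDensity (d : ℕ) (σ : ℝ) (x : EuclideanSpace ℝ (Fin d)) : ℝ :=
  (2 * Real.pi * σ ^ 2) ^ (-(d : ℝ) / 2) * Real.exp (-‖x‖ ^ 2 / (2 * σ ^ 2))

/-- Binomial probability mass function `p(k; n, q)`. -/
noncomputable def binPMF (q : ℝ) (n k : ℕ) : ℝ := (n.choose k : ℝ) * q ^ k * (1 - q) ^ (n - k)

/-- Binomial cumulative distribution function `P(k; n, q)`. -/
noncomputable def binCDF (q : ℝ) (n k : ℕ) : ℝ := ∑ j ∈ Finset.range (k + 1), binPMF q n j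

/-- Output density of the Sampled-with-Rejection Gaussian Mechanism on dataset `D`:
each element of `D` is kept independently with probability `q`, samples of size `< N_B`
are rejected (renormalization), and isotropic Gaussian noise `N(0, σ²I)` is added to
`f(sample)`. -/
noncomputable def srgmDensity {ι : Type*} [DecidableEq ι] (d : ℕ)
    (f : Finset ι → EuclideanSpace ℝ (Fin d)) (σ q : ℝ) (NB : ℕ)
    (D : Finset ι) (ω : EuclideanSpace ℝ (Fin d)) : ℝ :=
  (∑ J ∈ D.powerset.filter (fun J => NB ≤ J.card),
      q ^ J.card * (1 - q) ^ (D.card - J.card))⁻¹ *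
    ∑ J ∈ D.powerset.filter (fun J => NB ≤ J.card),
      q ^ J.card * (1 - q) ^ (D.card - J.card) * gaussDensity d σ (ω - f J)

section PartM1

structure TiltPair {Ω : Type*} [MeasurableSpace Ω] (μ : Measure Ω) (S : Ω → ℝ) (v : ℝ) : Prop where
  prob : IsProbabilityMeasure μ
  meas : Measurable S
  pos : ∀ ω, 0 < S ω
  int : ∀ t : ℝ, Integrable (fun ω => S ω ^ t) μ
  mom : ∀ t : ℝ, ∫ ω, S ω ^ t ∂μ = Real.exp (v * t * (t - 1) / 2)
  tilt : ∀ k : ℝ → ℝ, ∫ ω, S ω * k (S ω) ∂μ = ∫ ω, k (Real.exp v * S ω) ∂μ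
  tiltInt : ∀ k : ℝ → ℝ, Integrable (fun ω => k (Real.exp v * S ω)) μ →
    Integrable (fun ω => S ω * k (S ω)) μ

section Gauss
variable {d : ℕ} {σ : ℝ}

lemma gaussDensity_pos (hσ : 0 < σ) (x : EuclideanSpace ℝ (Fin d)) : 0 < gaussDensity d σ x := by
  unfold gaussDensity; positivity

lemma gaussDensity_cont : Continuous (gaussDensity d σ) := by
  unfold gaussDensity; fun_prop

lemma gaussDensity_integral (hσ : 0 < σ) : ∫ x, gaussDensity d σ x = 1 := by
  unfold gaussDensity
  rw [integral_const_mul]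
  have h := GaussianFourier.integral_rexp_neg_mul_sq_norm
    (V := EuclideanSpace ℝ (Fin d)) (b := 1 / (2 * σ ^ 2)) (by positivity)
  have h2 : (fun x : EuclideanSpace ℝ (Fin d) => Real.exp (-‖x‖ ^ 2 / (2 * σ ^ 2))) =
      fun x => Real.exp (-(1 / (2 * σ ^ 2)) * ‖x‖ ^ 2) := by
    funext x; congr 1; ring
  rw [h2, h]
  have h3 : Real.pi / (1 / (2 * σ ^ 2)) = 2 * Real.pi * σ ^ 2 := by field_simp
  rw [h3, finrank_euclideanSpace, Fintype.card_fin, ← Real.rpow_add (by positivity)]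
  rw [show -(d : ℝ) / 2 + (d : ℝ) / 2 = 0 by ring, Real.rpow_zero]

lemma gaussDensity_integrable (hσ : 0 < σ) :
    Integrable (gaussDensity d σ) := by
  by_contra h
  have := gaussDensity_integral (d := d) hσ
  rw [integral_undef h] at this
  norm_num at this

lemma gaussDensity_mix (hσ : 0 < σ) (ω u w : EuclideanSpace ℝ (Fin d)) (t : ℝ) :
    gaussDensity d σ (ω - u) * (gaussDensity d σ (ω - w) / gaussDensity d σ (ω - u)) ^ t =
      Real.exp (‖w - u‖ ^ 2 / σ ^ 2 * t * (t - 1) / 2) *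
        gaussDensity d σ (ω - (u + t • (w - u))) := by
  unfold gaussDensity
  have hc : 0 < (2 * Real.pi * σ ^ 2) ^ (-(d : ℝ) / 2) := by positivity
  rw [mul_div_mul_left _ _ hc.ne', ← Real.exp_sub, ← Real.exp_mul]
  rw [mul_assoc, mul_left_comm (Real.exp (_ * t * (t - 1) / 2)), ← Real.exp_add, ← Real.exp_add]
  congr 2
  have e1 : ω - w = (ω - u) - (w - u) := by abel
  have e2 : ω - (u + t • (w - u)) = (ω - u) - t • (w - u) := by abel
  rw [e1, e2]
  generalize ω - u = x
  generalize w - u = y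
  have n1 := @norm_sub_sq_real _ _ _ x y
  have n2 := @norm_sub_sq_real _ _ _ x (t • y)
  rw [inner_smul_right, norm_smul, mul_pow, Real.norm_eq_abs, sq_abs] at n2
  rw [n1, n2]
  field_simp
  ring

noncomputable def gaussMeas (d : ℕ) (σ : ℝ) (u : EuclideanSpace ℝ (Fin d)) :
    Measure (EuclideanSpace ℝ (Fin d)) :=
  volume.withDensity (fun ω => ENNReal.ofReal (gaussDensity d σ (ω - u)))

lemma gaussMeas_integral (hσ : 0 < σ) (u : EuclideanSpace ℝ (Fin d))
    (h : EuclideanSpace ℝ (Fin d) → ℝ) :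
    ∫ ω, h ω ∂(gaussMeas d σ u) = ∫ ω, gaussDensity d σ (ω - u) * h ω := by
  unfold gaussMeas
  rw [integral_withDensity_eq_integral_toReal_smul]
  · congr 1; funext ω
    rw [ENNReal.toReal_ofReal (gaussDensity_pos hσ _).le, smul_eq_mul]
  · have : Continuous fun ω => gaussDensity d σ (ω - u) :=
      gaussDensity_cont.comp (by fun_prop)
    exact this.measurable.ennreal_ofReal
  · filter_upwards with x using ENNReal.ofReal_lt_top

lemma gaussMeas_integrable (hσ : 0 < σ) (u : EuclideanSpace ℝ (Fin d))
    (h : EuclideanSpace ℝ (Fin d) → ℝ) :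
    Integrable h (gaussMeas d σ u) ↔ Integrable (fun ω => gaussDensity d σ (ω - u) * h ω) := by
  unfold gaussMeas
  rw [integrable_withDensity_iff_integrable_smul']
  · have : (fun x => (ENNReal.ofReal (gaussDensity d σ (x - u))).toReal • h x) =
      fun ω => gaussDensity d σ (ω - u) * h ω := by
      funext ω
      rw [ENNReal.toReal_ofReal (gaussDensity_pos hσ _).le, smul_eq_mul]
    rw [this]
  · have : Continuous fun ω => gaussDensity d σ (ω - u) :=
      gaussDensity_cont.comp (by fun_prop)
    exact this.measurable.ennreal_ofReal
  · filter_upwards with x using ENNReal.ofReal_lt_top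

lemma gaussMeas_tiltPair (hσ : 0 < σ) (u w : EuclideanSpace ℝ (Fin d)) :
    TiltPair (gaussMeas d σ u)
      (fun ω => gaussDensity d σ (ω - w) / gaussDensity d σ (ω - u)) (‖w - u‖ ^ 2 / σ ^ 2) := by
  have hcont : ∀ u : EuclideanSpace ℝ (Fin d), Continuous fun ω => gaussDensity d σ (ω - u) :=
    fun u => gaussDensity_cont.comp (by fun_prop)
  have hInteg : ∀ u : EuclideanSpace ℝ (Fin d), Integrable fun ω => gaussDensity d σ (ω - u) :=
    fun u => (gaussDensity_integrable hσ).comp_sub_right u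
  have hI1 : ∀ u : EuclideanSpace ℝ (Fin d), ∫ ω, gaussDensity d σ (ω - u) = 1 := fun u => by
    rw [integral_sub_right_eq_self (gaussDensity d σ) u, gaussDensity_integral hσ]
  have hshift : ∀ ω, gaussDensity d σ (ω + (w - u) - w) / gaussDensity d σ (ω + (w - u) - u) =
      Real.exp (‖w - u‖ ^ 2 / σ ^ 2) * (gaussDensity d σ (ω - w) / gaussDensity d σ (ω - u)) := by
    intro ω
    unfold gaussDensity
    have hc : 0 < (2 * Real.pi * σ ^ 2) ^ (-(d : ℝ) / 2) := by positivity
    rw [mul_div_mul_left _ _ hc.ne', ← Real.exp_sub, mul_div_mul_left _ _ hc.ne', ← Real.exp_sub,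
      ← Real.exp_add]
    congr 1
    have e1 : ω + (w - u) - w = ω - u := by abel
    have e2 : ω + (w - u) - u = (ω - u) + (w - u) := by abel
    have e3 : ω - w = (ω - u) - (w - u) := by abel
    rw [e1, e2, e3]
    generalize ω - u = x
    generalize w - u = y
    have n1 := @norm_sub_sq_real _ _ _ x y
    have n2 := @norm_add_sq_real _ _ _ x y
    rw [n1, n2]
    field_simp
    ring
  have key : ∀ k : ℝ → ℝ, (fun ω => gaussDensity d σ (ω - u) *
      ((gaussDensity d σ (ω - w) / gaussDensity d σ (ω - u)) *
        k (gaussDensity d σ (ω - w) / gaussDensity d σ (ω - u)))) =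
      fun ω => (fun ω' => gaussDensity d σ (ω' - u) *
        k (Real.exp (‖w - u‖ ^ 2 / σ ^ 2) * (gaussDensity d σ (ω' - w) / gaussDensity d σ (ω' - u))))
          (ω - (w - u)) := by
    intro k
    funext ω
    have h := hshift (ω - (w - u))
    rw [sub_add_cancel] at h
    simp only
    rw [← h, ← mul_assoc, mul_div_cancel₀ _ (gaussDensity_pos hσ _).ne']
    congr 2
    abel
  refine ⟨⟨?_⟩, ?_, ?_, ?_, ?_, ?_, ?_⟩
  · unfold gaussMeas
    rw [withDensity_apply _ MeasurableSet.univ, Measure.restrict_univ,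
      ← ofReal_integral_eq_lintegral_ofReal (hInteg u)
        (Filter.Eventually.of_forall fun x => (gaussDensity_pos hσ _).le), hI1, ENNReal.ofReal_one]
  · exact ((hcont w).measurable).div (hcont u).measurable
  · intro ω; exact div_pos (gaussDensity_pos hσ _) (gaussDensity_pos hσ _)
  · intro t
    rw [gaussMeas_integrable hσ]
    simp_rw [gaussDensity_mix hσ]
    exact (hInteg _).const_mul _
  · intro t
    rw [gaussMeas_integral hσ]
    simp_rw [gaussDensity_mix hσ]
    rw [integral_const_mul, hI1, mul_one]
  · intro k
    rw [gaussMeas_integral hσ, gaussMeas_integral hσ, key k]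
    exact integral_sub_right_eq_self (fun ω' => gaussDensity d σ (ω' - u) *
        k (Real.exp (‖w - u‖ ^ 2 / σ ^ 2) * (gaussDensity d σ (ω' - w) / gaussDensity d σ (ω' - u)))) (w - u)
  · intro k
    rw [gaussMeas_integrable hσ, gaussMeas_integrable hσ, key k]
    intro h
    exact h.comp_sub_right (w - u)

end Gauss

end PartM1

section PartM2

lemma rpow_sub_le_tangent {x y m : ℝ} (hx : 0 < x) (hy : 0 < y) (hm : 1 ≤ m) :
    y ^ m - x ^ m ≤ m * (y - x) * y ^ (m - 1) := by
  have h := one_add_mul_self_le_rpow_one_add (s := x / y - 1)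
    (by have : 0 < x / y := by positivity
        linarith) hm
  rw [show 1 + (x / y - 1) = x / y by ring, Real.div_rpow hx.le hy.le] at h
  have hym : 0 < y ^ m := by positivity
  rw [le_div_iff₀ hym] at h
  have h2 : y ^ (m - 1) = y ^ m / y := by rw [Real.rpow_sub_one hy.ne']
  rw [h2]
  have : m * (y - x) * (y ^ m / y) = - (m * (x / y - 1)) * y ^ m := by field_simp; ring
  rw [this]
  linarith

lemma rpow_le_interp {T a b l : ℝ} (hT : 0 < T) (hl0 : 0 ≤ l) (hl1 : l ≤ 1) :
    T ^ ((1 - l) * a + l * b) ≤ (1 - l) * T ^ a + l * T ^ b := by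
  have h := Real.geom_mean_le_arith_mean2_weighted (w₁ := 1 - l) (w₂ := l) (p₁ := T ^ a)
    (p₂ := T ^ b) (by linarith) hl0 (by positivity) (by positivity) (by ring)
  rw [← Real.rpow_mul hT.le, ← Real.rpow_mul hT.le, ← Real.rpow_add hT] at h
  rwa [mul_comm (1 - l) a, mul_comm l b]

/-- Riemann-sum comparison. -/
lemma riemann_compare {F B φ : ℝ → ℝ} {Q : ℝ} (hQ : 0 ≤ Q)
    (hF : ∀ a b, 0 ≤ a → a ≤ b → b ≤ Q → F b - F a ≤ (b - a) * φ b)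
    (hB : ∀ a b, 0 ≤ a → a ≤ b → b ≤ Q → (b - a) * φ a ≤ B b - B a) :
    F Q - F 0 ≤ B Q - B 0 := by
  have key : ∀ n : ℕ, 0 < n → F Q - F 0 ≤ B Q - B 0 + (Q * (φ Q - φ 0)) * (1 / n) := by
    intro n hn
    have hn' : (0 : ℝ) < n := by exact_mod_cast hn
    have step : ∀ i : ℕ, i ≤ n → F (i * (Q / n)) - F 0 ≤ B (i * (Q / n)) - B 0 +
        (Q / n) * (φ (i * (Q / n)) - φ 0) := by
      intro i
      induction i with
      | zero => intro _; simp
      | succ i ih =>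
        intro hi
        have ih := ih (by omega)
        have h0 : (0 : ℝ) ≤ i * (Q / n) := by positivity
        have h1 : (i : ℝ) * (Q / n) ≤ ((i + 1 : ℕ) : ℝ) * (Q / n) := by
          push_cast
          have : 0 ≤ Q / n := by positivity
          nlinarith
        have h2 : ((i + 1 : ℕ) : ℝ) * (Q / n) ≤ Q := by
          have : ((i + 1 : ℕ) : ℝ) ≤ n := by exact_mod_cast hi
          calc ((i + 1 : ℕ) : ℝ) * (Q / n) ≤ n * (Q / n) := by gcongr
            _ = Q := by field_simp
        have hd : ((i + 1 : ℕ) : ℝ) * (Q / n) - i * (Q / n) = Q / n := by push_cast; ring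
        have a1 := hF _ _ h0 h1 h2
        have a2 := hB _ _ h0 h1 h2
        rw [hd] at a1 a2
        nlinarith
    have := step n le_rfl
    rw [show (n : ℝ) * (Q / n) = Q by field_simp] at this
    calc _ ≤ _ := this
      _ = _ := by ring
  have hlim : Filter.Tendsto (fun n : ℕ => B Q - B 0 + (Q * (φ Q - φ 0)) * (1 / (n : ℝ)))
      Filter.atTop (nhds (B Q - B 0 + (Q * (φ Q - φ 0)) * 0)) :=
    (tendsto_one_div_atTop_nhds_zero_nat.const_mul _).const_add _
  rw [mul_zero, add_zero] at hlim
  refine ge_of_tendsto hlim ?_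
  filter_upwards [Filter.eventually_gt_atTop 0] with n hn using key n hn

namespace TiltPair
variable {Ω : Type*} [MeasurableSpace Ω] {μ : Measure Ω} {S : Ω → ℝ} {v : ℝ}

lemma int_affine (h : TiltPair μ S v) {a b m : ℝ} (ha : 0 ≤ a) (hb : 0 ≤ b) (hm : 0 ≤ m) :
    Integrable (fun ω => (a + b * S ω) ^ m) μ := by
  have := h.prob
  have hi : Integrable (fun ω => (2 * a) ^ m + (2 * b) ^ m * S ω ^ m) μ :=
    (integrable_const _).add ((h.int m).const_mul _)
  have hmeas := h.meas
  refine hi.mono' (by measurability) ?_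
  filter_upwards with ω
  have hS := h.pos ω
  rw [Real.norm_of_nonneg (by positivity)]
  rw [← Real.mul_rpow (by positivity) hS.le]
  rcases le_total a (b * S ω) with hc | hc
  · calc (a + b * S ω) ^ m ≤ (2 * b * S ω) ^ m := by
          apply Real.rpow_le_rpow (by positivity) _ hm; linarith
      _ ≤ _ := by
          have : 0 ≤ (2 * a) ^ m := by positivity
          linarith
  · calc (a + b * S ω) ^ m ≤ (2 * a) ^ m := by
          apply Real.rpow_le_rpow (by positivity) _ hm; linarith
      _ ≤ _ := by
          have : 0 ≤ (2 * b * S ω) ^ m := by positivity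
          linarith

lemma int_S (h : TiltPair μ S v) : Integrable S μ := by simpa using h.int 1
lemma mom_S (h : TiltPair μ S v) : ∫ ω, S ω ∂μ = 1 := by simpa using h.mom 1
lemma int_S2 (h : TiltPair μ S v) : Integrable (fun ω => S ω ^ 2) μ := by
  simpa using h.int 2
lemma mom_S2 (h : TiltPair μ S v) : ∫ ω, S ω ^ 2 ∂μ = Real.exp v := by
  have := h.mom 2
  simp only [Real.rpow_ofNat] at this
  rw [this]; congr 1; ring
lemma int_S3 (h : TiltPair μ S v) : Integrable (fun ω => S ω ^ 3) μ := by
  have := h.int 3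
  simpa using this
lemma mom_S3 (h : TiltPair μ S v) : ∫ ω, S ω ^ 3 ∂μ = Real.exp (3 * v) := by
  have := h.mom 3
  simp only [Real.rpow_ofNat] at this
  rw [this]; congr 1; ring

lemma affine_mom_le (h : TiltPair μ S v) {a b m : ℝ} (ha : 0 ≤ a) (hb : 0 < b) (hm : 1 ≤ m) :
    ∫ ω, (a + b * S ω) ^ m ∂μ ≤ (a + b * Real.exp (v * (m - 1) / 2)) ^ m := by
  have := h.prob
  set κ := Real.exp (v * (m - 1) / 2) with hκ
  have hκ0 : 0 < κ := Real.exp_pos _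
  set c := a + b * κ with hc
  have hc0 : 0 < c := by positivity
  have hpt : ∀ ω, (a + b * S ω) ^ m ≤ c ^ m * (a / c) + c ^ m * (b * κ / c) * (κ ^ m)⁻¹ * S ω ^ m := by
    intro ω
    have hS := h.pos ω
    have hj := (convexOn_rpow hm).2 (show (1 : ℝ) ∈ Set.Ici 0 by simp)
      (show S ω / κ ∈ Set.Ici 0 by simp; positivity)
      (show 0 ≤ a / c by positivity) (show 0 ≤ b * κ / c by positivity)
      (by rw [← add_div, ← hc, div_self hc0.ne'])
    simp only [smul_eq_mul, mul_one, Real.one_rpow] at hj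
    rw [Real.div_rpow hS.le hκ0.le] at hj
    have e : a + b * S ω = c * (a / c + b * κ / c * (S ω / κ)) := by field_simp
    rw [e, Real.mul_rpow hc0.le (by positivity)]
    calc _ ≤ c ^ m * (a / c + b * κ / c * (S ω ^ m / κ ^ m)) := by gcongr
      _ = _ := by ring
  have hi : Integrable (fun ω => c ^ m * (a / c) + c ^ m * (b * κ / c) * (κ ^ m)⁻¹ * S ω ^ m) μ :=
    (integrable_const _).add ((h.int m).const_mul _)
  calc ∫ ω, (a + b * S ω) ^ m ∂μ ≤ ∫ ω, (c ^ m * (a / c) + c ^ m * (b * κ / c) * (κ ^ m)⁻¹ * S ω ^ m) ∂μ :=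
        integral_mono (h.int_affine ha hb.le (by linarith)) hi hpt
    _ = c ^ m * (a / c) + c ^ m * (b * κ / c) * (κ ^ m)⁻¹ * Real.exp (v * m * (m - 1) / 2) := by
        rw [integral_add (integrable_const _) ((h.int m).const_mul _),
          integral_const_mul (c ^ m * (b * κ / c) * (κ ^ m)⁻¹), h.mom]
        simp
    _ = c ^ m := by
        have : κ ^ m = Real.exp (v * m * (m - 1) / 2) := by
          rw [hκ, ← Real.exp_mul]; congr 1; ring
        rw [this]
        field_simp
        try rw [hc]

lemma deriv_bound (h : TiltPair μ S v) (hv : 0 ≤ v) {α Q : ℝ} (hα : 3 ≤ α) (hQ : 0 < Q) (hQ1 : Q ≤ 1) :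
    Integrable (fun ω => (S ω - 1) * (1 - Q + Q * S ω) ^ (α - 1)) μ ∧
    ∫ ω, (S ω - 1) * (1 - Q + Q * S ω) ^ (α - 1) ∂μ ≤
      (α - 1) * Q * (Real.exp v - 1) *
        (1 - Q + Q * Real.exp (v * (α + 1) / 2)) ^ (α - 2) := by
  set e := Real.exp v with he
  have he1 : 1 ≤ e := Real.one_le_exp hv
  have hQ0 : 0 ≤ 1 - Q := by linarith
  have i1 : Integrable (fun ω => (1 - Q + Q * (e * S ω)) ^ (α - 1)) μ := by
    have := h.int_affine (a := 1 - Q) (b := Q * e) (m := α - 1) hQ0 (by positivity) (by linarith)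
    simpa only [mul_assoc] using this
  have i2 := h.tiltInt (fun s => (1 - Q + Q * s) ^ (α - 1)) i1
  have t2 := h.tilt (fun s => (1 - Q + Q * s) ^ (α - 1))
  have i3 := h.int_affine (a := 1 - Q) (b := Q) (m := α - 1) hQ0 hQ.le (by linarith)
  have i4 : Integrable (fun ω => (1 - Q + Q * (e * (e * S ω))) ^ (α - 2)) μ := by
    have := h.int_affine (a := 1 - Q) (b := Q * e * e) (m := α - 2) hQ0 (by positivity) (by linarith)
    simpa only [mul_assoc] using this
  have i5 := h.tiltInt (fun s => (1 - Q + Q * (e * s)) ^ (α - 2)) i4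
  have t5 := h.tilt (fun s => (1 - Q + Q * (e * s)) ^ (α - 2))
  have efun : (fun ω => (S ω - 1) * (1 - Q + Q * S ω) ^ (α - 1)) =
      fun ω => S ω * (1 - Q + Q * S ω) ^ (α - 1) - (1 - Q + Q * S ω) ^ (α - 1) := by
    funext ω; ring
  constructor
  · rw [efun]; exact i2.sub i3
  rw [efun, integral_sub i2 i3, t2, ← integral_sub i1 i3]
  have hpt : ∀ ω, (1 - Q + Q * (e * S ω)) ^ (α - 1) - (1 - Q + Q * S ω) ^ (α - 1) ≤
      (α - 1) * Q * (e - 1) * (S ω * (1 - Q + Q * (e * S ω)) ^ (α - 2)) := by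
    intro ω
    have hS := h.pos ω
    have := rpow_sub_le_tangent (x := 1 - Q + Q * S ω) (y := 1 - Q + Q * (e * S ω)) (m := α - 1)
      (by positivity) (by positivity) (by linarith)
    rw [show α - 1 - 1 = α - 2 by ring] at this
    calc _ ≤ _ := this
      _ = _ := by ring
  calc _ ≤ ∫ ω, (α - 1) * Q * (e - 1) * (S ω * (1 - Q + Q * (e * S ω)) ^ (α - 2)) ∂μ :=
        integral_mono (i1.sub i3) (i5.const_mul _) hpt
    _ = (α - 1) * Q * (e - 1) * ∫ ω, (1 - Q + Q * e * e * S ω) ^ (α - 2) ∂μ := by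
        rw [integral_const_mul, t5, ← he]
        simp only [mul_assoc]
    _ ≤ _ := by
        have h6 := h.affine_mom_le (a := 1 - Q) (b := Q * e * e) (m := α - 2) hQ0 (by positivity)
          (by linarith)
        have e6 : Q * e * e * Real.exp (v * (α - 2 - 1) / 2) = Q * Real.exp (v * (α + 1) / 2) := by
          rw [he, mul_assoc Q, mul_assoc Q, ← Real.exp_add, ← Real.exp_add]; congr 2; ring
        rw [e6] at h6
        have hh : 0 ≤ (α - 1) * Q * (e - 1) := by
          have : 0 ≤ e - 1 := by linarith
          have : 0 ≤ α - 1 := by linarith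
          positivity
        exact mul_le_mul_of_nonneg_left h6 hh

lemma phi_bound (h : TiltPair μ S v) (hv : 0 ≤ v) {α Q k w : ℝ} (hα : 3 ≤ α) (hQ : 0 ≤ Q) (hQ1 : Q ≤ 1)
    (hk0 : 0 ≤ k) (hk1 : k ≤ 1) (hw : (α - 2) * (Real.exp (v * (α + 1) / 2) - 1) * Q ≤ w)
    (hkw : Real.exp ((1 - k) * w) ≤ 1 + k * w / 2) :
    ∫ ω, (1 - Q + Q * S ω) ^ α ∂μ ≤
      1 + α * (α - 1) / 2 * Q ^ 2 * (Real.exp v - 1) * Real.exp (k * w) := by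
  have := h.prob
  set c := (α - 2) * (Real.exp (v * (α + 1) / 2) - 1) with hc
  have hz : 1 ≤ Real.exp (v * (α + 1) / 2) := Real.one_le_exp (by positivity)
  have hc0 : 0 ≤ c := mul_nonneg (by linarith) (by linarith)
  set C := α * (α - 1) * (Real.exp v - 1) with hC
  have hC0 : 0 ≤ C := by
    have : 0 ≤ Real.exp v - 1 := by linarith [Real.one_le_exp hv]
    have : 0 ≤ α - 1 := by linarith
    positivity
  have hkt : ∀ t, 0 ≤ t → t ≤ w → Real.exp ((1 - k) * t) ≤ 1 + k * t / 2 := by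
    intro t ht htw
    rcases eq_or_lt_of_le (ht.trans htw) with h0 | h0
    · have : t = 0 := by linarith
      subst this; simp
    · have := convexOn_exp.2 (Set.mem_univ (0 : ℝ)) (Set.mem_univ ((1 - k) * w))
        (show 0 ≤ 1 - t / w by rw [sub_nonneg, div_le_one h0]; exact htw)
        (show 0 ≤ t / w by positivity) (by ring)
      simp only [smul_eq_mul, mul_zero, zero_add, Real.exp_zero, mul_one] at this
      rw [show t / w * ((1 - k) * w) = (1 - k) * t by field_simp] at this
      calc _ ≤ _ := this
        _ ≤ 1 - t / w + t / w * (1 + k * w / 2) := by gcongr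
        _ = _ := by field_simp; ring
  have main := riemann_compare (F := fun θ => ∫ ω, (1 - θ + θ * S ω) ^ α ∂μ)
    (B := fun θ => C / 2 * θ ^ 2 * Real.exp (k * (c * θ))) (φ := fun θ => C * θ * Real.exp (c * θ)) hQ ?_ ?_
  · simp only [zero_mul, sub_zero, add_zero, Real.one_rpow, integral_const, probReal_univ, smul_eq_mul,
      mul_one] at main
    have : C / 2 * Q ^ 2 * Real.exp (k * (c * Q)) ≤ C / 2 * Q ^ 2 * Real.exp (k * w) := by gcongr
    have e : C / 2 * Q ^ 2 * Real.exp (k * w) = α * (α - 1) / 2 * Q ^ 2 * (Real.exp v - 1) * Real.exp (k * w) := by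
      rw [hC]; ring
    rw [← e]
    norm_num at main
    linarith
  · intro a b ha hab hbQ
    rcases eq_or_lt_of_le (ha.trans hab) with hb | hb
    · have : a = b := by linarith
      subst this; simp
    have ib := h.int_affine (a := 1 - b) (b := b) (m := α) (by linarith) hb.le (by linarith)
    have ia := h.int_affine (a := 1 - a) (b := a) (m := α) (by linarith) ha (by linarith)
    obtain ⟨id, hd⟩ := h.deriv_bound hv hα hb (by linarith)
    rw [← integral_sub ib ia]
    calc _ ≤ ∫ ω, (b - a) * α * ((S ω - 1) * (1 - b + b * S ω) ^ (α - 1)) ∂μ := by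
          apply integral_mono (ib.sub ia) (id.const_mul _)
          intro ω
          have hS := h.pos ω
          have pb : 0 < 1 - b + b * S ω := by
            have : 0 ≤ 1 - b := by linarith
            positivity
          have pa : 0 < 1 - a + a * S ω := by
            rcases eq_or_lt_of_le ha with h0 | h0
            · rw [← h0]; norm_num
            have : 0 ≤ 1 - a := by linarith
            positivity
          have := rpow_sub_le_tangent pa pb (m := α) (by linarith)
          calc _ ≤ _ := this
            _ = _ := by ring
      _ = (b - a) * α * ∫ ω, ((S ω - 1) * (1 - b + b * S ω) ^ (α - 1)) ∂μ := integral_const_mul _ _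
      _ ≤ (b - a) * α * ((α - 1) * b * (Real.exp v - 1) * Real.exp (c * b)) := by
          have h1 : (1 - b + b * Real.exp (v * (α + 1) / 2)) ^ (α - 2) ≤ Real.exp (c * b) := by
            have h2 : 1 - b + b * Real.exp (v * (α + 1) / 2) ≤
                Real.exp (b * (Real.exp (v * (α + 1) / 2) - 1)) := by
              have := Real.add_one_le_exp (b * (Real.exp (v * (α + 1) / 2) - 1))
              linarith
            have h3 : 0 ≤ 1 - b + b * Real.exp (v * (α + 1) / 2) := by
              have : 0 ≤ 1 - b := by linarith
              positivity
            calc _ ≤ (Real.exp (b * (Real.exp (v * (α + 1) / 2) - 1))) ^ (α - 2) :=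
                  Real.rpow_le_rpow h3 h2 (by linarith)
              _ = _ := by rw [← Real.exp_mul, hc]; congr 1; ring
          have e0 : 0 ≤ Real.exp v - 1 := by linarith [Real.one_le_exp hv]
          have e1 : 0 ≤ α - 1 := by linarith
          have e2 : 0 ≤ b - a := by linarith
          have e3 : 0 ≤ α := by linarith
          have : (α - 1) * b * (Real.exp v - 1) * (1 - b + b * Real.exp (v * (α + 1) / 2)) ^ (α - 2) ≤
            (α - 1) * b * (Real.exp v - 1) * Real.exp (c * b) := by gcongr
          have := hd.trans this
          gcongr
      _ = _ := by rw [hC]; ring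
  · intro a b ha hab hbQ
    rcases eq_or_lt_of_le hab with hb | hb
    · subst hb; simp
    have hder : ∀ x : ℝ, HasDerivAt (fun θ => C / 2 * θ ^ 2 * Real.exp (k * (c * θ)))
        (C * x * Real.exp (k * (c * x)) * (1 + k * (c * x) / 2)) x := by
      intro x
      have h1 : HasDerivAt (fun θ : ℝ => k * (c * θ)) (k * (c * 1)) x :=
        ((hasDerivAt_id x).const_mul c).const_mul k
      have h2 := h1.exp
      have h3 : HasDerivAt (fun θ : ℝ => C / 2 * θ ^ 2) (C / 2 * (2 * x)) x := by
        simpa using (hasDerivAt_pow 2 x).const_mul (C / 2)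
      refine (h3.mul h2).congr_deriv ?_
      ring
    obtain ⟨ξ, hξ, hξe⟩ := exists_hasDerivAt_eq_slope
      (fun θ => C / 2 * θ ^ 2 * Real.exp (k * (c * θ))) _ hb
      (fun x _ => (hder x).continuousAt.continuousWithinAt) (fun x _ => hder x)
    rw [eq_div_iff (by linarith)] at hξe
    rw [← hξe]
    have hξ0 : 0 ≤ ξ := by linarith [hξ.1]
    have h1 : Real.exp (c * ξ) ≤ Real.exp (k * (c * ξ)) * (1 + k * (c * ξ) / 2) := by
      have := hkt (c * ξ) (by positivity) (by
        refine le_trans ?_ hw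
        exact mul_le_mul_of_nonneg_left (by linarith [hξ.2]) hc0)
      calc Real.exp (c * ξ) = Real.exp (k * (c * ξ)) * Real.exp ((1 - k) * (c * ξ)) := by
            rw [← Real.exp_add]; congr 1; ring
        _ ≤ _ := by gcongr
    have h2 : C * a * Real.exp (c * a) ≤ C * ξ * Real.exp (c * ξ) := by
      have := hξ.1
      gcongr
    have h3 : C * ξ * Real.exp (c * ξ) ≤ C * ξ * (Real.exp (k * (c * ξ)) * (1 + k * (c * ξ) / 2)) := by
      gcongr
    have h4 : 0 ≤ b - a := by linarith
    calc (b - a) * (C * a * Real.exp (c * a)) ≤ (b - a) * (C * ξ * (Real.exp (k * (c * ξ)) * (1 + k * (c * ξ) / 2))) := by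
          exact mul_le_mul_of_nonneg_left (h2.trans h3) h4
      _ = _ := by ring

lemma phi_bound_small (h : TiltPair μ S v) (hv : 0 ≤ v) (hv1 : v ≤ 1 / 4) {α Q : ℝ} (hα1 : 1 ≤ α)
    (hα : α ≤ 3) (hQ : 0 ≤ Q) (hQ1 : Q ≤ 1) :
    ∫ ω, (1 - Q + Q * S ω) ^ α ∂μ ≤ 1 + α * (α - 1) * Q ^ 2 * (Real.exp v - 1) := by
  have := h.prob
  have hpos : ∀ ω, 0 < 1 - Q + Q * S ω := by
    intro ω
    have hS := h.pos ω
    rcases eq_or_lt_of_le hQ with h0 | h0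
    · rw [← h0]; norm_num
    have : 0 ≤ 1 - Q := by linarith
    positivity
  set e := Real.exp v with he
  have he1 : 1 ≤ e := Real.one_le_exp hv
  have e3 : Real.exp (3 * v) = e ^ 3 := by rw [he, ← Real.exp_nat_mul]; norm_num
  have he2 : e ≤ 1.2841 := by
    have : e ≤ Real.exp (1 / 4) := Real.exp_le_exp.2 hv1
    have h4 : Real.exp (1 / 4) ^ 4 = Real.exp 1 := by rw [← Real.exp_nat_mul]; norm_num
    have := Real.exp_one_lt_d9
    by_contra hc
    have : (1.2841 : ℝ) ^ 4 < Real.exp (1 / 4) ^ 4 := pow_lt_pow_left₀ (by linarith) (by norm_num) (by norm_num)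
    norm_num at this
    linarith
  have i1 : Integrable (fun ω => 1 - Q + Q * S ω) μ := (integrable_const _).add (h.int_S.const_mul _)
  have m1 : ∫ ω, (1 - Q + Q * S ω) ∂μ = 1 := by
    rw [integral_add (integrable_const _) (h.int_S.const_mul _), integral_const_mul, h.mom_S]; simp
  have ex2 : (fun ω => (1 - Q + Q * S ω) ^ 2) =
      fun ω => ((1 - Q) ^ 2 + 2 * (1 - Q) * Q * S ω) + Q ^ 2 * S ω ^ 2 := by funext ω; ring
  have j1 : Integrable (fun ω => (1 - Q) ^ 2 + 2 * (1 - Q) * Q * S ω) μ :=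
    (integrable_const _).add (h.int_S.const_mul _)
  have i2 : Integrable (fun ω => (1 - Q + Q * S ω) ^ 2) μ := by
    rw [ex2]; exact j1.add (h.int_S2.const_mul _)
  have m2 : ∫ ω, (1 - Q + Q * S ω) ^ 2 ∂μ = 1 + Q ^ 2 * (e - 1) := by
    rw [ex2, integral_add j1 (h.int_S2.const_mul _), integral_add (integrable_const _) (h.int_S.const_mul _),
      integral_const_mul, integral_const_mul, h.mom_S, h.mom_S2]
    simp; ring
  have ex3 : (fun ω => (1 - Q + Q * S ω) ^ 3) =
      fun ω => (((1 - Q) ^ 3 + 3 * (1 - Q) ^ 2 * Q * S ω) + 3 * (1 - Q) * Q ^ 2 * S ω ^ 2) + Q ^ 3 * S ω ^ 3 := by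
    funext ω; ring
  have k1 : Integrable (fun ω => (1 - Q) ^ 3 + 3 * (1 - Q) ^ 2 * Q * S ω) μ :=
    (integrable_const _).add (h.int_S.const_mul _)
  have k2 : Integrable (fun ω => ((1 - Q) ^ 3 + 3 * (1 - Q) ^ 2 * Q * S ω) + 3 * (1 - Q) * Q ^ 2 * S ω ^ 2) μ :=
    k1.add (h.int_S2.const_mul _)
  have i3 : Integrable (fun ω => (1 - Q + Q * S ω) ^ 3) μ := by
    rw [ex3]; exact k2.add (h.int_S3.const_mul _)
  have m3 : ∫ ω, (1 - Q + Q * S ω) ^ 3 ∂μ = (1 - Q) ^ 3 + 3 * (1 - Q) ^ 2 * Q + 3 * (1 - Q) * Q ^ 2 * e + Q ^ 3 * e ^ 3 := by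
    rw [ex3, integral_add k2 (h.int_S3.const_mul _), integral_add k1 (h.int_S2.const_mul _),
      integral_add (integrable_const _) (h.int_S.const_mul _),
      integral_const_mul, integral_const_mul, integral_const_mul, h.mom_S, h.mom_S2, h.mom_S3, e3, ← he]
    simp
  have iα := h.int_affine (a := 1 - Q) (b := Q) (m := α) (by linarith) hQ (by linarith)
  rcases le_total α 2 with h2 | h2
  · calc _ ≤ ∫ ω, ((2 - α) * (1 - Q + Q * S ω) + (α - 1) * (1 - Q + Q * S ω) ^ 2) ∂μ := by
          apply integral_mono iα ((i1.const_mul _).add (i2.const_mul _))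
          intro ω
          simp only [Pi.add_apply]
          have := rpow_le_interp (a := 1) (b := 2) (l := α - 1) (hpos ω) (by linarith) (by linarith)
          rw [show (1 - (α - 1)) * 1 + (α - 1) * 2 = α by ring] at this
          simp only [Real.rpow_one, Real.rpow_ofNat] at this
          calc _ ≤ _ := this
            _ = _ := by ring
      _ = 1 + (α - 1) * Q ^ 2 * (e - 1) := by
          rw [integral_add (i1.const_mul _) (i2.const_mul _), integral_const_mul, integral_const_mul, m1, m2]
          ring
      _ ≤ _ := by
          have : 0 ≤ (α - 1) * Q ^ 2 * (e - 1) :=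
            mul_nonneg (mul_nonneg (by linarith) (sq_nonneg _)) (by linarith)
          nlinarith
  · calc _ ≤ ∫ ω, ((3 - α) * (1 - Q + Q * S ω) ^ 2 + (α - 2) * (1 - Q + Q * S ω) ^ 3) ∂μ := by
          apply integral_mono iα ((i2.const_mul _).add (i3.const_mul _))
          intro ω
          simp only [Pi.add_apply]
          have := rpow_le_interp (a := 2) (b := 3) (l := α - 2) (hpos ω) (by linarith) (by linarith)
          rw [show (1 - (α - 2)) * 2 + (α - 2) * 3 = α by ring] at this
          simp only [Real.rpow_ofNat] at this
          calc _ ≤ _ := this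
            _ = _ := by ring
      _ = 1 + Q ^ 2 * (e - 1) * ((3 - α) + (α - 2) * (3 + Q * (e ^ 2 + e - 2))) := by
          rw [integral_add (i2.const_mul _) (i3.const_mul _), integral_const_mul, integral_const_mul, m2, m3]
          ring
      _ ≤ 1 + Q ^ 2 * (e - 1) * (α * (α - 1)) := by
          have h1 : Q * (e ^ 2 + e - 2) ≤ 1 := by nlinarith
          have h5 : (3 - α) + (α - 2) * (3 + Q * (e ^ 2 + e - 2)) ≤ α * (α - 1) := by
            nlinarith [sq_nonneg (α - 2)]
          have h4 : 0 ≤ e - 1 := by linarith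
          gcongr
      _ = _ := by ring

end TiltPair

end PartM2

section PartM3

lemma exp_le_affine_16 {v : ℝ} (hv : 0 ≤ v) (hv1 : v ≤ 1 / 16) : Real.exp v - 1 ≤ 1.07 * v := by
  have h := Real.exp_bound' (x := v) hv (by linarith) (n := 2) (by norm_num)
  norm_num [Finset.sum_range_succ, Nat.factorial] at h
  nlinarith

lemma neg_rpow_tangent {x y β : ℝ} (hx : 0 < x) (hy : 0 < y) (hβ : 0 ≤ β) :
    y ^ (-β) - β * y ^ (-β - 1) * (x - y) ≤ x ^ (-β) := by
  have h1 : 1 - β * (x / y - 1) ≤ (x / y) ^ (-β) := by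
    have hxy : 0 < x / y := by positivity
    rw [Real.rpow_def_of_pos hxy]
    have h2 := Real.add_one_le_exp (Real.log (x / y) * -β)
    have h3 := Real.log_le_sub_one_of_pos hxy
    nlinarith
  rw [Real.div_rpow hx.le hy.le] at h1
  have hyb : 0 < y ^ (-β) := by positivity
  rw [le_div_iff₀ hyb] at h1
  rw [Real.rpow_sub_one hy.ne']
  calc _ = (1 - β * (x / y - 1)) * y ^ (-β) := by field_simp
    _ ≤ _ := h1

lemma neg_rpow_quad {q y β : ℝ} (hq0 : 0 ≤ q) (hq : q < 1) (hy : -q ≤ y) (hβ : 0 ≤ β) :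
    (1 + y) ^ (-β) ≤ 1 - β * y + β * (β + 1) / 2 * (1 - q) ^ (-β - 2) * y ^ 2 := by
  set C := (1 - q) ^ (-β - 2) with hC
  have hC1 : 1 ≤ C := by
    rw [hC]
    exact Real.one_le_rpow_of_pos_of_le_one_of_nonpos (by linarith) (by linarith) (by linarith)
  set h : ℝ → ℝ := fun y => 1 - β * y + β * (β + 1) / 2 * C * y ^ 2 - (1 + y) ^ (-β) with hh
  have hder : ∀ y, -q ≤ y → HasDerivAt h (β * ((1 + y) ^ (-β - 1) - 1 + (β + 1) * C * y)) y := by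
    intro y hy
    have hp : 0 < 1 + y := by linarith
    have d1 : HasDerivAt (fun y : ℝ => (1 + y) ^ (-β)) (1 * (-β) * (1 + y) ^ (-β - 1)) y :=
      ((hasDerivAt_id y).const_add 1).rpow_const (Or.inl hp.ne')
    have d2 : HasDerivAt (fun y : ℝ => 1 - β * y) (-(β * 1)) y :=
      ((hasDerivAt_id y).const_mul β).const_sub 1
    have d3 : HasDerivAt (fun y : ℝ => β * (β + 1) / 2 * C * y ^ 2) (β * (β + 1) / 2 * C * (2 * y)) y := by
      simpa using (hasDerivAt_pow 2 y).const_mul (β * (β + 1) / 2 * C)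
    refine ((d2.add d3).sub d1).congr_deriv ?_
    ring
  have h0 : h 0 = 0 := by simp [hh]
  suffices 0 ≤ h y by simp only [hh] at this; linarith
  rcases le_total 0 y with hy0 | hy0
  · have mono : MonotoneOn h (Set.Icc 0 y) := by
      apply monotoneOn_of_hasDerivWithinAt_nonneg (convex_Icc 0 y)
        (f' := fun y => β * ((1 + y) ^ (-β - 1) - 1 + (β + 1) * C * y))
      · intro x hx; exact (hder x (by linarith [hx.1])).continuousAt.continuousWithinAt
      · intro x hx
        rw [interior_Icc] at hx
        exact (hder x (by linarith [hx.1])).hasDerivWithinAt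
      · intro x hx
        rw [interior_Icc] at hx
        have hx0 := hx.1
        have := neg_rpow_tangent (x := 1 + x) (y := 1) (β := β + 1) (by linarith) (by norm_num) (by linarith)
        simp only [Real.one_rpow] at this
        rw [show -(β + 1) = -β - 1 by ring] at this
        have h2 : (β + 1) * x ≤ (β + 1) * C * x := by
          have : 0 ≤ (β + 1) * x := by positivity
          nlinarith
        apply mul_nonneg hβ
        linarith
    have := mono (Set.left_mem_Icc.2 hy0) (Set.right_mem_Icc.2 hy0) hy0
    linarith
  · have anti : AntitoneOn h (Set.Icc y 0) := by
      apply antitoneOn_of_hasDerivWithinAt_nonpos (convex_Icc y 0)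
        (f' := fun y => β * ((1 + y) ^ (-β - 1) - 1 + (β + 1) * C * y))
      · intro x hx; exact (hder x (by linarith [hx.1])).continuousAt.continuousWithinAt
      · intro x hx
        rw [interior_Icc] at hx
        exact (hder x (by linarith [hx.1])).hasDerivWithinAt
      · intro x hx
        rw [interior_Icc] at hx
        have hx0 := hx.2
        have hx1 := hx.1
        have := neg_rpow_tangent (x := 1) (y := 1 + x) (β := β + 1) (by linarith) (by linarith) (by linarith)
        simp only [Real.one_rpow] at this
        rw [show -(β + 1) - 1 = -β - 2 by ring, show -(β + 1) = -β - 1 by ring] at this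
        have hD : (1 + x) ^ (-β - 2) ≤ C :=
          Real.rpow_le_rpow_of_nonpos (by linarith) (by linarith) (by linarith)
        have h2 : (β + 1) * (1 + x) ^ (-β - 2) * (1 - (1 + x)) ≤ (β + 1) * C * (-x) := by
          rw [show 1 - (1 + x) = -x by ring]
          have : 0 ≤ -x := by linarith
          gcongr
        apply mul_nonpos_of_nonneg_of_nonpos hβ
        linarith
    have := anti (Set.left_mem_Icc.2 hy0) (Set.right_mem_Icc.2 hy0) hy0
    linarith

namespace TiltPair
variable {Ω : Type*} [MeasurableSpace Ω] {μ : Measure Ω} {S : Ω → ℝ} {v : ℝ}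

lemma int_neg (h : TiltPair μ S v) {α q : ℝ} (hα : 1 < α) (hq0 : 0 < q) (hq : q ≤ 1 / 5) :
    Integrable (fun ω => (1 - q + q * S ω) ^ (1 - α)) μ := by
  have := h.prob
  have hmeas := h.meas
  refine (integrable_const ((1 - q) ^ (1 - α))).mono' (Measurable.aestronglyMeasurable
    (((hmeas.const_mul q).const_add (1 - q)).pow_const (1 - α))) ?_
  filter_upwards with ω
  have hS := h.pos ω
  have hp : 0 < 1 - q := by linarith
  rw [Real.norm_of_nonneg (by positivity)]
  have : 0 < q * S ω := by positivity
  exact Real.rpow_le_rpow_of_nonpos hp (by linarith) (by linarith)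

lemma dir1_bound (h : TiltPair μ S v) (hv : 0 ≤ v) {α q u : ℝ} (hvu : v ≤ u) (hu : u ≤ 1 / 16)
    (hα : 1 < α) (hq0 : 0 < q) (hq : q ≤ 1 / 5) :
    ∫ ω, (1 - q + q * S ω) ^ (1 - α) ∂μ ≤ Real.exp (2 * α * (α - 1) * q ^ 2 * u) := by
  have := h.prob
  have hp : 0 < 1 - q := by linarith
  rcases le_total 1 (3 * (q * (α - 1)) + 4 * q) with hc | hc
  · have hpt : ∀ ω, (1 - q + q * S ω) ^ (1 - α) ≤ S ω ^ (q * (1 - α)) := by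
      intro ω
      have hS := h.pos ω
      have hg := Real.geom_mean_le_arith_mean2_weighted (w₁ := 1 - q) (w₂ := q) (p₁ := 1)
        (p₂ := S ω) hp.le hq0.le zero_le_one hS.le (by ring)
      simp only [Real.one_rpow, one_mul, mul_one] at hg
      rw [Real.rpow_mul hS.le]
      exact Real.rpow_le_rpow_of_nonpos (by positivity) hg (by linarith)
    calc _ ≤ ∫ ω, S ω ^ (q * (1 - α)) ∂μ := integral_mono (h.int_neg hα hq0 hq) (h.int _) hpt
      _ = Real.exp (v * (q * (1 - α)) * (q * (1 - α) - 1) / 2) := h.mom _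
      _ ≤ _ := by
          apply Real.exp_le_exp.2
          have e1 : v * (q * (1 - α)) * (q * (1 - α) - 1) / 2 = v * ((q * (α - 1)) * (q * (α - 1) + 1) / 2) := by ring
          have e2 : 2 * α * (α - 1) * q ^ 2 * u = u * ((q * (α - 1)) * (4 * (q * (α - 1)) + 4 * q) / 2) := by ring
          rw [e1, e2]
          have hs : 0 < q * (α - 1) := mul_pos hq0 (by linarith)
          have : q * (α - 1) + 1 ≤ 4 * (q * (α - 1)) + 4 * q := by linarith
          have hu0 : 0 ≤ u := hv.trans hvu
          gcongr
  · set C := (1 - q) ^ (-(α - 1) - 2) with hC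
    have hα0 : 0 < α - 1 := by linarith
    have hC0 : 0 < C := by positivity
    have hC1 : C ≤ 1.82 := by
      have hlog : -Real.log (1 - q) ≤ 1.25 * q := by
        have := Real.one_sub_inv_le_log_of_pos hp
        have h2 : (1 - q)⁻¹ ≤ 1 + 1.25 * q := by
          rw [inv_le_iff_one_le_mul₀ hp]; nlinarith
        linarith
      rw [hC, Real.rpow_def_of_pos hp]
      have : Real.log (1 - q) * (-(α - 1) - 2) ≤ 0.584 := by
        have : Real.log (1 - q) * (-(α - 1) - 2) = (-Real.log (1 - q)) * (α + 1) := by ring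
        rw [this]
        have h3 : (-Real.log (1 - q)) * (α + 1) ≤ 1.25 * q * (α + 1) := by
          gcongr
        nlinarith
      calc _ ≤ Real.exp 0.584 := Real.exp_le_exp.2 this
        _ ≤ 1.82 := by
          have h := Real.exp_bound' (x := 0.584) (by norm_num) (by norm_num) (n := 5) (by norm_num)
          norm_num [Finset.sum_range_succ, Nat.factorial] at h
          norm_num
          linarith
    have hpt : ∀ ω, (1 - q + q * S ω) ^ (1 - α) ≤
        (1 + (α - 1) * q * 1 - (α - 1) * q * S ω) +
          (α - 1) * α / 2 * C * q ^ 2 * (S ω ^ 2 - 2 * S ω + 1) := by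
      intro ω
      have hS := h.pos ω
      have := neg_rpow_quad (q := q) (y := q * (S ω - 1)) (β := α - 1) hq0.le (by linarith)
        (by nlinarith) (by linarith)
      rw [show 1 + q * (S ω - 1) = 1 - q + q * S ω by ring, show -(α - 1) = 1 - α by ring] at this
      rw [show 1 - α - 2 = -(α - 1) - 2 by ring, ← hC] at this
      calc _ ≤ _ := this
        _ = _ := by ring
    have j1 : Integrable (fun ω => 1 + (α - 1) * q * 1 - (α - 1) * q * S ω) μ :=
      (integrable_const _).sub (h.int_S.const_mul _)
    have j2 : Integrable (fun ω => S ω ^ 2 - 2 * S ω) μ := h.int_S2.sub (h.int_S.const_mul _)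
    have j3 : Integrable (fun ω => S ω ^ 2 - 2 * S ω + 1) μ := j2.add (integrable_const _)
    calc _ ≤ ∫ ω, ((1 + (α - 1) * q * 1 - (α - 1) * q * S ω) +
          (α - 1) * α / 2 * C * q ^ 2 * (S ω ^ 2 - 2 * S ω + 1)) ∂μ :=
          integral_mono (h.int_neg hα hq0 hq) (j1.add (j3.const_mul _)) hpt
      _ = 1 + (α - 1) * α / 2 * C * q ^ 2 * (Real.exp v - 1) := by
          rw [integral_add j1 (j3.const_mul _), integral_sub (integrable_const _) (h.int_S.const_mul _),
            integral_const_mul, integral_const_mul ((α - 1) * α / 2 * C * q ^ 2),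
            integral_add j2 (integrable_const _), integral_sub h.int_S2 (h.int_S.const_mul _),
            integral_const_mul, h.mom_S, h.mom_S2]
          simp only [integral_const, probReal_univ, smul_eq_mul, one_mul]
          ring
      _ ≤ 1 + 2 * α * (α - 1) * q ^ 2 * u := by
          have h1 := exp_le_affine_16 hv (hvu.trans hu)
          have h2 : Real.exp v - 1 ≤ 1.07 * u := by linarith
          have h3 : 0 ≤ Real.exp v - 1 := by linarith [Real.one_le_exp hv]
          have h4 : C * (Real.exp v - 1) ≤ 4 * u := by nlinarith
          have : (α - 1) * α / 2 * q ^ 2 * (C * (Real.exp v - 1)) ≤ (α - 1) * α / 2 * q ^ 2 * (4 * u) := by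
            gcongr
          linarith
      _ ≤ _ := by
          have := Real.add_one_le_exp (2 * α * (α - 1) * q ^ 2 * u)
          linarith

end TiltPair

end PartM3

section PartM4

section Binom
variable {q : ℝ} {n : ℕ}

lemma binPMF_nonneg (hq0 : 0 < q) (hq1 : q < 1) (n k : ℕ) : 0 ≤ binPMF q n k := by
  unfold binPMF
  have : 0 < 1 - q := by linarith
  positivity

lemma binPMF_pos (hq0 : 0 < q) (hq1 : q < 1) {n k : ℕ} (hk : k ≤ n) : 0 < binPMF q n k := by
  unfold binPMF
  have : 0 < 1 - q := by linarith
  have : 0 < n.choose k := Nat.choose_pos hk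
  positivity

lemma binPMF_ratio (hq1 : q < 1) (n k : ℕ) :
    binPMF q n (k + 1) = ((n - k : ℕ) : ℝ) * q / ((k + 1) * (1 - q)) * binPMF q n k := by
  unfold binPMF
  have hp : 0 < 1 - q := by linarith
  rcases lt_or_ge k n with h | h
  · have h1 : (n.choose (k + 1) : ℝ) * (k + 1) = n.choose k * ((n - k : ℕ) : ℝ) := by
      exact_mod_cast Nat.choose_succ_right_eq n k
    have h2 : n - k = (n - (k + 1)) + 1 := by omega
    have h3 : (1 - q) ^ (n - k) = (1 - q) ^ (n - (k + 1)) * (1 - q) := by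
      rw [← pow_succ, ← h2]
    rw [h3]
    have h4 : (n.choose (k + 1) : ℝ) = n.choose k * ((n - k : ℕ) : ℝ) / (k + 1) := by
      rw [← h1]; field_simp
    rw [h4]
    field_simp
    ring
  · rw [Nat.choose_eq_zero_of_lt (by omega), Nat.sub_eq_zero_of_le h]; simp

lemma binPMF_le_succ (hq0 : 0 < q) (hq1 : q < 1) {n k : ℕ} (hk : (k + 1 : ℝ) ≤ q * n) :
    binPMF q n k ≤ binPMF q n (k + 1) := by
  rw [binPMF_ratio hq1]
  have hp : 0 < 1 - q := by linarith
  have hn : (0 : ℝ) ≤ n := by positivity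
  have hkn : k ≤ n := by
    have : (k : ℝ) ≤ n := by nlinarith
    exact_mod_cast this
  have h1 : 1 ≤ ((n - k : ℕ) : ℝ) * q / ((k + 1) * (1 - q)) := by
    rw [Nat.cast_sub hkn, le_div_iff₀ (by positivity)]
    nlinarith
  have := binPMF_nonneg hq0 hq1 n k
  nlinarith

lemma binPMF_logconc (hq0 : 0 < q) (hq1 : q < 1) (n a j m : ℕ) (haj : a ≤ j) :
    binPMF q n a * binPMF q n (j + m) ≤ binPMF q n (a + m) * binPMF q n j := by
  have hp : 0 < 1 - q := by linarith
  induction m with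
  | zero => simp
  | succ m ih =>
    rw [← add_assoc, ← add_assoc, binPMF_ratio hq1 n (j + m), binPMF_ratio hq1 n (a + m)]
    have hr : ((n - (j + m) : ℕ) : ℝ) * q / (((j + m : ℕ) + 1) * (1 - q)) ≤
        ((n - (a + m) : ℕ) : ℝ) * q / (((a + m : ℕ) + 1) * (1 - q)) := by
      have h1 : ((n - (j + m) : ℕ) : ℝ) ≤ ((n - (a + m) : ℕ) : ℝ) := by
        exact_mod_cast Nat.sub_le_sub_left (by omega) n
      have h2 : ((a + m : ℕ) : ℝ) ≤ ((j + m : ℕ) : ℝ) := by exact_mod_cast (by omega)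
      gcongr
    have n1 := binPMF_nonneg hq0 hq1 n (a + m)
    have n2 := binPMF_nonneg hq0 hq1 n j
    have r0 : 0 ≤ ((n - (j + m) : ℕ) : ℝ) * q / (((j + m : ℕ) + 1) * (1 - q)) := by positivity
    calc _ = ((n - (j + m) : ℕ) : ℝ) * q / (((j + m : ℕ) + 1) * (1 - q)) *
          (binPMF q n a * binPMF q n (j + m)) := by ring
      _ ≤ ((n - (j + m) : ℕ) : ℝ) * q / (((j + m : ℕ) + 1) * (1 - q)) *
          (binPMF q n (a + m) * binPMF q n j) := by gcongr
      _ ≤ ((n - (a + m) : ℕ) : ℝ) * q / (((a + m : ℕ) + 1) * (1 - q)) *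
          (binPMF q n (a + m) * binPMF q n j) := by gcongr
      _ = _ := by ring

noncomputable def binTail (q : ℝ) (n a : ℕ) : ℝ := ∑ j ∈ Finset.Ico a (n + 1), binPMF q n j

lemma binPMF_sum (q : ℝ) (n : ℕ) : ∑ j ∈ Finset.range (n + 1), binPMF q n j = 1 := by
  have := add_pow q (1 - q) n
  rw [show q + (1 - q) = 1 by ring, one_pow] at this
  rw [this]
  apply Finset.sum_congr rfl
  intro j _
  unfold binPMF; ring

lemma binTail_eq (q : ℝ) {n a : ℕ} (ha : 1 ≤ a) (han : a ≤ n) :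
    1 - binCDF q n (a - 1) = binTail q n a := by
  unfold binCDF binTail
  rw [show a - 1 + 1 = a by omega, ← binPMF_sum q n, Finset.range_eq_Ico,
    ← Finset.sum_Ico_consecutive _ (Nat.zero_le a) (show a ≤ n + 1 by omega),
    Finset.range_eq_Ico]
  ring

lemma binTail_pos (hq0 : 0 < q) (hq1 : q < 1) {n a : ℕ} (h : a ≤ n) : 0 < binTail q n a := by
  unfold binTail
  apply Finset.sum_pos
  · intro j hj
    rw [Finset.mem_Ico] at hj
    exact binPMF_pos hq0 hq1 (by omega)
  · exact ⟨a, by simp; omega⟩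

lemma binTail_head (q : ℝ) {n a : ℕ} (h : a ≤ n) : binTail q n a = binPMF q n a + binTail q n (a + 1) := by
  unfold binTail
  rw [Finset.sum_eq_sum_Ico_succ_bot (by omega)]

/-- the tail ratio comparison -/
lemma binTail_ratio (hq0 : 0 < q) (hq1 : q < 1) {n a j : ℕ} (haj : a ≤ j) (hj : j ≤ n) :
    binPMF q n a * binTail q n (j + 1) ≤ binTail q n (a + 1) * binPMF q n j := by
  unfold binTail
  rw [Finset.mul_sum, Finset.sum_mul]
  rw [Finset.sum_Ico_eq_sum_range, Finset.sum_Ico_eq_sum_range]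
  calc _ ≤ ∑ k ∈ Finset.range (n + 1 - (j + 1)), binPMF q n (a + 1 + k) * binPMF q n j := by
        apply Finset.sum_le_sum
        intro k _
        have := binPMF_logconc hq0 hq1 n a j (1 + k) haj
        rw [← add_assoc, ← add_assoc] at this
        exact this
    _ ≤ _ := by
        apply Finset.sum_le_sum_of_subset_of_nonneg
        · intro x; simp only [Finset.mem_range]; omega
        · intro i _ _
          exact mul_nonneg (binPMF_nonneg hq0 hq1 _ _) (binPMF_nonneg hq0 hq1 _ _)

lemma binPMF_pascal (q : ℝ) (n k : ℕ) :
    binPMF q (n + 1) (k + 1) = (1 - q) * binPMF q n (k + 1) + q * binPMF q n k := by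
  unfold binPMF
  rcases lt_or_ge k n with h | h
  · have h2 : n - k = (n - (k + 1)) + 1 := by omega
    rw [Nat.choose_succ_succ, show n + 1 - (k + 1) = n - k by omega, h2]
    push_cast
    ring
  · rw [Nat.choose_succ_succ, show n + 1 - (k + 1) = n - k by omega,
      Nat.choose_eq_zero_of_lt (show n < k + 1 by omega)]
    push_cast
    ring

lemma binPMF_pascal_zero (q : ℝ) (n : ℕ) :
    binPMF q (n + 1) 0 = (1 - q) * binPMF q n 0 := by
  unfold binPMF
  simp [pow_succ]; ring

lemma binTail_succ (q : ℝ) {n k : ℕ} (hk : k ≤ n) :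
    binTail q (n + 1) (k + 1) = binTail q n (k + 1) + q * binPMF q n k := by
  unfold binTail
  have e1 : ∑ j ∈ Finset.Ico (k + 1) (n + 1 + 1), binPMF q (n + 1) j =
      ∑ j ∈ Finset.Ico k (n + 1), binPMF q (n + 1) (j + 1) := by
    rw [Finset.sum_Ico_add' (fun j => binPMF q (n + 1) j) k (n + 1) 1]
  have e2 : ∑ j ∈ Finset.Ico k (n + 1), binPMF q n (j + 1) = ∑ j ∈ Finset.Ico (k + 1) (n + 1), binPMF q n j := by
    rw [Finset.sum_Ico_add' (fun j => binPMF q n j) k (n + 1) 1, Finset.sum_Ico_succ_top (by omega)]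
    have : binPMF q n (n + 1) = 0 := by unfold binPMF; simp
    rw [this, add_zero]
  rw [e1]
  simp_rw [binPMF_pascal]
  rw [Finset.sum_add_distrib, ← Finset.mul_sum, ← Finset.mul_sum, e2]
  rw [Finset.sum_eq_sum_Ico_succ_bot (show k < n + 1 by omega)]
  ring

lemma rho_step (hq0 : 0 < q) (hq1 : q < 1) {n k : ℕ} (hk : (k + 1 : ℝ) ≤ q * n) :
    binPMF q (n + 1) k / binTail q (n + 1) (k + 1) ≤ binPMF q n k / binTail q n (k + 1) := by
  have hkn : k + 1 ≤ n := by
    have hn : (0 : ℝ) ≤ n := by positivity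
    have : (k + 1 : ℝ) ≤ n := by nlinarith
    exact_mod_cast this
  have t1 := binTail_pos hq0 hq1 hkn
  have t2 := binTail_pos hq0 hq1 (show k + 1 ≤ n + 1 by omega)
  rw [div_le_div_iff₀ t2 t1, binTail_succ q (show k ≤ n by omega)]
  have p0 := binPMF_nonneg hq0 hq1 n k
  have hle : binPMF q (n + 1) k ≤ binPMF q n k := by
    rcases k with _ | k
    · rw [binPMF_pascal_zero]; nlinarith
    · rw [binPMF_pascal]
      have := binPMF_le_succ hq0 hq1 (n := n) (k := k) (by push_cast at hk; linarith)
      nlinarith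
  have : binPMF q (n + 1) k * binTail q n (k + 1) ≤ binPMF q n k * binTail q n (k + 1) := by gcongr
  nlinarith [mul_nonneg hq0.le (mul_nonneg p0 p0)]

lemma rho_mono (hq0 : 0 < q) (hq1 : q < 1) {N n k : ℕ} (hk : (k + 1 : ℝ) ≤ q * N) (hn : N ≤ n) :
    binPMF q n k / binTail q n (k + 1) ≤ binPMF q N k / binTail q N (k + 1) := by
  induction n, hn using Nat.le_induction with
  | base => exact le_rfl
  | succ n hn ih =>
    refine (rho_step hq0 hq1 ?_).trans ih
    have : (N : ℝ) ≤ n := by exact_mod_cast hn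
    nlinarith

end Binom

end PartM4

section PartM5

section Comb
variable {ι : Type*} [DecidableEq ι]

lemma sum_filter_card (D : Finset ι) (m : ℕ) (h : Finset ι → ℝ) :
    ∑ J ∈ D.powerset.filter (fun J => m ≤ J.card), h J =
      ∑ j ∈ Finset.Ico m (D.card + 1), ∑ J ∈ D.powersetCard j, h J := by
  rw [Finset.sum_filter, Finset.sum_powerset]
  have hj : ∀ j, ∑ J ∈ D.powersetCard j, (if m ≤ J.card then h J else 0) =
      if m ≤ j then ∑ J ∈ D.powersetCard j, h J else 0 := by
    intro j
    split_ifs with hm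
    · apply Finset.sum_congr rfl
      intro J hJ
      rw [Finset.mem_powersetCard] at hJ
      rw [if_pos (by omega)]
    · apply Finset.sum_eq_zero
      intro J hJ
      rw [Finset.mem_powersetCard] at hJ
      rw [if_neg (by omega)]
  simp_rw [hj]
  rw [← Finset.sum_filter]
  apply Finset.sum_congr _ (fun _ _ => rfl)
  ext j; simp; omega

lemma sum_weights (q : ℝ) (D : Finset ι) (m : ℕ) :
    ∑ J ∈ D.powerset.filter (fun J => m ≤ J.card), q ^ J.card * (1 - q) ^ (D.card - J.card) =
      binTail q D.card m := by
  rw [sum_filter_card]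
  unfold binTail
  apply Finset.sum_congr rfl
  intro j _
  rw [Finset.sum_congr rfl (g := fun _ => q ^ j * (1 - q) ^ (D.card - j))]
  · rw [Finset.sum_const, Finset.card_powersetCard, nsmul_eq_mul]; unfold binPMF; ring
  · intro J hJ
    rw [Finset.mem_powersetCard] at hJ
    rw [hJ.2]

lemma sum_insert (q : ℝ) (D : Finset ι) (a : ι) (ha : a ∉ D) (k : ℕ) (g : Finset ι → ℝ) :
    ∑ J ∈ (insert a D).powerset.filter (fun J => k + 1 ≤ J.card),
        q ^ J.card * (1 - q) ^ ((insert a D).card - J.card) * g J =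
      ∑ J ∈ D.powerset.filter (fun J => k + 1 ≤ J.card),
        q ^ J.card * (1 - q) ^ (D.card - J.card) * ((1 - q) * g J + q * g (insert a J)) +
      q * ∑ K ∈ D.powersetCard k, q ^ k * (1 - q) ^ (D.card - k) * g (insert a K) := by
  rw [Finset.sum_filter, Finset.sum_powerset_insert ha, Finset.sum_filter]
  have e3 : ∑ K ∈ D.powersetCard k, q ^ k * (1 - q) ^ (D.card - k) * g (insert a K) =
      ∑ K ∈ D.powerset, if K.card = k then q ^ K.card * (1 - q) ^ (D.card - K.card) * g (insert a K) else 0 := by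
    rw [← Finset.sum_filter]
    have : D.powerset.filter (fun K => K.card = k) = D.powersetCard k := by
      ext K; simp [Finset.mem_powersetCard]
    rw [this]
    apply Finset.sum_congr rfl
    intro K hK
    rw [Finset.mem_powersetCard] at hK
    rw [hK.2]
  rw [e3, Finset.mul_sum, ← Finset.sum_add_distrib, ← Finset.sum_add_distrib]
  apply Finset.sum_congr rfl
  intro J hJ
  rw [Finset.mem_powerset] at hJ
  have haJ : a ∉ J := fun h => ha (hJ h)
  have hc := Finset.card_le_card hJ
  rw [Finset.card_insert_of_notMem haJ, Finset.card_insert_of_notMem ha]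
  rw [show D.card + 1 - (J.card + 1) = D.card - J.card by omega,
    show D.card + 1 - J.card = D.card - J.card + 1 by omega]
  rcases lt_trichotomy J.card k with h | h | h
  · rw [if_neg (by omega), if_neg (by omega), if_neg (by omega), if_neg (by omega)]; simp
  · rw [if_neg (by omega), if_pos (by omega), if_neg (by omega), if_pos (by omega)]; ring
  · rw [if_pos (by omega), if_pos (by omega), if_pos (by omega), if_neg (by omega)]; ring

lemma sum_erase (D : Finset ι) (j : ℕ) (hj : j + 1 ≤ D.card) (G : Finset ι → ℝ) :
    ∑ J ∈ D.powersetCard (j + 1), ∑ i ∈ J, G (J.erase i) =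
      ((D.card - j : ℕ) : ℝ) * ∑ K ∈ D.powersetCard j, G K := by
  have h2 : ((D.card - j : ℕ) : ℝ) * ∑ K ∈ D.powersetCard j, G K =
      ∑ K ∈ D.powersetCard j, ∑ i ∈ D \ K, G K := by
    rw [Finset.mul_sum]
    apply Finset.sum_congr rfl
    intro K hK
    rw [Finset.mem_powersetCard] at hK
    rw [Finset.sum_const, nsmul_eq_mul, Finset.card_sdiff_of_subset hK.1, hK.2]
  rw [h2, Finset.sum_sigma', Finset.sum_sigma']
  refine Finset.sum_bij' (fun x _ => ⟨x.1.erase x.2, x.2⟩) (fun x _ => ⟨insert x.2 x.1, x.2⟩) ?_ ?_ ?_ ?_ ?_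
  · rintro ⟨J, i⟩ h
    simp only [Finset.mem_sigma, Finset.mem_powersetCard, Finset.mem_sdiff] at h ⊢
    refine ⟨⟨(Finset.erase_subset _ _).trans h.1.1, ?_⟩, h.1.1 h.2, by simp⟩
    rw [Finset.card_erase_of_mem h.2]; omega
  · rintro ⟨K, i⟩ h
    simp only [Finset.mem_sigma, Finset.mem_powersetCard, Finset.mem_sdiff] at h ⊢
    refine ⟨⟨Finset.insert_subset h.2.1 h.1.1, ?_⟩, by simp⟩
    rw [Finset.card_insert_of_notMem h.2.2]; omega
  · rintro ⟨J, i⟩ h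
    simp only [Finset.mem_sigma] at h
    simp [Finset.insert_erase h.2]
  · rintro ⟨K, i⟩ h
    simp only [Finset.mem_sigma, Finset.mem_sdiff] at h
    simp [Finset.erase_insert h.2.2]
  · rintro ⟨J, i⟩ h
    rfl

/-- The coupling identity. -/
lemma coupling_identity (q : ℝ) (D : Finset ι) (k : ℕ) (hk : k + 1 ≤ D.card) (F : ℕ → ℝ)
    (hF0 : F (k + 1) = binPMF q D.card k) (hFn : F (D.card + 1) = 0) (G : Finset ι → ℝ) :
    ∑ J ∈ D.powerset.filter (fun J => k + 1 ≤ J.card),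
      ((q ^ J.card * (1 - q) ^ (D.card - J.card) - F (J.card + 1) / D.card.choose J.card) * G J +
        ∑ i ∈ J, F J.card / (D.card.choose J.card * J.card) * G (J.erase i)) =
    ∑ J ∈ D.powerset.filter (fun J => k + 1 ≤ J.card), q ^ J.card * (1 - q) ^ (D.card - J.card) * G J +
      ∑ K ∈ D.powersetCard k, q ^ k * (1 - q) ^ (D.card - k) * G K := by
  set n := D.card with hn
  set X : ℕ → ℝ := fun j => F (j + 1) / n.choose j * ∑ K ∈ D.powersetCard j, G K with hX
  have hlev : ∀ j ∈ Finset.Ico (k + 1) (n + 1), ∑ J ∈ D.powersetCard j,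
      ((q ^ J.card * (1 - q) ^ (n - J.card) - F (J.card + 1) / n.choose J.card) * G J +
        ∑ i ∈ J, F J.card / (n.choose J.card * J.card) * G (J.erase i)) =
      ∑ J ∈ D.powersetCard j, q ^ J.card * (1 - q) ^ (n - J.card) * G J - (X j - X (j - 1)) := by
    intro j hj
    rw [Finset.mem_Ico] at hj
    obtain ⟨m, rfl⟩ : ∃ m, j = m + 1 := ⟨j - 1, by omega⟩
    have e1 : ∑ J ∈ D.powersetCard (m + 1),
      ((q ^ J.card * (1 - q) ^ (n - J.card) - F (J.card + 1) / n.choose J.card) * G J +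
        ∑ i ∈ J, F J.card / (n.choose J.card * J.card) * G (J.erase i)) =
      ∑ J ∈ D.powersetCard (m + 1), (q ^ J.card * (1 - q) ^ (n - J.card) * G J -
        F (m + 1 + 1) / n.choose (m + 1) * G J +
        F (m + 1) / (n.choose (m + 1) * (m + 1 : ℕ)) * ∑ i ∈ J, G (J.erase i)) := by
      apply Finset.sum_congr rfl
      intro J hJ
      rw [Finset.mem_powersetCard] at hJ
      rw [Finset.mul_sum, hJ.2]; ring
    rw [e1, Finset.sum_add_distrib, Finset.sum_sub_distrib, ← Finset.mul_sum, ← Finset.mul_sum,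
      sum_erase D m (by omega), hX]
    simp only [Nat.add_sub_cancel]
    have hch : (n.choose (m + 1) : ℝ) * ((m + 1 : ℕ) : ℝ) = n.choose m * ((n - m : ℕ) : ℝ) := by
      exact_mod_cast Nat.choose_succ_right_eq n m
    have hpos : (0 : ℝ) < ((n - m : ℕ) : ℝ) := by
      have : 0 < n - m := by omega
      exact_mod_cast this
    have hpos2 : (0 : ℝ) < n.choose m := by
      have : 0 < n.choose m := Nat.choose_pos (by omega)
      exact_mod_cast this
    rw [hch, ← hn]
    have : F (m + 1) / (n.choose m * ((n - m : ℕ) : ℝ)) * (((n - m : ℕ) : ℝ) * ∑ K ∈ D.powersetCard m, G K) =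
        F (m + 1) / n.choose m * ∑ K ∈ D.powersetCard m, G K := by
      field_simp
    rw [this]; ring
  rw [sum_filter_card, sum_filter_card, ← hn, Finset.sum_congr rfl hlev, Finset.sum_sub_distrib]
  have htel : ∑ j ∈ Finset.Ico (k + 1) (n + 1), (X j - X (j - 1)) = X n - X k := by
    have h1 := Finset.sum_Ico_add' (fun j => X j - X (j - 1)) k n 1
    rw [← h1]
    simp only [Nat.add_sub_cancel]
    exact Finset.sum_Ico_sub X (by omega)
  rw [htel]
  have hXn : X n = 0 := by simp [hX, hFn]
  have hXk : X k = ∑ K ∈ D.powersetCard k, q ^ k * (1 - q) ^ (n - k) * G K := by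
    rw [← Finset.mul_sum]
    simp only [hX]
    rw [hF0]
    congr 1
    have hpos2 : (0 : ℝ) < n.choose k := by
      have : 0 < n.choose k := Nat.choose_pos (by omega)
      exact_mod_cast this
    unfold binPMF
    field_simp
  rw [hXn, hXk]; ring

end Comb

section Flow

/-- flow into level `j` from level `j-1` -/
noncomputable def flowF (q β : ℝ) (n k j : ℕ) : ℝ :=
  max 0 (binPMF q n k - β * ∑ i ∈ Finset.Ico (k + 1) j, binPMF q n i)

noncomputable def flowφ (q β : ℝ) (n k j : ℕ) : ℝ :=
  (flowF q β n k j - flowF q β n k (j + 1)) / (β * binPMF q n j)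

variable {q β : ℝ} {n k : ℕ}

lemma flow_nonneg (j : ℕ) : 0 ≤ flowF q β n k j := le_max_left _ _

lemma flow_start (hq0 : 0 < q) (hq1 : q < 1) : flowF q β n k (k + 1) = binPMF q n k := by
  unfold flowF
  simp [binPMF_nonneg hq0 hq1]

lemma flow_end (hβ : binPMF q n k ≤ β * binTail q n (k + 1)) :
    flowF q β n k (n + 1) = 0 := by
  unfold flowF
  rw [max_eq_left]
  unfold binTail at hβ
  linarith

lemma flow_props (hq0 : 0 < q) (hq1 : q < 1) (hβ0 : 0 < β)
    (hβ : binPMF q n k ≤ β * binTail q n (k + 1)) {j : ℕ} (hj : k + 1 ≤ j) (hjn : j ≤ n) :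
    0 ≤ flowφ q β n k j ∧ flowφ q β n k j ≤ 1 ∧
    β * (flowφ q β n k j * binPMF q n j) = flowF q β n k j - flowF q β n k (j + 1) ∧
    flowF q β n k (j + 1) ≤ flowφ q β n k j * binPMF q n j := by
  have hp := binPMF_pos hq0 hq1 hjn
  set x := binPMF q n k - β * ∑ i ∈ Finset.Ico (k + 1) j, binPMF q n i with hx
  have h1 : flowF q β n k j = max 0 x := rfl
  have h2 : flowF q β n k (j + 1) = max 0 (x - β * binPMF q n j) := by
    unfold flowF
    rw [Finset.sum_Ico_succ_top hj, hx]
    congr 1; ring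
  have hb : 0 < β * binPMF q n j := by positivity
  have e3 : β * (flowφ q β n k j * binPMF q n j) = flowF q β n k j - flowF q β n k (j + 1) := by
    unfold flowφ; field_simp
  have key : x - β * binPMF q n j ≤ binPMF q n j := by
    have hr := binTail_ratio hq0 hq1 (n := n) (a := k) (j := j) (by omega) hjn
    have hsplit : binTail q n (k + 1) = ∑ i ∈ Finset.Ico (k + 1) (j + 1), binPMF q n i + binTail q n (j + 1) := by
      unfold binTail
      rw [Finset.sum_Ico_consecutive _ (by omega) (by omega)]
    have ht := binTail_pos hq0 hq1 (show k + 1 ≤ n by omega)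
    have hx2 : x - β * binPMF q n j = binPMF q n k - β * ∑ i ∈ Finset.Ico (k + 1) (j + 1), binPMF q n i := by
      rw [hx, Finset.sum_Ico_succ_top hj]; ring
    rw [hx2]
    set Z := binTail q n (k + 1)
    set T := binTail q n (j + 1)
    have hs : ∑ i ∈ Finset.Ico (k + 1) (j + 1), binPMF q n i = Z - T := by rw [hsplit]; ring
    have hTZ : 0 ≤ Z - T := by
      rw [← hs]; exact Finset.sum_nonneg (fun i _ => binPMF_nonneg hq0 hq1 _ _)
    rw [hs]
    have h3 : (binPMF q n k - β * (Z - T)) * Z ≤ binPMF q n j * Z := by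
      have : binPMF q n k * (Z - T) ≤ β * Z * (Z - T) := by gcongr
      nlinarith
    exact le_of_mul_le_mul_right h3 ht
  have hφ0 : 0 ≤ flowφ q β n k j := by
    unfold flowφ
    apply div_nonneg _ hb.le
    rw [h1, h2, sub_nonneg]
    exact max_le_max le_rfl (by linarith)
  have hφ1 : flowφ q β n k j ≤ 1 := by
    unfold flowφ
    rw [div_le_one hb, h1, h2]
    have := le_max_right 0 (x - β * binPMF q n j)
    have h0 := le_max_left 0 (x - β * binPMF q n j)
    have : max 0 x ≤ max 0 (x - β * binPMF q n j) + β * binPMF q n j := max_le (by linarith) (by linarith)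
    linarith
  refine ⟨hφ0, hφ1, e3, ?_⟩
  rcases le_total (x - β * binPMF q n j) 0 with h | h
  · rw [h2, max_eq_left h]; positivity
  · have : flowφ q β n k j = 1 := by
      unfold flowφ
      rw [h1, h2, max_eq_right h, max_eq_right (by linarith)]
      rw [div_eq_one_iff_eq hb.ne']; ring
    rw [this, h2, max_eq_right h]; linarith

lemma flow_total (hq0 : 0 < q) (hq1 : q < 1) (hβ0 : 0 < β) (hk : k + 1 ≤ n)
    (hβ : binPMF q n k ≤ β * binTail q n (k + 1)) :
    ∑ j ∈ Finset.Ico (k + 1) (n + 1), flowφ q β n k j * binPMF q n j = binPMF q n k / β := by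
  rw [eq_div_iff hβ0.ne', mul_comm, Finset.mul_sum]
  rw [Finset.sum_congr rfl (g := fun j => -(flowF q β n k (j + 1) - flowF q β n k j))]
  · rw [Finset.sum_neg_distrib, Finset.sum_Ico_sub (flowF q β n k) (by omega), flow_start hq0 hq1, flow_end hβ]
    ring
  · intro j hj
    rw [Finset.mem_Ico] at hj
    rw [(flow_props hq0 hq1 hβ0 hβ hj.1 (by omega)).2.2.1]; ring

end Flow

end PartM5

section PartM6

noncomputable def persp (α x y : ℝ) : ℝ := (x / y) ^ α * y

lemma persp_nonneg {α x y : ℝ} (hx : 0 ≤ x) (hy : 0 ≤ y) : 0 ≤ persp α x y := by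
  unfold persp; positivity

lemma persp_smul {α c x y : ℝ} : persp α (c * x) (c * y) = c * persp α x y := by
  unfold persp
  rcases eq_or_ne c 0 with h | h
  · subst h; simp
  · rw [mul_div_mul_left _ _ h]; ring

lemma persp_sum_le {κ : Type*} (s : Finset κ) {α : ℝ} (hα : 1 ≤ α) (x y : κ → ℝ)
    (hx : ∀ i ∈ s, 0 ≤ x i) (hy : ∀ i ∈ s, 0 ≤ y i) (hxy : ∀ i ∈ s, y i = 0 → x i = 0) :
    persp α (∑ i ∈ s, x i) (∑ i ∈ s, y i) ≤ ∑ i ∈ s, persp α (x i) (y i) := by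
  set Y := ∑ i ∈ s, y i with hY
  have hY0 : 0 ≤ Y := Finset.sum_nonneg hy
  rcases eq_or_lt_of_le hY0 with h | h
  · rw [← h]
    simp only [persp, mul_zero]
    exact Finset.sum_nonneg fun i hi => persp_nonneg (α := α) (hx i hi) (hy i hi)
  · have := Real.rpow_arith_mean_le_arith_mean_rpow s (fun i => y i / Y) (fun i => x i / y i)
      (fun i hi => div_nonneg (hy i hi) hY0) (by rw [← Finset.sum_div, ← hY, div_self h.ne'])
      (fun i hi => div_nonneg (hx i hi) (hy i hi)) hα
    have e : ∑ i ∈ s, y i / Y * (x i / y i) = (∑ i ∈ s, x i) / Y := by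
      rw [Finset.sum_div]
      apply Finset.sum_congr rfl
      intro i hi
      rcases eq_or_ne (y i) 0 with h0 | h0
      · rw [hxy i hi h0, h0]; simp
      · field_simp
    rw [e] at this
    unfold persp
    calc _ ≤ (∑ i ∈ s, y i / Y * (x i / y i) ^ α) * Y := by gcongr
      _ = _ := by
        rw [Finset.sum_mul]
        apply Finset.sum_congr rfl
        intro i _
        field_simp

lemma persp_add_le {α : ℝ} (hα : 1 ≤ α) {x1 x2 y1 y2 : ℝ} (hx1 : 0 ≤ x1) (hx2 : 0 ≤ x2)
    (hy1 : 0 ≤ y1) (hy2 : 0 ≤ y2) (h1 : y1 = 0 → x1 = 0) (h2 : y2 = 0 → x2 = 0) :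
    persp α (x1 + x2) (y1 + y2) ≤ persp α x1 y1 + persp α x2 y2 := by
  have := persp_sum_le (Finset.univ : Finset (Fin 2)) hα ![x1, x2] ![y1, y2]
    (by intro i _; fin_cases i <;> simpa) (by intro i _; fin_cases i <;> simpa)
    (by intro i _; fin_cases i <;> simpa)
  simpa [Fin.sum_univ_two] using this

section Struct
variable {ι : Type*} [DecidableEq ι] {d : ℕ} {σ : ℝ}

lemma persp_gauss (hσ : 0 < σ) (α c0 c1 : ℝ) (ω u w : EuclideanSpace ℝ (Fin d)) :
    persp α (c0 * gaussDensity d σ (ω - u) + c1 * gaussDensity d σ (ω - w)) (gaussDensity d σ (ω - u)) =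
      gaussDensity d σ (ω - u) *
        (c0 + c1 * (gaussDensity d σ (ω - w) / gaussDensity d σ (ω - u))) ^ α := by
  unfold persp
  have := gaussDensity_pos hσ (ω - u)
  rw [mul_comm]
  congr 2
  field_simp

lemma persp_gauss_integrable (hσ : 0 < σ) {α c0 c1 : ℝ} (hα : 0 ≤ α) (h0 : 0 ≤ c0) (h1 : 0 ≤ c1)
    (u w : EuclideanSpace ℝ (Fin d)) :
    Integrable (fun ω => persp α (c0 * gaussDensity d σ (ω - u) + c1 * gaussDensity d σ (ω - w))
      (gaussDensity d σ (ω - u))) := by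
  simp_rw [persp_gauss hσ]
  rw [← gaussMeas_integrable hσ u (fun ω => (c0 + c1 * (gaussDensity d σ (ω - w) / gaussDensity d σ (ω - u))) ^ α)]
  exact (gaussMeas_tiltPair hσ u w).int_affine h0 h1 hα

lemma persp_gauss_integral (hσ : 0 < σ) (α c0 c1 : ℝ)
    (u w : EuclideanSpace ℝ (Fin d)) :
    ∫ ω, persp α (c0 * gaussDensity d σ (ω - u) + c1 * gaussDensity d σ (ω - w))
      (gaussDensity d σ (ω - u)) =
    ∫ ω, (c0 + c1 * (gaussDensity d σ (ω - w) / gaussDensity d σ (ω - u))) ^ α ∂(gaussMeas d σ u) := by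
  simp_rw [persp_gauss hσ]
  rw [gaussMeas_integral hσ]

theorem dir2_struct (f : Finset ι → EuclideanSpace ℝ (Fin d))
    (hsens : ∀ (S : Finset ι) (a : ι), a ∉ S → ‖f (insert a S) - f S‖ ≤ 1)
    (hσ : 0 < σ) {q α β B1 B2 : ℝ} (hq0 : 0 < q) (hq1 : q < 1) (hα : 1 < α) (k : ℕ)
    (D : Finset ι) (a : ι) (ha : a ∉ D) (hk : k + 1 ≤ D.card) (hβ0 : 0 < β)
    (hβ : binPMF q D.card k / binTail q D.card (k + 1) ≤ β)
    (hB1 : ∀ u w : EuclideanSpace ℝ (Fin d), ‖w - u‖ ≤ 1 →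
      ∫ ω, persp α ((1 - q) * gaussDensity d σ (ω - u) + q * gaussDensity d σ (ω - w))
        (gaussDensity d σ (ω - u)) ≤ B1)
    (hB2 : ∀ u w : EuclideanSpace ℝ (Fin d), ‖w - u‖ ≤ 2 →
      ∫ ω, persp α ((1 - q) * gaussDensity d σ (ω - u) + (q * (1 + β)) * gaussDensity d σ (ω - w))
        (gaussDensity d σ (ω - u)) ≤ B2) :
    ∫ ω, persp α (srgmDensity d f σ q (k + 1) (insert a D) ω) (srgmDensity d f σ q (k + 1) D ω) ≤
      ((1 + q * (binPMF q D.card k / binTail q D.card (k + 1))) ^ α)⁻¹ *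
        ((1 - binPMF q D.card k / binTail q D.card (k + 1) / β) * B1 +
          binPMF q D.card k / binTail q D.card (k + 1) / β * B2) := by
  set n := D.card with hn
  set Z := binTail q n (k + 1) with hZ
  have hZ0 : 0 < Z := binTail_pos hq0 hq1 hk
  set r := 1 + q * (binPMF q n k / Z) with hr
  have hpk := binPMF_nonneg hq0 hq1 n k
  have hr0 : 0 < r := by positivity
  have hp : 0 < 1 - q := by linarith
  have hβ' : binPMF q n k ≤ β * Z := by rwa [div_le_iff₀ hZ0] at hβ
  set P := D.powerset.filter (fun J => k + 1 ≤ J.card) with hP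
  have hPm : ∀ J ∈ P, J ⊆ D ∧ k + 1 ≤ J.card ∧ J.card ≤ n := by
    intro J hJ
    rw [hP, Finset.mem_filter, Finset.mem_powerset] at hJ
    exact ⟨hJ.1, hJ.2, Finset.card_le_card hJ.1⟩
  set g : Finset ι → EuclideanSpace ℝ (Fin d) → ℝ := fun J ω => gaussDensity d σ (ω - f J) with hg
  have hgpos : ∀ J ω, 0 < g J ω := fun J ω => gaussDensity_pos hσ _
  set W : Finset ι → ℝ := fun J => q ^ J.card * (1 - q) ^ (n - J.card) with hW
  have hWpos : ∀ J, 0 < W J := fun J => by simp only [hW]; positivity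
  set F := flowF q β n k with hF
  set φ := flowφ q β n k with hφ
  have hC : ∀ J ∈ P, (0 : ℝ) < n.choose J.card := by
    intro J hJ
    have : 0 < n.choose J.card := Nat.choose_pos (hPm J hJ).2.2
    exact_mod_cast this
  have hflow : ∀ J ∈ P, 0 ≤ φ J.card ∧ φ J.card ≤ 1 ∧
      β * (φ J.card * W J) = (F J.card - F (J.card + 1)) / n.choose J.card ∧
      F (J.card + 1) / n.choose J.card ≤ φ J.card * W J := by
    intro J hJ
    obtain ⟨h1, h2, h3, h4⟩ := flow_props hq0 hq1 hβ0 hβ' (hPm J hJ).2.1 (hPm J hJ).2.2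
    have hCJ := hC J hJ
    have hb : binPMF q n J.card = n.choose J.card * W J := by simp only [hW]; unfold binPMF; ring
    rw [hb] at h3 h4
    refine ⟨h1, h2, ?_, ?_⟩
    · rw [eq_div_iff hCJ.ne', ← h3]; ring
    · rw [div_le_iff₀ hCJ]; linarith
  -- densities
  have hMD : ∀ ω, srgmDensity d f σ q (k + 1) D ω = Z⁻¹ * ∑ J ∈ P, W J * g J ω := by
    intro ω
    unfold srgmDensity
    rw [sum_weights]
  set X : EuclideanSpace ℝ (Fin d) → ℝ := fun ω => ∑ J ∈ P, ((1 - q) * W J * g J ω +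
      q * ((W J - F (J.card + 1) / n.choose J.card) * g (insert a J) ω +
        ∑ i ∈ J, F J.card / (n.choose J.card * J.card) * g (insert a (J.erase i)) ω)) with hX
  have hMD' : ∀ ω, srgmDensity d f σ q (k + 1) (insert a D) ω = (Z * r)⁻¹ * X ω := by
    intro ω
    unfold srgmDensity
    rw [sum_weights, sum_insert q D a ha k (fun J => gaussDensity d σ (ω - f J)),
      Finset.card_insert_of_notMem ha, ← hn, binTail_succ q (by omega)]
    congr 2
    · rw [hr, ← hZ]; field_simp
    · have hc := coupling_identity q D k hk F (flow_start hq0 hq1) (flow_end hβ') (fun J => g (insert a J) ω)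
      have hc2 : ∑ J ∈ P, q * ((W J - F (J.card + 1) / n.choose J.card) * g (insert a J) ω +
          ∑ i ∈ J, F J.card / (n.choose J.card * J.card) * g (insert a (J.erase i)) ω) =
          q * (∑ J ∈ P, W J * g (insert a J) ω +
            ∑ K ∈ Finset.powersetCard k D, q ^ k * (1 - q) ^ (n - k) * g (insert a K) ω) := by
        rw [← Finset.mul_sum]
        congr 1
      simp only [hX]
      rw [Finset.sum_add_distrib, hc2, mul_add, ← add_assoc]
      congr 1
      rw [Finset.mul_sum, ← Finset.sum_add_distrib]
      apply Finset.sum_congr rfl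
      intro J _
      simp only [hW, hg]
      ring
  -- pieces
  set d0 : Finset ι → ℝ := fun J => (φ J.card * W J - F (J.card + 1) / n.choose J.card) / (1 + β) with hd0
  set d1 : Finset ι → ℝ := fun J => F J.card / (n.choose J.card * J.card) / (1 + β) with hd1
  have hd0n : ∀ J ∈ P, 0 ≤ d0 J := by
    intro J hJ
    have := (hflow J hJ).2.2.2
    simp only [hd0]
    apply div_nonneg _ (by linarith)
    linarith
  have hd1n : ∀ J ∈ P, 0 ≤ d1 J := by
    intro J hJ
    have : 0 ≤ F J.card := flow_nonneg _
    simp only [hd1]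
    positivity
  have hdsum : ∀ J ∈ P, d0 J + J.card * d1 J = φ J.card * W J := by
    intro J hJ
    have h3 := (hflow J hJ).2.2.1
    have hCJ := hC J hJ
    have hJc : (0 : ℝ) < J.card := by
      have := (hPm J hJ).2.1
      have : 0 < J.card := by omega
      exact_mod_cast this
    have e1 : (J.card : ℝ) * d1 J = F J.card / n.choose J.card / (1 + β) := by
      simp only [hd1]; field_simp
    rw [e1]
    simp only [hd0]
    rw [← add_div, div_eq_iff (by positivity)]
    rw [sub_div] at h3
    linarith
  set I1 : Finset ι → EuclideanSpace ℝ (Fin d) → ℝ := fun J ω =>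
    persp α ((1 - q) * g J ω + q * g (insert a J) ω) (g J ω) with hI1
  set I2 : Finset ι → Finset ι → EuclideanSpace ℝ (Fin d) → ℝ := fun J K ω =>
    persp α ((1 - q) * g J ω + (q * (1 + β)) * g (insert a K) ω) (g J ω) with hI2
  set U : EuclideanSpace ℝ (Fin d) → ℝ := fun ω => ∑ J ∈ P, ((1 - φ J.card) * W J * I1 J ω +
      (d0 J * I2 J J ω + ∑ i ∈ J, d1 J * I2 J (J.erase i) ω)) with hU
  have hpt : ∀ ω, persp α (X ω) (∑ J ∈ P, W J * g J ω) ≤ U ω := by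
    intro ω
    have hX0 : ∀ J ∈ P, ((1 - q) * W J * g J ω +
      q * ((W J - F (J.card + 1) / n.choose J.card) * g (insert a J) ω +
        ∑ i ∈ J, F J.card / (n.choose J.card * J.card) * g (insert a (J.erase i)) ω)) =
        (1 - φ J.card) * W J * ((1 - q) * g J ω + q * g (insert a J) ω) +
        (d0 J * ((1 - q) * g J ω + (q * (1 + β)) * g (insert a J) ω) +
          ∑ i ∈ J, d1 J * ((1 - q) * g J ω + (q * (1 + β)) * g (insert a (J.erase i)) ω)) := by
      intro J hJ
      have hs := hdsum J hJ
      have e1 : ∑ i ∈ J, d1 J * ((1 - q) * g J ω + (q * (1 + β)) * g (insert a (J.erase i)) ω) =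
          J.card * d1 J * ((1 - q) * g J ω) +
          q * ∑ i ∈ J, F J.card / (n.choose J.card * J.card) * g (insert a (J.erase i)) ω := by
        rw [Finset.mul_sum]
        simp_rw [mul_add]
        rw [Finset.sum_add_distrib, Finset.sum_const, nsmul_eq_mul]
        congr 1
        · ring
        · apply Finset.sum_congr rfl
          intro i _
          simp only [hd1]
          have : (1 + β) ≠ 0 := by positivity
          field_simp
      rw [e1]
      have e2 : d0 J * (q * (1 + β)) = q * (φ J.card * W J - F (J.card + 1) / n.choose J.card) := by
        simp only [hd0]
        have : (1 + β) ≠ 0 := by positivity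
        field_simp
      linear_combination (-((1 - q) * g J ω)) * hs - g (insert a J) ω * e2
    have hY0 : ∀ J ∈ P, W J * g J ω = (1 - φ J.card) * W J * g J ω +
        (d0 J * g J ω + ∑ i ∈ J, d1 J * g J ω) := by
      intro J hJ
      have hs := hdsum J hJ
      rw [Finset.sum_const, nsmul_eq_mul]
      linear_combination (- g J ω) * hs
    simp only [hX, hU]
    refine (persp_sum_le P hα.le _ _ ?_ ?_ ?_).trans ?_
    · intro J hJ
      rw [hX0 J hJ]
      have h1 := hgpos J ω
      have h2 := hgpos (insert a J) ω
      have h3 : ∀ i ∈ J, 0 ≤ g (insert a (J.erase i)) ω := fun i _ => (hgpos _ ω).le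
      have h4 : 0 ≤ 1 - φ J.card := by linarith [(hflow J hJ).2.1]
      have h5 := hd0n J hJ
      have h6 := hd1n J hJ
      have h7 := hWpos J
      refine add_nonneg (by positivity) (add_nonneg (by positivity) (Finset.sum_nonneg fun i hi => ?_))
      have := h3 i hi
      positivity
    · intro J _
      exact (mul_pos (hWpos J) (hgpos J ω)).le
    · intro J _ h
      exact absurd h (mul_pos (hWpos J) (hgpos J ω)).ne'
    · apply Finset.sum_le_sum
      intro J hJ
      rw [hX0 J hJ, hY0 J hJ]
      have h1 := hgpos J ω
      have h2 : ∀ K, 0 < g K ω := fun K => hgpos K ω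
      have h4 : 0 ≤ 1 - φ J.card := by linarith [(hflow J hJ).2.1]
      have h5 := hd0n J hJ
      have h6 := hd1n J hJ
      have h7 := hWpos J
      have hx1 : ∀ K, 0 ≤ (1 - q) * g J ω + q * g K ω := fun K => by have := h2 K; positivity
      have hx2 : ∀ K, 0 ≤ (1 - q) * g J ω + (q * (1 + β)) * g K ω := fun K => by have := h2 K; positivity
      have hz : ∀ c x : ℝ, c * g J ω = 0 → c * x = 0 := by
        intro c x hc
        rcases mul_eq_zero.1 hc with h | h
        · rw [h, zero_mul]
        · exact absurd h h1.ne'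
      have hsum0 : ∑ i ∈ J, d1 J * g J ω = 0 → ∑ i ∈ J, d1 J *
          ((1 - q) * g J ω + (q * (1 + β)) * g (insert a (J.erase i)) ω) = 0 := by
        intro h0
        apply Finset.sum_eq_zero
        intro i hi
        have := (Finset.sum_eq_zero_iff_of_nonneg (fun i _ => by positivity)).1 h0 i hi
        exact hz _ _ this
      have hsn : 0 ≤ ∑ i ∈ J, d1 J *
          ((1 - q) * g J ω + (q * (1 + β)) * g (insert a (J.erase i)) ω) :=
        Finset.sum_nonneg fun i _ => mul_nonneg h6 (hx2 _)
      have hsn2 : 0 ≤ ∑ i ∈ J, d1 J * g J ω := Finset.sum_nonneg fun i _ => by positivity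
      refine (persp_add_le hα.le (mul_nonneg (by positivity) (hx1 _))
        (add_nonneg (mul_nonneg h5 (hx2 _)) hsn) (by positivity)
        (add_nonneg (by positivity) hsn2) (hz _ _) ?_).trans ?_
      · intro h0
        have hA : 0 ≤ d0 J * g J ω := by positivity
        have ha0 : d0 J * g J ω = 0 := by linarith
        have hb0 : ∑ i ∈ J, d1 J * g J ω = 0 := by linarith
        rw [hz _ _ ha0, hsum0 hb0, add_zero]
      · apply add_le_add
        · rw [persp_smul]
        refine (persp_add_le hα.le (mul_nonneg h5 (hx2 _)) hsn (by positivity) hsn2 (hz _ _) hsum0).trans ?_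
        apply add_le_add
        · rw [persp_smul]
        refine (persp_sum_le J hα.le _ _ (fun i _ => mul_nonneg h6 (hx2 _)) (fun i _ => by positivity)
          (fun i _ => hz _ _)).trans ?_
        apply Finset.sum_le_sum
        intro i _
        rw [persp_smul]
  -- integrals
  have i1 : ∀ J, Integrable (I1 J) := fun J =>
    persp_gauss_integrable hσ (by linarith) hp.le hq0.le (f J) (f (insert a J))
  have i2 : ∀ J K, Integrable (I2 J K) := fun J K =>
    persp_gauss_integrable hσ (by linarith) hp.le (by positivity) (f J) (f (insert a K))
  have iJ : ∀ J, Integrable (fun ω => ∑ i ∈ J, d1 J * I2 J (J.erase i) ω) := fun J =>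
    integrable_finsetSum _ fun i _ => (i2 J _).const_mul _
  have iJ2 : ∀ J, Integrable (fun ω => d0 J * I2 J J ω + ∑ i ∈ J, d1 J * I2 J (J.erase i) ω) := fun J =>
    ((i2 J J).const_mul _).add (iJ J)
  have iJ3 : ∀ J, Integrable (fun ω => (1 - φ J.card) * W J * I1 J ω +
      (d0 J * I2 J J ω + ∑ i ∈ J, d1 J * I2 J (J.erase i) ω)) := fun J =>
    ((i1 J).const_mul _).add (iJ2 J)
  have iU : Integrable U := integrable_finsetSum _ fun J _ => iJ3 J
  have hUint : ∫ ω, U ω ≤ (Z - binPMF q n k / β) * B1 + binPMF q n k / β * B2 := by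
    simp only [hU]
    rw [integral_finsetSum _ fun J _ => iJ3 J]
    have hJle : ∀ J ∈ P, ∫ ω, ((1 - φ J.card) * W J * I1 J ω +
      (d0 J * I2 J J ω + ∑ i ∈ J, d1 J * I2 J (J.erase i) ω)) ≤
        W J * B1 + (φ J.card * W J) * (B2 - B1) := by
      intro J hJ
      have h4 : 0 ≤ 1 - φ J.card := by linarith [(hflow J hJ).2.1]
      have h5 := hd0n J hJ
      have h6 := hd1n J hJ
      have h7 := hWpos J
      rw [integral_add ((i1 J).const_mul _) (iJ2 J), integral_add ((i2 J J).const_mul _) (iJ J),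
        integral_finsetSum _ (fun i _ => (i2 J _).const_mul _), integral_const_mul, integral_const_mul]
      have haJ : a ∉ J := fun h => ha ((hPm J hJ).1 h)
      have b1 : ∫ ω, I1 J ω ≤ B1 := hB1 _ _ (hsens J a haJ)
      have b2 : ∫ ω, I2 J J ω ≤ B2 := hB2 _ _ ((hsens J a haJ).trans (by norm_num))
      have b3 : ∀ i ∈ J, ∫ ω, d1 J * I2 J (J.erase i) ω ≤ d1 J * B2 := by
        intro i hi
        rw [integral_const_mul]
        apply mul_le_mul_of_nonneg_left _ h6
        apply hB2
        have e1 := hsens (J.erase i) a (fun h => haJ (Finset.mem_of_mem_erase h))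
        have e2 := hsens (J.erase i) i (by simp)
        rw [Finset.insert_erase hi] at e2
        calc ‖f (insert a (J.erase i)) - f J‖ = ‖(f (insert a (J.erase i)) - f (J.erase i)) - (f J - f (J.erase i))‖ := by
              congr 1; abel
          _ ≤ _ := norm_sub_le _ _
          _ ≤ 2 := by linarith
      have b4 := Finset.sum_le_sum b3
      rw [Finset.sum_const, nsmul_eq_mul] at b4
      have b5 : (1 - φ J.card) * W J * ∫ ω, I1 J ω ≤ (1 - φ J.card) * W J * B1 := by gcongr
      have b6 : d0 J * ∫ ω, I2 J J ω ≤ d0 J * B2 := by gcongr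
      have hs := hdsum J hJ
      have : (1 - φ J.card) * W J * B1 + (d0 J * B2 + J.card * (d1 J * B2)) =
        W J * B1 + (φ J.card * W J) * (B2 - B1) := by linear_combination B2 * hs
      linarith
    refine (Finset.sum_le_sum hJle).trans ?_
    rw [Finset.sum_add_distrib, ← Finset.sum_mul, ← Finset.sum_mul]
    have s1 : ∑ J ∈ P, W J = Z := sum_weights q D (k + 1)
    have s2 : ∑ J ∈ P, φ J.card * W J = binPMF q n k / β := by
      rw [← flow_total hq0 hq1 hβ0 hk hβ', hP, sum_filter_card]
      apply Finset.sum_congr rfl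
      intro j _
      rw [Finset.sum_congr rfl (g := fun _ => φ j * (q ^ j * (1 - q) ^ (n - j)))]
      · rw [Finset.sum_const, Finset.card_powersetCard, nsmul_eq_mul]; unfold binPMF; ring
      · intro J hJ
        rw [Finset.mem_powersetCard] at hJ
        simp only [hW]
        rw [hJ.2]
    rw [s1, s2]
    apply le_of_eq; ring
  have hX0 : ∀ ω, 0 ≤ X ω := by
    intro ω
    have h := hMD' ω
    have h2 : 0 ≤ srgmDensity d f σ q (k + 1) (insert a D) ω := by
      unfold srgmDensity
      refine mul_nonneg (inv_nonneg.2 (Finset.sum_nonneg fun J _ => by positivity))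
        (Finset.sum_nonneg fun J _ => ?_)
      have := gaussDensity_pos hσ (ω - f J)
      positivity
    rw [h] at h2
    exact nonneg_of_mul_nonneg_right h2 (by positivity)
  have hN0 : ∀ ω, 0 ≤ ∑ J ∈ P, W J * g J ω := fun ω =>
    Finset.sum_nonneg fun J _ => (mul_pos (hWpos J) (hgpos J ω)).le
  have hfin : ∀ ω, persp α (srgmDensity d f σ q (k + 1) (insert a D) ω) (srgmDensity d f σ q (k + 1) D ω) =
      (r ^ α)⁻¹ * Z⁻¹ * persp α (X ω) (∑ J ∈ P, W J * g J ω) := by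
    intro ω
    rw [hMD, hMD', mul_inv, mul_assoc, persp_smul, mul_comm (r ^ α)⁻¹, mul_assoc]
    congr 1
    unfold persp
    rw [mul_div_assoc, Real.mul_rpow (by positivity) (div_nonneg (hX0 ω) (hN0 ω)), Real.inv_rpow hr0.le]
    ring
  simp_rw [hfin]
  rw [integral_const_mul]
  have hle : ∫ ω, persp α (X ω) (∑ J ∈ P, W J * g J ω) ≤ ∫ ω, U ω :=
    integral_mono_of_nonneg (Filter.Eventually.of_forall fun ω => persp_nonneg (hX0 ω) (hN0 ω)) iU
      (Filter.Eventually.of_forall hpt)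
  calc _ ≤ (r ^ α)⁻¹ * Z⁻¹ * ((Z - binPMF q n k / β) * B1 + binPMF q n k / β * B2) := by
        gcongr; exact hle.trans hUint
    _ = _ := by field_simp

end Struct

end PartM6

section PartM6b

section Struct1
variable {ι : Type*} [DecidableEq ι] {d : ℕ} {σ : ℝ}

lemma persp_eq {α x y : ℝ} (hx : 0 < x) (hy : 0 < y) : persp α x y = x ^ α * y ^ (1 - α) := by
  unfold persp
  rw [Real.div_rpow hx.le hy.le, Real.rpow_sub hy, Real.rpow_one]
  field_simp

theorem dir1_struct (f : Finset ι → EuclideanSpace ℝ (Fin d))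
    (hsens : ∀ (S : Finset ι) (a : ι), a ∉ S → ‖f (insert a S) - f S‖ ≤ 1)
    (hσ : 4 ≤ σ) {q α : ℝ} (hq0 : 0 < q) (hq : q ≤ 1 / 5) (hα : 1 < α) (k : ℕ)
    (D : Finset ι) (a : ι) (ha : a ∉ D) (hk : k + 1 ≤ D.card) :
    ∫ ω, persp α (srgmDensity d f σ q (k + 1) D ω) (srgmDensity d f σ q (k + 1) (insert a D) ω) ≤
      (1 + q * (binPMF q D.card k / binTail q D.card (k + 1))) ^ (α - 1) *
        Real.exp (2 * α * (α - 1) * q ^ 2 * (1 / σ ^ 2)) := by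
  have hσ0 : 0 < σ := by linarith
  have hq1 : q < 1 := by linarith
  set B := Real.exp (2 * α * (α - 1) * q ^ 2 * (1 / σ ^ 2)) with hB
  set n := D.card with hn
  set Z := binTail q n (k + 1) with hZ
  have hZ0 : 0 < Z := binTail_pos hq0 hq1 hk
  set r := 1 + q * (binPMF q n k / Z) with hr
  have hpk := binPMF_nonneg hq0 hq1 n k
  have hr0 : 0 < r := by positivity
  have hp : 0 < 1 - q := by linarith
  set P := D.powerset.filter (fun J => k + 1 ≤ J.card) with hP
  have hPne : P.Nonempty := by
    refine ⟨D, ?_⟩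
    rw [hP, Finset.mem_filter, Finset.mem_powerset]
    exact ⟨subset_rfl, hk⟩
  set g : Finset ι → EuclideanSpace ℝ (Fin d) → ℝ := fun J ω => gaussDensity d σ (ω - f J) with hg
  have hgpos : ∀ J ω, 0 < g J ω := fun J ω => gaussDensity_pos hσ0 _
  set W : Finset ι → ℝ := fun J => q ^ J.card * (1 - q) ^ (n - J.card) with hW
  have hWpos : ∀ J, 0 < W J := fun J => by simp only [hW]; positivity
  set T : Finset ι → EuclideanSpace ℝ (Fin d) → ℝ := fun J ω => (1 - q) * g J ω + q * g (insert a J) ω with hT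
  have hTpos : ∀ J ω, 0 < T J ω := fun J ω => by
    have := hgpos J ω
    have := hgpos (insert a J) ω
    simp only [hT]; positivity
  have hMD : ∀ ω, srgmDensity d f σ q (k + 1) D ω = Z⁻¹ * ∑ J ∈ P, W J * g J ω := by
    intro ω
    unfold srgmDensity
    rw [sum_weights]
  have hMD' : ∀ ω, Z⁻¹ * (r⁻¹ * ∑ J ∈ P, W J * T J ω) ≤ srgmDensity d f σ q (k + 1) (insert a D) ω := by
    intro ω
    unfold srgmDensity
    rw [sum_weights, sum_insert q D a ha k (fun J => gaussDensity d σ (ω - f J)),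
      Finset.card_insert_of_notMem ha, ← hn, binTail_succ q (by omega), ← mul_assoc, ← mul_inv]
    have e : binTail q n (k + 1) + q * binPMF q n k = Z * r := by
      rw [hr, ← hZ]; field_simp
    rw [e]
    gcongr
    apply le_add_of_nonneg_right
    apply mul_nonneg hq0.le (Finset.sum_nonneg fun K _ => ?_)
    have := hgpos (insert a K) ω
    simp only [hg] at this
    positivity
  have hpt : ∀ ω, persp α (srgmDensity d f σ q (k + 1) D ω) (srgmDensity d f σ q (k + 1) (insert a D) ω) ≤
      Z⁻¹ * r ^ (α - 1) * ∑ J ∈ P, W J * persp α (g J ω) (T J ω) := by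
    intro ω
    have hS : 0 < ∑ J ∈ P, W J * g J ω := Finset.sum_pos (fun J _ => mul_pos (hWpos J) (hgpos J ω)) hPne
    have hS' : 0 < ∑ J ∈ P, W J * T J ω := Finset.sum_pos (fun J _ => mul_pos (hWpos J) (hTpos J ω)) hPne
    have h1 : 0 < Z⁻¹ * ∑ J ∈ P, W J * g J ω := by positivity
    have h2 : 0 < Z⁻¹ * (r⁻¹ * ∑ J ∈ P, W J * T J ω) := by positivity
    rw [hMD]
    calc _ ≤ persp α (Z⁻¹ * ∑ J ∈ P, W J * g J ω) (Z⁻¹ * (r⁻¹ * ∑ J ∈ P, W J * T J ω)) := by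
          rw [persp_eq h1 (lt_of_lt_of_le h2 (hMD' ω)), persp_eq h1 h2]
          apply mul_le_mul_of_nonneg_left _ (by positivity)
          exact Real.rpow_le_rpow_of_nonpos h2 (hMD' ω) (by linarith)
      _ = Z⁻¹ * r ^ (α - 1) * persp α (∑ J ∈ P, W J * g J ω) (∑ J ∈ P, W J * T J ω) := by
          rw [persp_smul, persp_eq hS (by positivity), persp_eq hS hS',
            Real.mul_rpow (by positivity) hS'.le, Real.inv_rpow hr0.le, ← Real.rpow_neg hr0.le]
          rw [show -(1 - α) = α - 1 by ring]; ring
      _ ≤ _ := by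
          apply mul_le_mul_of_nonneg_left _ (by positivity)
          refine (persp_sum_le P hα.le _ _ (fun J _ => (mul_pos (hWpos J) (hgpos J ω)).le)
            (fun J _ => (mul_pos (hWpos J) (hTpos J ω)).le)
            (fun J _ h => absurd h (mul_pos (hWpos J) (hTpos J ω)).ne')).trans ?_
          apply Finset.sum_le_sum
          intro J _
          rw [persp_smul]
  have hpe : ∀ J ω, persp α (g J ω) (T J ω) = g J ω *
      (1 - q + q * (g (insert a J) ω / g J ω)) ^ (1 - α) := by
    intro J ω
    have h1 := hgpos J ω
    have h2 := hgpos (insert a J) ω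
    rw [persp_eq h1 (hTpos J ω)]
    have : T J ω = g J ω * (1 - q + q * (g (insert a J) ω / g J ω)) := by
      simp only [hT]; field_simp
    rw [this, Real.mul_rpow h1.le (by positivity), ← mul_assoc, ← Real.rpow_add h1]
    norm_num
  have hInteg : ∀ J, Integrable (fun ω => persp α (g J ω) (T J ω)) := by
    intro J
    simp_rw [hpe]
    have := (gaussMeas_integrable hσ0 (f J) (fun ω => (1 - q + q * (g (insert a J) ω / g J ω)) ^ (1 - α))).1
      ((gaussMeas_tiltPair hσ0 (f J) (f (insert a J))).int_neg hα hq0 hq)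
    exact this
  have hbd : ∀ J ∈ P, ∫ ω, persp α (g J ω) (T J ω) ≤ B := by
    intro J hJ
    have haJ : a ∉ J := fun h => ha (by
      rw [hP, Finset.mem_filter, Finset.mem_powerset] at hJ; exact hJ.1 h)
    simp_rw [hpe]
    have e := gaussMeas_integral hσ0 (f J) (fun ω => (1 - q + q * (g (insert a J) ω / g J ω)) ^ (1 - α))
    have hs := hsens J a haJ
    have hv : ‖f (insert a J) - f J‖ ^ 2 / σ ^ 2 ≤ 1 / σ ^ 2 := by
      gcongr
      exact pow_le_one₀ (norm_nonneg _) hs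
    have b := (gaussMeas_tiltPair hσ0 (f J) (f (insert a J))).dir1_bound (by positivity) hv
      (by
        rw [div_le_div_iff₀ (by positivity) (by norm_num)]; nlinarith) hα hq0 hq
    calc _ = _ := e.symm
      _ ≤ _ := b
  have iU : Integrable (fun ω => Z⁻¹ * r ^ (α - 1) * ∑ J ∈ P, W J * persp α (g J ω) (T J ω)) :=
    (integrable_finsetSum _ fun J _ => (hInteg J).const_mul _).const_mul _
  have hnn : ∀ D' : Finset ι, ∀ ω, 0 ≤ srgmDensity d f σ q (k + 1) D' ω := by
    intro D' ω
    unfold srgmDensity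
    refine mul_nonneg (inv_nonneg.2 (Finset.sum_nonneg fun J _ => by positivity))
      (Finset.sum_nonneg fun J _ => ?_)
    have := gaussDensity_pos hσ0 (ω - f J)
    positivity
  refine (integral_mono_of_nonneg (Filter.Eventually.of_forall fun ω => persp_nonneg (hnn _ ω) (hnn _ ω)) iU
      (Filter.Eventually.of_forall hpt)).trans ?_
  rw [integral_const_mul, integral_finsetSum _ (fun J _ => (hInteg J).const_mul _)]
  have hsum : ∑ J ∈ P, ∫ ω, W J * persp α (g J ω) (T J ω) ≤ ∑ J ∈ P, W J * B := by
    apply Finset.sum_le_sum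
    intro J hJ
    rw [integral_const_mul]
    exact mul_le_mul_of_nonneg_left (hbd J hJ) (hWpos J).le
  have s1 : ∑ J ∈ P, W J = Z := sum_weights q D (k + 1)
  rw [← Finset.sum_mul, s1] at hsum
  calc _ ≤ Z⁻¹ * r ^ (α - 1) * (Z * B) := by gcongr
    _ = _ := by field_simp

end Struct1

end PartM6b

section PartM7a

lemma one_add_rpow_le {α b : ℝ} (hα : 1 < α) (hb : 0 ≤ b) :
    (1 + b) ^ α ≤ 1 + α * b + (α - 1) / α * (Real.exp (α * b) - 1 - α * b) := by
  have key : MonotoneOn (fun t : ℝ => 1 + α * t + (α - 1) / α * (Real.exp (α * t) - 1 - α * t) - (1 + t) ^ α)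
      (Set.Ici 0) := by
    have hd : ∀ t : ℝ, 0 ≤ t → HasDerivAt (fun t : ℝ => 1 + α * t + (α - 1) / α * (Real.exp (α * t) - 1 - α * t) - (1 + t) ^ α)
        (1 + (α - 1) * Real.exp (α * t) - α * (1 + t) ^ (α - 1)) t := by
      intro t ht
      have h0 : HasDerivAt (fun t : ℝ => α * t) α t := by simpa using (hasDerivAt_id t).const_mul α
      have h1 : HasDerivAt (fun t : ℝ => 1 + t) 1 t := by simpa using (hasDerivAt_id t).const_add 1
      have h2 := h1.rpow_const (p := α) (Or.inr hα.le)
      have h3 := ((h0.const_add 1).add (((h0.exp.sub_const 1).sub h0).const_mul ((α - 1) / α))).sub h2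
      refine h3.congr_deriv ?_
      field_simp
      ring
    refine monotoneOn_of_deriv_nonneg (convex_Ici 0)
      (fun t ht => (hd t ht).continuousAt.continuousWithinAt)
      (fun t ht => (hd t (interior_subset ht)).differentiableAt.differentiableWithinAt) ?_
    intro t ht
    have ht0 : 0 ≤ t := interior_subset ht
    rw [(hd t ht0).deriv]
    have e1 : (1 + t) ^ (α - 1) ≤ Real.exp ((α - 1) * t) := by
      have : 1 + t ≤ Real.exp t := by linarith [Real.add_one_le_exp t]
      calc (1 + t) ^ (α - 1) ≤ (Real.exp t) ^ (α - 1) :=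
            Real.rpow_le_rpow (by linarith) this (by linarith)
        _ = Real.exp ((α - 1) * t) := by rw [← Real.exp_mul, mul_comm]
    have e2 : Real.exp ((α - 1) * t) ≤ 1 / α + (α - 1) / α * Real.exp (α * t) := by
      have := convexOn_exp.2 (Set.mem_univ (0:ℝ)) (Set.mem_univ (α * t))
        (by positivity : 0 ≤ 1 / α) (div_nonneg (by linarith) (by linarith) : 0 ≤ (α - 1) / α) (by field_simp; ring)
      simp only [smul_eq_mul, mul_zero, zero_add, Real.exp_zero, mul_one] at this
      have h7 : (α - 1) / α * (α * t) = (α - 1) * t := by field_simp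
      rwa [h7] at this
    have e3 : α * (1 + t) ^ (α - 1) ≤ α * (1 / α + (α - 1) / α * Real.exp (α * t)) :=
      mul_le_mul_of_nonneg_left (e1.trans e2) (by linarith)
    have e4 : α * (1 / α + (α - 1) / α * Real.exp (α * t)) = 1 + (α - 1) * Real.exp (α * t) := by
      field_simp
    linarith
  have := key (Set.mem_Ici.2 le_rfl) (Set.mem_Ici.2 hb) hb
  simp only [mul_zero, add_zero, Real.exp_zero, Real.one_rpow] at this
  linarith

/-- the profile function -/
noncomputable def profF (Ψ m β : ℝ) : ℝ := Ψ * ((1 + β) ^ 2 * Real.exp (m * (1 + β)))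

lemma profF_convex {Ψ m : ℝ} (hΨ : 0 ≤ Ψ) (hm : 0 ≤ m) : ConvexOn ℝ (Set.Icc 0 1) (profF Ψ m) := by
  have h1 : ConvexOn ℝ (Set.Icc (0:ℝ) 1) (fun β : ℝ => (1 + β) ^ 2) := by
    refine ⟨convex_Icc 0 1, ?_⟩
    intro x _ y _ a b ha hb hab
    simp only [smul_eq_mul]
    have : b = 1 - a := by linarith
    subst this
    nlinarith [mul_nonneg (mul_nonneg ha hb) (sq_nonneg (x - y))]
  have h2 : ConvexOn ℝ (Set.Icc (0:ℝ) 1) (fun β : ℝ => Real.exp (m * (1 + β))) := by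
    refine ⟨convex_Icc 0 1, ?_⟩
    intro x _ y _ a b ha hb hab
    have := convexOn_exp.2 (Set.mem_univ (m * (1 + x))) (Set.mem_univ (m * (1 + y))) ha hb hab
    simp only [smul_eq_mul] at this ⊢
    have hb' : b = 1 - a := by linarith
    subst hb'
    convert this using 2
    ring
  have h3 := h1.mul h2 (fun x hx => by positivity) (fun x hx => by positivity) (by
    intro x hx y hy hxy
    have hx0 := hx.1
    simp only [Real.exp_lt_exp] at hxy
    have : x ≤ y := by
      by_contra hcon
      push Not at hcon
      nlinarith [mul_nonneg hm (by linarith : 0 ≤ x - y)]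
    simp only
    gcongr)
  exact h3.smul hΨ

lemma caseII {α q u ρ F B1 B2 : ℝ} (hα : 1 < α) (hq0 : 0 < q) (hu : 0 ≤ u) (hρp : 0 < ρ) (hF : 0 ≤ F)
    (hII : 2 * (q * α) * u * (F - 1) ≤ ρ)
    (h2 : B2 ≤ (1 + q * ρ) ^ α + (1 + q * ρ) ^ (α - 2) * (2 * α * (α - 1) * q ^ 2 * u) * F) :
    (1 - ρ / ρ) * B1 + ρ / ρ * B2 ≤
        (1 + q * ρ) ^ α * Real.exp ((α - 1) * q * ρ + 2 * α * (α - 1) * q ^ 2 * u) := by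
  have hα1 : 0 < α - 1 := by linarith
  set Y := 2 * α * (α - 1) * q ^ 2 * u with hY
  have hY0 : 0 ≤ Y := by positivity
  rw [div_self hρp.ne', sub_self, zero_mul, zero_add, one_mul]
  refine h2.trans ?_
  have hb : 0 < 1 + q * ρ := by positivity
  have e1 : (1 + q * ρ) ^ (α - 2) ≤ (1 + q * ρ) ^ α :=
    Real.rpow_le_rpow_of_exponent_le (by nlinarith [mul_pos hq0 hρp]) (by linarith)
  have e2 : 1 + Y * F ≤ Real.exp ((α - 1) * q * ρ + Y) := by
    have i1 := Real.add_one_le_exp ((α - 1) * q * ρ)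
    have i2 := Real.add_one_le_exp Y
    rw [Real.exp_add]
    have i3 : (1 + (α - 1) * q * ρ) * (1 + Y) ≤ Real.exp ((α - 1) * q * ρ) * Real.exp Y :=
      mul_le_mul (by linarith) (by linarith) (by positivity) (by positivity)
    refine le_trans ?_ i3
    have := mul_le_mul_of_nonneg_left hII (by positivity : 0 ≤ (α - 1) * q)
    have hyy : (α - 1) * q * (2 * (q * α) * u * (F - 1)) = Y * (F - 1) := by rw [hY]; ring
    rw [hyy] at this
    have h9 : 0 ≤ (α - 1) * q * ρ * Y := by positivity
    linarith
  calc _ ≤ (1 + q * ρ) ^ α + (1 + q * ρ) ^ α * Y * F := by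
        gcongr
    _ = (1 + q * ρ) ^ α * (1 + Y * F) := by ring
    _ ≤ _ := by gcongr
  
lemma combine {α q u ρ Ψ m β0 G : ℝ} (hα : 1 < α) (hq0 : 0 < q) (hu : 0 ≤ u)
    (hρ0 : 0 ≤ ρ) (hρ1 : ρ ≤ 1) (hΨ : 0 ≤ Ψ) (hm : 0 ≤ m) (hβ0 : 0 < β0) (hβ1 : β0 ≤ 1)
    (hG : (1 + q * β0) ^ (α - 2) ≤ G)
    (hI : 2 * (q * α) * u * (G * profF Ψ m β0 - 1 - q * α * β0 - q * (α - 1) * β0) ≤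
      β0 * (1 - (Real.exp (q * α * β0) - 1 - q * α * β0) / (q * α * β0)))
    (hII0 : β0 < 1 → 2 * (q * α) * u * (profF Ψ m β0 - 1) ≤ β0)
    (hII1 : β0 < 1 → 2 * (q * α) * u * (profF Ψ m 1 - 1) ≤ 1) :
    ∃ β, 0 < β ∧ β ≤ 1 ∧ ρ ≤ β ∧ ∀ B1 B2 : ℝ, B1 ≤ 1 + 2 * α * (α - 1) * q ^ 2 * u →
      B2 ≤ (1 + q * β) ^ α + (1 + q * β) ^ (α - 2) * (2 * α * (α - 1) * q ^ 2 * u) * profF Ψ m β →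
      (1 - ρ / β) * B1 + ρ / β * B2 ≤
        (1 + q * ρ) ^ α * Real.exp ((α - 1) * q * ρ + 2 * α * (α - 1) * q ^ 2 * u) := by
  set Y := 2 * α * (α - 1) * q ^ 2 * u with hY
  have hα1 : 0 < α - 1 := by linarith
  have hY0 : 0 ≤ Y := by positivity
  have hFnn : ∀ β, 0 ≤ profF Ψ m β := fun β => by unfold profF; positivity
  rcases le_or_gt ρ β0 with hle | hlt
  · refine ⟨β0, hβ0, hβ1, hle, ?_⟩
    intro B1 B2 h1 h2
    set lam := ρ / β0 with hlam
    have hl0 : 0 ≤ lam := by positivity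
    have hl1 : lam ≤ 1 := by rw [hlam, div_le_one hβ0]; exact hle
    have hρ : ρ = lam * β0 := by rw [hlam]; field_simp
    set a := q * α * β0 with ha
    set h := q * (α - 1) * β0 with hh
    have ha0 : 0 < a := by positivity
    have hh0 : 0 < h := by positivity
    have e1 := one_add_rpow_le hα (b := q * β0) (by positivity)
    have e1' : α * (q * β0) = a := by rw [ha]; ring
    rw [e1'] at e1
    have e2 : (α - 1) / α = h / a := by rw [ha, hh]; field_simp
    rw [e2] at e1
    have e3 : 1 + a * lam ≤ (1 + q * ρ) ^ α := by
      have := one_add_mul_self_le_rpow_one_add (s := q * ρ) (p := α) (by nlinarith [mul_nonneg hq0.le hρ0]) hα.le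
      refine le_trans (le_of_eq ?_) this
      rw [ha, hρ]; ring
    have e4 : (1 + h * lam) * (1 + Y) ≤ Real.exp ((α - 1) * q * ρ + Y) := by
      rw [Real.exp_add]
      have i1 := Real.add_one_le_exp ((α - 1) * q * ρ)
      have i2 := Real.add_one_le_exp Y
      have i3 : (α - 1) * q * ρ = h * lam := by rw [hh, hρ]; ring
      rw [i3] at i1 ⊢
      exact mul_le_mul (by linarith) (by linarith) (by positivity) (by positivity)
    have e5 : (1 + a * lam) * ((1 + h * lam) * (1 + Y)) ≤ (1 + q * ρ) ^ α * Real.exp ((α - 1) * q * ρ + Y) :=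
      mul_le_mul e3 e4 (by positivity) (by positivity)
    refine le_trans ?_ e5
    have hGY : (1 + q * β0) ^ (α - 2) * Y * profF Ψ m β0 ≤ G * Y * profF Ψ m β0 := by
      gcongr; exact hFnn _
    set F := profF Ψ m β0
    set E := Real.exp a
    have hYh : Y * β0 = 2 * (q * α) * u * h := by rw [hY, hh]; ring
    have hcore : h / a * (E - 1 - a) + Y * (G * F - 1 - a - h) ≤ h := by
      have t1 := mul_le_mul_of_nonneg_left hI hh0.le
      have t2 : h * (2 * (q * α) * u * (G * F - 1 - a - h)) = β0 * (Y * (G * F - 1 - a - h)) := by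
        linear_combination (-(G * F - 1 - a - h)) * hYh
      rw [t2] at t1
      have t3 : h * (β0 * (1 - (E - 1 - a) / a)) = β0 * (h - h / a * (E - 1 - a)) := by
        field_simp
      rw [t3] at t1
      have := le_of_mul_le_mul_left t1 hβ0
      linarith
    have hB2 : B2 ≤ 1 + a + h / a * (E - 1 - a) + G * Y * F := by linarith
    have s1 : (1 - lam) * B1 ≤ (1 - lam) * (1 + Y) := mul_le_mul_of_nonneg_left h1 (by linarith)
    have s2 : lam * B2 ≤ lam * (1 + a + h / a * (E - 1 - a) + G * Y * F) := mul_le_mul_of_nonneg_left hB2 hl0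
    have s3 : lam * (h / a * (E - 1 - a) + Y * (G * F - 1 - a - h)) ≤ lam * h := mul_le_mul_of_nonneg_left hcore hl0
    have s4 : 0 ≤ a * h * lam ^ 2 * (1 + Y) := by positivity
    nlinarith [s1, s2, s3, s4]
  · have hb1 : β0 < 1 := lt_of_lt_of_le hlt hρ1
    have hII : 2 * (q * α) * u * (profF Ψ m ρ - 1) ≤ ρ := by
      have hc := profF_convex hΨ hm
      have hseg : ∃ t, 0 ≤ t ∧ t ≤ 1 ∧ ρ = (1 - t) * β0 + t * 1 := by
        refine ⟨(ρ - β0) / (1 - β0), div_nonneg (by linarith) (by linarith), ?_, ?_⟩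
        · rw [div_le_one (by linarith)]; linarith
        · have : 1 - β0 ≠ 0 := by linarith
          field_simp; ring
      obtain ⟨t, ht0, ht1, ht⟩ := hseg
      have := hc.2 (⟨hβ0.le, hβ1⟩ : β0 ∈ Set.Icc (0:ℝ) 1) (⟨by norm_num, le_rfl⟩ : (1:ℝ) ∈ Set.Icc (0:ℝ) 1)
        (by linarith : 0 ≤ 1 - t) ht0 (by ring)
      simp only [smul_eq_mul] at this
      rw [← ht] at this
      have a1 := mul_le_mul_of_nonneg_left (hII0 hb1) (by linarith : 0 ≤ 1 - t)
      have a2 := mul_le_mul_of_nonneg_left (hII1 hb1) ht0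
      have a3 := mul_le_mul_of_nonneg_left this (by positivity : 0 ≤ 2 * (q * α) * u)
      nlinarith
    have hρp : 0 < ρ := by linarith
    refine ⟨ρ, hρp, hρ1, le_rfl, ?_⟩
    intro B1 B2 h1 h2
    exact caseII hα hq0 hu hρp (hFnn _) hII h2

end PartM7a

section PartM7b

lemma exp_num {t : ℝ} (h0 : 0 ≤ t) (h2 : t ≤ 2) :
    Real.exp t ≤ (1 + t / 2 + (t / 2) ^ 2 / 2 + (t / 2) ^ 3 / 6 + (t / 2) ^ 4 * (5 / 96)) ^ 2 := by
  have h := Real.exp_bound' (x := t / 2) (by linarith) (by linarith) (n := 4) (by norm_num)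
  simp [Finset.sum_range_succ, Nat.factorial] at h
  have e : Real.exp t = Real.exp (t / 2) ^ 2 := by
    rw [← Real.exp_nat_mul]; congr 1; push_cast; ring
  rw [e]
  refine pow_le_pow_left₀ (Real.exp_pos _).le (h.trans (le_of_eq ?_)) 2
  norm_num
  ring

lemma exp_num' {t T E : ℝ} (ht : t ≤ T) (h0 : 0 ≤ T) (h2 : T ≤ 2)
    (hE : (1 + T / 2 + (T / 2) ^ 2 / 2 + (T / 2) ^ 3 / 6 + (T / 2) ^ 4 * (5 / 96)) ^ 2 ≤ E) :
    Real.exp t ≤ E := (Real.exp_le_exp.2 ht).trans ((exp_num h0 h2).trans hE)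

lemma hkw_73 {w : ℝ} (h0 : 0 ≤ w) (h2 : w ≤ 2) : Real.exp ((1 - 0.73) * w) ≤ 1 + 0.73 * w / 2 := by
  have h := convexOn_exp.2 (Set.mem_univ (0:ℝ)) (Set.mem_univ (0.54:ℝ))
        (by linarith : 0 ≤ 1 - w / 2) (by linarith : 0 ≤ w / 2) (by ring)
  simp only [smul_eq_mul, mul_zero, zero_add, Real.exp_zero, mul_one] at h
  have h7 : w / 2 * 0.54 = (1 - 0.73) * w := by ring
  rw [h7] at h
  have e : Real.exp 0.54 ≤ 1.73 := exp_num' le_rfl (by norm_num) (by norm_num) (by norm_num)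
  nlinarith

variable {Ω : Type*} [MeasurableSpace Ω] {μ : Measure Ω} {S : Ω → ℝ} {v : ℝ}

namespace TiltPair

lemma rescale (h : TiltPair μ S v) {α q β : ℝ} (hq0 : 0 < q) (hq : q ≤ 1 / 5) (hβ0 : 0 < β) (hβ1 : β ≤ 1) :
    ∫ ω, ((1 - q) + q * (1 + β) * S ω) ^ α ∂μ =
      (1 + q * β) ^ α * ∫ ω, (1 - q * (1 + β) / (1 + q * β) + q * (1 + β) / (1 + q * β) * S ω) ^ α ∂μ := by
  rw [← integral_const_mul]
  congr 1
  ext ω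
  have hS := h.pos ω
  have hb : 0 < 1 + q * β := by positivity
  have hQ : 0 ≤ q * (1 + β) / (1 + q * β) := by positivity
  have hQ1 : q * (1 + β) / (1 + q * β) ≤ 1 := by rw [div_le_one hb]; nlinarith
  rw [← Real.mul_rpow hb.le (by nlinarith [mul_nonneg hQ hS.le])]
  congr 1
  field_simp
  ring

lemma rescale_alg {α q β u X W : ℝ} (hq0 : 0 < q) (hβ0 : 0 < β) (hu : 0 < u)
    (hX : X ≤ 1 + α * (α - 1) / 2 * (q * (1 + β) / (1 + q * β)) ^ 2 * (Real.exp (4 * u) - 1) * W) :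
    (1 + q * β) ^ α * X ≤ (1 + q * β) ^ α + (1 + q * β) ^ (α - 2) * (2 * α * (α - 1) * q ^ 2 * u) *
      (((Real.exp (4 * u) - 1) / (4 * u)) * ((1 + β) ^ 2 * W)) := by
  have hb : 0 < 1 + q * β := by positivity
  have e : (1 + q * β) ^ (α - 2) = (1 + q * β) ^ α / (1 + q * β) ^ 2 := by
    rw [Real.rpow_sub hb]; norm_num
  rw [e]
  have hp : 0 < (1 + q * β) ^ α := by positivity
  calc (1 + q * β) ^ α * X ≤ (1 + q * β) ^ α * _ := mul_le_mul_of_nonneg_left hX hp.le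
    _ = _ := by
      set P := (1 + q * β) ^ α
      field_simp
      ring

lemma B2_big (h : TiltPair μ S v) (hv : 0 ≤ v) {α q β u : ℝ} (hu : 0 < u) (hvu : v ≤ 4 * u) (hα : 3 ≤ α)
    (hq0 : 0 < q) (hq : q ≤ 1 / 5) (hβ0 : 0 < β) (hβ1 : β ≤ 1)
    (hc : (α - 2) * q * (Real.exp (2 * u * (α + 1)) - 1) ≤ 1) :
    ∫ ω, ((1 - q) + q * (1 + β) * S ω) ^ α ∂μ ≤
      (1 + q * β) ^ α + (1 + q * β) ^ (α - 2) * (2 * α * (α - 1) * q ^ 2 * u) *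
        profF ((Real.exp (4 * u) - 1) / (4 * u))
          (0.73 * ((α - 2) * q * (Real.exp (2 * u * (α + 1)) - 1))) β := by
  set c := (α - 2) * q * (Real.exp (2 * u * (α + 1)) - 1) with hcdef
  have hz : 1 ≤ Real.exp (2 * u * (α + 1)) := Real.one_le_exp (by positivity)
  have hα2 : 0 ≤ α - 2 := by linarith
  have hα1 : 0 ≤ α - 1 := by linarith
  have hc0 : 0 ≤ c := mul_nonneg (by positivity) (by linarith)
  rw [h.rescale hq0 hq hβ0 hβ1]
  have hb : 0 < 1 + q * β := by positivity
  have hQ : 0 ≤ q * (1 + β) / (1 + q * β) := by positivity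
  have hQ1 : q * (1 + β) / (1 + q * β) ≤ 1 := by rw [div_le_one hb]; nlinarith
  have hQ2 : q * (1 + β) / (1 + q * β) ≤ q * (1 + β) := div_le_self (by positivity) (by nlinarith [mul_pos hq0 hβ0])
  have hw0 : 0 ≤ c * (1 + β) := by positivity
  have hw2 : c * (1 + β) ≤ 2 := by nlinarith
  have hz2 : Real.exp (v * (α + 1) / 2) ≤ Real.exp (2 * u * (α + 1)) := by
    apply Real.exp_le_exp.2; nlinarith
  have hz3 : 1 ≤ Real.exp (v * (α + 1) / 2) := Real.one_le_exp (by positivity)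
  have main := h.phi_bound hv hα hQ hQ1 (k := 0.73) (w := c * (1 + β)) (by norm_num) (by norm_num) ?_
    (hkw_73 hw0 hw2)
  · refine rescale_alg hq0 hβ0 hu (W := Real.exp (0.73 * c * (1 + β))) (main.trans ?_)
    have : Real.exp v ≤ Real.exp (4 * u) := Real.exp_le_exp.2 hvu
    rw [mul_assoc 0.73 c]
    gcongr
  · have hcc : c * (1 + β) = (α - 2) * (Real.exp (2 * u * (α + 1)) - 1) * (q * (1 + β)) := by rw [hcdef]; ring
    rw [hcc]
    have : 0 ≤ Real.exp (v * (α + 1) / 2) - 1 := by linarith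
    gcongr

lemma B2_small (h : TiltPair μ S v) (hv : 0 ≤ v) {α q β u : ℝ} (hu : 0 < u) (hu1 : u ≤ 1 / 16) (hvu : v ≤ 4 * u)
    (hα1 : 1 ≤ α) (hα : α ≤ 3)
    (hq0 : 0 < q) (hq : q ≤ 1 / 5) (hβ0 : 0 < β) (hβ1 : β ≤ 1) :
    ∫ ω, ((1 - q) + q * (1 + β) * S ω) ^ α ∂μ ≤
      (1 + q * β) ^ α + (1 + q * β) ^ (α - 2) * (2 * α * (α - 1) * q ^ 2 * u) *
        profF (2 * ((Real.exp (4 * u) - 1) / (4 * u))) 0 β := by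
  rw [h.rescale hq0 hq hβ0 hβ1]
  have hb : 0 < 1 + q * β := by positivity
  have hQ : 0 ≤ q * (1 + β) / (1 + q * β) := by positivity
  have hQ1 : q * (1 + β) / (1 + q * β) ≤ 1 := by rw [div_le_one hb]; nlinarith
  have hα1' : 0 ≤ α - 1 := by linarith
  have main := h.phi_bound_small hv (by linarith) hα1 hα hQ hQ1
  have : Real.exp v ≤ Real.exp (4 * u) := Real.exp_le_exp.2 hvu
  refine (rescale_alg hq0 hβ0 hu (W := 2) (main.trans ?_)).trans (le_of_eq ?_)
  · have : α * (α - 1) * (q * (1 + β) / (1 + q * β)) ^ 2 * (Real.exp v - 1) ≤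
      α * (α - 1) * (q * (1 + β) / (1 + q * β)) ^ 2 * (Real.exp (4 * u) - 1) := by gcongr
    linarith
  · unfold profF
    rw [zero_mul, Real.exp_zero]; ring

lemma B1_big (h : TiltPair μ S v) (hv : 0 ≤ v) {α q u : ℝ} (hu : 0 < u) (hu1 : u ≤ 1 / 16) (hvu : v ≤ u) (hα : 3 ≤ α)
    (hq0 : 0 < q) (hq : q ≤ 1 / 5)
    (hc : (α - 2) * q * (Real.exp (2 * u * (α + 1)) - 1) ≤ 1) :
    ∫ ω, ((1 - q) + q * S ω) ^ α ∂μ ≤ 1 + 2 * α * (α - 1) * q ^ 2 * u := by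
  have hz : 1 ≤ Real.exp (v * (α + 1) / 2) := Real.one_le_exp (by positivity)
  have hz2 : Real.exp (v * (α + 1) / 2) ≤ Real.exp (2 * u * (α + 1)) := by
    apply Real.exp_le_exp.2; nlinarith
  have hα2 : 0 ≤ α - 2 := by linarith
  have hα1 : 0 ≤ α - 1 := by linarith
  have main := h.phi_bound hv hα hq0.le (by linarith) (k := 0.73) (w := 1) (by norm_num) (by norm_num) (by
    refine le_trans ?_ hc
    have : 0 ≤ Real.exp (v * (α + 1) / 2) - 1 := by linarith
    calc _ = (α - 2) * q * (Real.exp (v * (α + 1) / 2) - 1) := by ring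
      _ ≤ _ := by gcongr) (hkw_73 (by norm_num) (by norm_num))
  refine main.trans ?_
  have e1 := exp_le_affine_16 hv (by linarith)
  have e2 : Real.exp (0.73 * 1) ≤ 2.1 := exp_num' le_rfl (by norm_num) (by norm_num) (by norm_num)
  have e3 : (Real.exp v - 1) * Real.exp (0.73 * 1) ≤ 4 * u := by
    have : 0 ≤ Real.exp v - 1 := by linarith [Real.add_one_le_exp v]
    calc _ ≤ (1.07 * v) * 2.1 := by gcongr
      _ ≤ _ := by linarith
  have e4 : 0 ≤ α * (α - 1) / 2 * q ^ 2 := by positivity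
  have := mul_le_mul_of_nonneg_left e3 e4
  nlinarith

lemma B1_small (h : TiltPair μ S v) (hv : 0 ≤ v) {α q u : ℝ} (hu1 : u ≤ 1 / 16) (hvu : v ≤ u)
    (hα1 : 1 ≤ α) (hα : α ≤ 3) (hq0 : 0 < q) (hq : q ≤ 1 / 5) :
    ∫ ω, ((1 - q) + q * S ω) ^ α ∂μ ≤ 1 + 2 * α * (α - 1) * q ^ 2 * u := by
  have hα1' : 0 ≤ α - 1 := by linarith
  refine (h.phi_bound_small hv (by linarith) hα1 hα hq0.le (by linarith)).trans ?_
  have e1 := exp_le_affine_16 hv (by linarith)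
  have e4 : 0 ≤ α * (α - 1) * q ^ 2 := by positivity
  have := mul_le_mul_of_nonneg_left (by linarith : Real.exp v - 1 ≤ 2 * u) e4
  nlinarith

end TiltPair

end PartM7b

section PartM7c

lemma kappa_le {u : ℝ} (hu : 0 < u) (hu1 : u ≤ 1 / 16) :
    (Real.exp (4 * u) - 1) / (4 * u) ≤ Real.exp (2.05 * u) := by
  rw [div_le_iff₀ (by linarith)]
  have h := Real.exp_bound' (x := 4 * u) (by linarith) (by linarith) (n := 4) (by norm_num)
  simp [Finset.sum_range_succ, Nat.factorial] at h
  have h2 := Real.quadratic_le_exp_of_nonneg (x := 2.05 * u) (by linarith)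
  have h3 := mul_le_mul_of_nonneg_right h2 (by linarith : 0 ≤ 4 * u)
  refine le_trans ?_ h3
  norm_num at h
  have e1 : 0 ≤ u ^ 2 * (1 / 16 - u) := by nlinarith [sq_nonneg u]
  have e2 : u ^ 3 * u ≤ u ^ 3 * (1 / 16) := by gcongr
  nlinarith

lemma kappa_num {u : ℝ} (hu : 0 < u) (hu1 : u ≤ 1 / 16) :
    (Real.exp (4 * u) - 1) / (4 * u) ≤ 1.137 :=
  (kappa_le hu hu1).trans (exp_num' (T := 2.05 / 16) (by linarith) (by norm_num) (by norm_num) (by norm_num))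

lemma kappa_nonneg {u : ℝ} (hu : 0 < u) : 0 ≤ (Real.exp (4 * u) - 1) / (4 * u) :=
  div_nonneg (by linarith [Real.one_le_exp (by linarith : 0 ≤ 4 * u)]) (by linarith)

lemma log_sq_le {s : ℝ} (hs : 0 < s) : Real.log (1 + 1 / s) ^ 2 * (s * (s + 1)) ≤ 1 := by
  set A := Real.log (1 + 1 / s) with hA
  have hpos : 0 < 1 + 1 / s := by positivity
  have hA0 : 0 ≤ A := Real.log_nonneg (by have : 0 < 1 / s := by positivity
                                          linarith)
  have e1 : Real.exp A = 1 + 1 / s := by rw [hA, Real.exp_log hpos]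
  have h1 : A / 2 ≤ Real.sinh (A / 2) := Real.self_le_sinh_iff.2 (by linarith)
  have h2 : A ^ 2 ≤ (2 * Real.sinh (A / 2)) ^ 2 := by
    apply pow_le_pow_left₀ hA0; linarith
  have h3 : (2 * Real.sinh (A / 2)) ^ 2 = Real.exp A - 2 + Real.exp (-A) := by
    rw [Real.sinh_eq]
    have i1 : Real.exp A = Real.exp (A / 2) ^ 2 := by rw [← Real.exp_nat_mul]; congr 1; push_cast; ring
    have i2 : Real.exp (-A) = Real.exp (-(A / 2)) ^ 2 := by rw [← Real.exp_nat_mul]; congr 1; push_cast; ring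
    have i3 : Real.exp (A / 2) * Real.exp (-(A / 2)) = 1 := by rw [← Real.exp_add]; simp
    rw [i1, i2]
    linear_combination (-2) * i3
  rw [h3, Real.exp_neg, e1] at h2
  calc A ^ 2 * (s * (s + 1)) ≤ (1 + 1 / s - 2 + (1 + 1 / s)⁻¹) * (s * (s + 1)) := by gcongr
    _ = 1 := by field_simp; ring

/-- mono lemma -/
lemma mono_exp {v V g M E : ℝ} (hv0 : 0 ≤ v) (hv : v ≤ V) (hg : 0 ≤ g) (hM : 0 ≤ M) (hE : 0 ≤ E)
    (h : g * V * M ≤ M - E) : v * (M * Real.exp (g * (V - v)) - E) ≤ V * (M - E) := by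
  have hME : 0 ≤ M - E := le_trans (by have := hv0.trans hv; positivity) h
  rcases eq_or_lt_of_le hv0 with h0 | h0
  · rw [← h0, zero_mul]; exact mul_nonneg (hv0.trans hv) hME
  rcases eq_or_lt_of_le hM with hM0 | hM0
  · rw [← hM0] at h hME ⊢
    have : E = 0 := by linarith
    rw [this]; simp
  have hgV : g * V ≤ 1 := by
    by_contra hc; push Not at hc; nlinarith
  have hy : g * (V - v) < 1 := by
    rcases eq_or_lt_of_le hg with hg0 | hg0
    · rw [← hg0]; norm_num
    · nlinarith [mul_pos hg0 h0]
  have he : Real.exp (g * (V - v)) ≤ 1 / (1 - g * (V - v)) := by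
    have := Real.one_sub_le_exp_neg (g * (V - v))
    rw [Real.exp_neg] at this
    rw [one_div, le_inv_comm₀ (Real.exp_pos _) (by linarith)]
    exact this
  have h1 : v * Real.exp (g * (V - v)) ≤ V - (1 - g * V) * (V - v) := by
    calc _ ≤ v * (1 / (1 - g * (V - v))) := by gcongr
      _ ≤ _ := by
        rw [mul_one_div, div_le_iff₀ (by linarith)]
        have k1 : 0 ≤ (V - v) := by linarith
        have : (V - (1 - g * V) * (V - v)) * (1 - g * (V - v)) - v = g * (V - v) ^ 2 * (1 - g * V) := by ring
        have k2 : 0 ≤ g * (V - v) ^ 2 * (1 - g * V) := by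
          have : 0 ≤ 1 - g * V := by linarith
          positivity
        linarith
  have h2 := mul_le_mul_of_nonneg_left h1 hM
  have h3 := mul_nonneg (by linarith : 0 ≤ V - v) (by linarith : 0 ≤ M - E - g * V * M)
  nlinarith

/-- the finishing lemma for Case I and the left endpoint of Case II -/
lemma finishI {α q u c κ r0 V T g EM : ℝ} (hα : 3 ≤ α) (hq0 : 0 < q) (hq : q ≤ 1 / 5) (hu : 0 < u)
    (hx : 0.2 ≤ q * α) (hκ0 : 0 ≤ κ) (hκ : κ ≤ Real.exp (2.05 * u)) (hc0 : 0 ≤ c)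
    (hr : 1 + 0.2 / (q * α) ≤ r0) (hv : (q * α) ^ 2 * u ≤ V) (hV : V ≤ 0.045) (hg : 0 ≤ g)
    (hexp : 2.05 * u + 0.73 * c * r0 + 0.2 - 0.4 / α ≤ T + g * (V - (q * α) ^ 2 * u))
    (hT : Real.exp T ≤ EM) (hmono : g * V * (r0 ^ 2 * EM) ≤ r0 ^ 2 * EM - 4 / 3)
    (hfin : 10 * V * (r0 ^ 2 * EM - 4 / 3) ≤ 0.8929) :
    (2 * (q * α) * u * (Real.exp (0.2 - 0.4 / α) * profF κ (0.73 * c) (0.2 / (q * α)) - 1 -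
      q * α * (0.2 / (q * α)) - q * (α - 1) * (0.2 / (q * α))) ≤
      0.2 / (q * α) * (1 - (Real.exp (q * α * (0.2 / (q * α))) - 1 - q * α * (0.2 / (q * α))) / (q * α * (0.2 / (q * α)))))
    ∧ 2 * (q * α) * u * (profF κ (0.73 * c) (0.2 / (q * α)) - 1) ≤ 0.2 / (q * α) := by
  have hx0 : 0 < q * α := by linarith
  have hα0 : 0 < α := by linarith
  have e1 : q * α * (0.2 / (q * α)) = 0.2 := by field_simp
  have e2 : q * (α - 1) * (0.2 / (q * α)) = 0.2 * (1 - 1 / α) := by field_simp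
  rw [e1, e2]
  set x := q * α with hxdef
  set v := x ^ 2 * u with hvdef
  have hv0 : 0 ≤ v := by positivity
  set F := profF κ (0.73 * c) (0.2 / x) with hF
  have hβ : 0 < 0.2 / x := by positivity
  have hr1 : 0 ≤ 1 + 0.2 / x := by positivity
  have hEM : 0 ≤ EM := (Real.exp_pos T).le.trans hT
  have hGF : Real.exp (0.2 - 0.4 / α) * F ≤ r0 ^ 2 * EM * Real.exp (g * (V - v)) := by
    have : F ≤ Real.exp (2.05 * u) * (r0 ^ 2 * Real.exp (0.73 * c * r0)) := by
      rw [hF]; unfold profF; gcongr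
    calc _ ≤ Real.exp (0.2 - 0.4 / α) * (Real.exp (2.05 * u) * (r0 ^ 2 * Real.exp (0.73 * c * r0))) := by gcongr
      _ = r0 ^ 2 * Real.exp (2.05 * u + 0.73 * c * r0 + 0.2 - 0.4 / α) := by
        rw [show 2.05 * u + 0.73 * c * r0 + 0.2 - 0.4 / α = (0.2 - 0.4 / α) + (2.05 * u + 0.73 * c * r0) by ring,
          Real.exp_add, Real.exp_add]; ring
      _ ≤ r0 ^ 2 * Real.exp (T + g * (V - v)) := by gcongr
      _ = r0 ^ 2 * Real.exp T * Real.exp (g * (V - v)) := by rw [Real.exp_add]; ring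
      _ ≤ _ := by gcongr
  have hm := mono_exp hv0 hv hg (by positivity : 0 ≤ r0 ^ 2 * EM) (by norm_num : (0:ℝ) ≤ 4 / 3) hmono
  have hmain : 10 * v * (Real.exp (0.2 - 0.4 / α) * F - 4 / 3) ≤ 0.8929 := by
    have := mul_le_mul_of_nonneg_left hGF hv0
    nlinarith
  have hainv : 1 / α ≤ 1 / 3 := by gcongr
  have h04 : 0.4 / α = 0.4 * (1 / α) := by ring
  have hscale : ∀ W : ℝ, 2 * x * u * W = 0.2 / x * (10 * v * W) := by
    intro W; rw [hvdef]; field_simp; ring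
  constructor
  · rw [hscale]
    refine mul_le_mul_of_nonneg_left ?_ hβ.le
    have e5 : Real.exp 0.2 ≤ 1.22142 := exp_num' le_rfl (by norm_num) (by norm_num) (by norm_num)
    have : 10 * v * (Real.exp (0.2 - 0.4 / α) * F - 1 - 0.2 - 0.2 * (1 - 1 / α)) ≤
        10 * v * (Real.exp (0.2 - 0.4 / α) * F - 4 / 3) := by
      apply mul_le_mul_of_nonneg_left _ (by positivity)
      linarith
    refine this.trans (hmain.trans ?_)
    rw [le_sub_comm, div_le_iff₀ (by norm_num)]
    linarith
  · rw [hscale]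
    have : 10 * v * (F - 1) ≤ 1 := by
      have i1 : 16 / 15 ≤ Real.exp (0.2 - 0.4 / α) := by
        have := Real.add_one_le_exp (0.2 - 0.4 / α)
        rw [h04] at this ⊢
        linarith
      have hF0 : 0 ≤ F := by rw [hF]; unfold profF; positivity
      have i2 : 10 * v * (16 / 15 * F) ≤ 10 * v * (Real.exp (0.2 - 0.4 / α) * F) := by gcongr
      nlinarith
    nlinarith

/-- right endpoint of Case II -/
lemma finishII {x u κ c t X V T g EM : ℝ} (hκ0 : 0 ≤ κ) (hκ : κ ≤ Real.exp (2.05 * u)) (ht0 : 0 ≤ t) (htV : t ≤ V) (hg : 0 ≤ g)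
    (hxu : x * u ≤ X * t) (hxu0 : 0 ≤ x * u) (hX : 0 ≤ X)
    (hexp : 2.05 * u + 1.46 * c ≤ T + g * (V - t)) (hT : Real.exp T ≤ EM)
    (hmono : g * V * (4 * EM) ≤ 4 * EM - 1) (hfin : 2 * X * V * (4 * EM - 1) ≤ 1) :
    2 * x * u * (profF κ (0.73 * c) 1 - 1) ≤ 1 := by
  have hEM : 0 ≤ EM := (Real.exp_pos T).le.trans hT
  have hF : profF κ (0.73 * c) 1 ≤ 4 * EM * Real.exp (g * (V - t)) := by
    unfold profF
    calc _ ≤ Real.exp (2.05 * u) * ((1 + 1) ^ 2 * Real.exp (0.73 * c * (1 + 1))) := by gcongr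
      _ = 4 * Real.exp (2.05 * u + 1.46 * c) := by
        rw [Real.exp_add, show 0.73 * c * (1 + 1) = 1.46 * c by ring]; ring
      _ ≤ 4 * Real.exp (T + g * (V - t)) := by gcongr
      _ = 4 * Real.exp T * Real.exp (g * (V - t)) := by rw [Real.exp_add]; ring
      _ ≤ _ := by gcongr
  have hm := mono_exp ht0 htV hg (by positivity : 0 ≤ 4 * EM) (by norm_num : (0:ℝ) ≤ 1) hmono
  set W := 4 * EM * Real.exp (g * (V - t)) - 1 with hW
  have hle : 2 * x * u * (profF κ (0.73 * c) 1 - 1) ≤ 2 * (x * u) * W := by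
    rw [mul_assoc 2 x u]
    apply mul_le_mul_of_nonneg_left _ (by positivity)
    linarith
  refine hle.trans ?_
  rcases le_total W 0 with h | h
  · have := mul_nonneg hxu0 (by linarith : 0 ≤ -W)
    linarith
  · have a1 := mul_le_mul_of_nonneg_right hxu h
    have a2 := mul_le_mul_of_nonneg_left hm hX
    nlinarith

end PartM7c

section PartM7d

/-- the three conclusions needed by `combine` (case `x ≥ 1/5`, `α ≥ 3`) -/
def BigGoal (α q u : ℝ) : Prop :=
  (2 * (q * α) * u * (Real.exp (0.2 - 0.4 / α) * profF ((Real.exp (4 * u) - 1) / (4 * u)) (0.73 * ((α - 2) * q * (Real.exp (2 * u * (α + 1)) - 1))) (0.2 / (q * α)) - 1 -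
      q * α * (0.2 / (q * α)) - q * (α - 1) * (0.2 / (q * α))) ≤
      0.2 / (q * α) * (1 - (Real.exp (q * α * (0.2 / (q * α))) - 1 - q * α * (0.2 / (q * α))) / (q * α * (0.2 / (q * α)))))
    ∧ 2 * (q * α) * u * (profF ((Real.exp (4 * u) - 1) / (4 * u)) (0.73 * ((α - 2) * q * (Real.exp (2 * u * (α + 1)) - 1))) (0.2 / (q * α)) - 1) ≤ 0.2 / (q * α)
    ∧ 2 * (q * α) * u * (profF ((Real.exp (4 * u) - 1) / (4 * u)) (0.73 * ((α - 2) * q * (Real.exp (2 * u * (α + 1)) - 1))) 1 - 1) ≤ 1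

section
variable {α q u A : ℝ}

lemma sz_bound (hα : 3 ≤ α) (hq0 : 0 < q) (hu : 0 < u) (hu1 : u ≤ 1 / 16)
    (hA : A = Real.log (1 + 1 / (q * (α - 1)))) (hC2 : 2 * u * (α + 1) ≤ A - 3.545 * u) :
    q * (α - 1) * (Real.exp (2 * u * (α + 1)) - 1) ≤ 1 - 3.15 * u * (1 + q * (α - 1)) := by
  have hα1 : 0 < α - 1 := by linarith
  set s := q * (α - 1) with hs
  have hs0 : 0 < s := by positivity
  have e1 : Real.exp A = 1 + 1 / s := by rw [hA, Real.exp_log (by positivity)]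
  have e2 : Real.exp (2 * u * (α + 1)) ≤ (1 + 1 / s) * Real.exp (-(3.545 * u)) := by
    rw [← e1, ← Real.exp_add]; exact Real.exp_le_exp.2 (by linarith)
  have e3 : Real.exp (-(3.545 * u)) ≤ 1 - 3.15 * u := by
    have := Real.quadratic_le_exp_of_nonneg (x := 3.545 * u) (by linarith)
    rw [Real.exp_neg]
    refine inv_le_of_inv_le₀ (by linarith) ?_
    refine le_trans ?_ this
    rw [inv_eq_one_div, div_le_iff₀ (by linarith)]
    nlinarith [mul_nonneg hu.le (by linarith : 0 ≤ 1 / 16 - u), mul_nonneg (sq_nonneg u) (by linarith : 0 ≤ 1 / 16 - u)]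
  have e4 : s * Real.exp (2 * u * (α + 1)) ≤ (s + 1) * (1 - 3.15 * u) := by
    calc _ ≤ s * ((1 + 1 / s) * Real.exp (-(3.545 * u))) := by gcongr
      _ = (s + 1) * Real.exp (-(3.545 * u)) := by field_simp
      _ ≤ _ := by gcongr
  linarith

lemma c_nonneg (hα : 3 ≤ α) (hq0 : 0 < q) (hu : 0 < u) :
    0 ≤ (α - 2) * q * (Real.exp (2 * u * (α + 1)) - 1) := by
  have := Real.one_le_exp (by positivity : 0 ≤ 2 * u * (α + 1))
  exact mul_nonneg (mul_nonneg (by linarith) hq0.le) (by linarith)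

lemma c_le_one (hα : 3 ≤ α) (hq0 : 0 < q) (hu : 0 < u) (hu1 : u ≤ 1 / 16)
    (hA : A = Real.log (1 + 1 / (q * (α - 1)))) (hC2 : 2 * u * (α + 1) ≤ A - 3.545 * u) :
    (α - 2) * q * (Real.exp (2 * u * (α + 1)) - 1) ≤ 1 := by
  have h := sz_bound hα hq0 hu hu1 hA hC2
  have h2 := Real.one_le_exp (by positivity : 0 ≤ 2 * u * (α + 1))
  have h3 : 0 ≤ q * (α - 1) := mul_nonneg hq0.le (by linarith)
  have h4 : 0 ≤ u * (1 + q * (α - 1)) := by positivity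
  nlinarith [mul_nonneg hq0.le (by linarith : 0 ≤ Real.exp (2 * u * (α + 1)) - 1)]

set_option maxHeartbeats 1600000 in
lemma cell {x0 x1 V U j e0 e1 C1 r0 T g EM g2 T2 EM2 : ℝ}
    (hα : 3 ≤ α) (hq0 : 0 < q) (hq : q ≤ 1 / 5) (hu : 0 < u) (hu1 : u ≤ 1 / 16)
    (hA : A = Real.log (1 + 1 / (q * (α - 1)))) (hC2 : 2 * u * (α + 1) ≤ A - 3.545 * u)
    (hx0 : x0 ≤ q * α) (hx1 : q * α ≤ x1) (hx02 : 0.2 ≤ x0) (hx01 : x0 ≤ 1)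
    (hV : (q * α) ^ 2 * u ≤ V) (hV45 : V ≤ 0.045) (hU : u ≤ U)
    (hj0 : 0 ≤ j) (hj1 : j ≤ 1.2) (hj : j ^ 2 ≤ (x0 - 0.2) * (x0 + 0.8)) (he0 : 0 < e0) (he1 : 0 ≤ e1)
    (hdisc : (e1 + 7.545 * j * e0 - 2 * j) ^ 2 ≤ 4 * (7.545 * j) * e1 * e0)
    (hC10 : 0 ≤ C1)
    (hC1 : C1 ≤ e1 + 3.15 * (0.8 + x0) * (1 + e0) - e1 * (3.15 * (0.8 + x0)) * U)
    (hr : 1 + 0.2 / x0 ≤ r0) (hg0 : 0 ≤ g)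
    (hg : g ≤ (0.73 * r0 * C1 + 0.8 * j) / x1 ^ 2 - 2.05 / x0 ^ 2)
    (hT : 0.2 + 0.73 * r0 * (1 + e0) - g * V ≤ T) (hEM : Real.exp T ≤ EM)
    (hmono : g * V * (r0 ^ 2 * EM) ≤ r0 ^ 2 * EM - 4 / 3)
    (hfin : 10 * V * (r0 ^ 2 * EM - 4 / 3) ≤ 0.8929)
    (hg20 : 0 ≤ g2) (hg2 : g2 ≤ 1.46 * C1 - 2.05)
    (hT2 : 1.46 * (1 + e0) - g2 * U ≤ T2) (hEM2 : Real.exp T2 ≤ EM2)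
    (hmono2 : g2 * U * (4 * EM2) ≤ 4 * EM2 - 1) (hfin2 : 2 * x1 * U * (4 * EM2 - 1) ≤ 1) :
    BigGoal α q u := by
  have hsz := sz_bound hα hq0 hu hu1 hA hC2
  have hc0 := c_nonneg hα hq0 hu
  have hα1 : 0 < α - 1 := by linarith
  have hα0 : 0 < α := by linarith
  have hs0 : 0 < q * (α - 1) := by positivity
  have hA2 := log_sq_le hs0
  rw [← hA] at hA2
  have hx00 : 0 < x0 := by linarith
  have hxp : 0 < q * α := by positivity
  have hx1p : 0 < x1 := by linarith
  have hss : x0 - 0.2 ≤ q * (α - 1) := by linarith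
  have hA0 : 0 ≤ A := by
    have : 0 ≤ 2 * u * (α + 1) := by positivity
    linarith
  have hjA : j * A ≤ 1 := by
    have h1 : j ^ 2 ≤ q * (α - 1) * (q * (α - 1) + 1) := hj.trans (by
      apply mul_le_mul hss (by linarith) (by linarith) (by linarith))
    have h2 : (j * A) ^ 2 ≤ 1 := by
      have := mul_le_mul_of_nonneg_left h1 (sq_nonneg A)
      linarith
    exact (abs_le_one_iff_mul_self_le_one.2 (by rwa [sq] at h2) |> fun h => (le_abs_self _).trans h)
  have hinv : 0.8 * j * u ≤ 0.4 / α := by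
    rw [le_div_iff₀ hα0]
    have : 2 * u * α ≤ A := by linarith
    linarith [mul_le_mul_of_nonneg_left this hj0]
  set ε := 1 / (α - 1) with hε
  have hε0 : 0 < ε := by positivity
  have hε1 : ε * (α - 1) = 1 := by rw [hε]; field_simp
  have hεle : ε ≤ 1 := by rw [hε, div_le_one hα1]; linarith
  have hju : 7.545 * j * u < 1 := by
    have : j * u ≤ 1.2 * (1 / 16) := by gcongr
    linarith
  have h2j : 2 * u * j ≤ ε * (1 - 7.545 * j * u) := by
    have h1 : 2 * u * (α - 1) ≤ A - 7.545 * u := by linarith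
    have h2 := mul_le_mul_of_nonneg_left h1 (mul_nonneg hε0.le hj0)
    have h3 : ε * j * (2 * u * (α - 1)) = 2 * u * j := by linear_combination (2 * u * j) * hε1
    rw [h3] at h2
    have h4 := mul_le_mul_of_nonneg_left hjA hε0.le
    linarith
  have hεlow : e1 * u - e0 ≤ ε := by
    have hquad : (e1 * u - e0) * (1 - 7.545 * j * u) ≤ 2 * u * j := by
      -- discriminant argument
      set B := e1 + 7.545 * j * e0 - 2 * j with hB
      have : B * u ≤ 7.545 * j * e1 * u ^ 2 + e0 := by
        have hR : 0 ≤ 7.545 * j * e1 * u ^ 2 + e0 := by positivity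
        have hsq : (B * u) ^ 2 ≤ (7.545 * j * e1 * u ^ 2 + e0) ^ 2 := by
          have := mul_le_mul_of_nonneg_right hdisc (sq_nonneg u)
          linarith [sq_nonneg (7.545 * j * e1 * u ^ 2 - e0)]
        exact abs_le_of_sq_le_sq hsq hR |> fun h => (le_abs_self _).trans h
      rw [hB] at this
      linarith
    exact le_of_mul_le_mul_right (hquad.trans h2j) (by linarith)
  set c := (α - 2) * q * (Real.exp (2 * u * (α + 1)) - 1) with hc
  have hcε : c = (1 - ε) * (q * (α - 1) * (Real.exp (2 * u * (α + 1)) - 1)) := by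
    rw [hc]; linear_combination (-(q * (Real.exp (2 * u * (α + 1)) - 1))) * hε1 * (-1)
  have hδ : q * (α - 1) * (Real.exp (2 * u * (α + 1)) - 1) ≤ 1 - 3.15 * (0.8 + x0) * u := by
    refine hsz.trans ?_
    linarith [mul_nonneg hu.le (by linarith : 0 ≤ q * (α - 1) - (x0 - 0.2))]
  have hδ0 : 0 ≤ 1 - 3.15 * (0.8 + x0) * u := by
    have : (0.8 + x0) * u ≤ (0.8 + 1) * (1 / 16) := by gcongr
    linarith
  have hcC : c ≤ (1 + e0) - C1 * u := by
    have h1 : c ≤ (1 + e0 - e1 * u) * (1 - 3.15 * (0.8 + x0) * u) := by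
      rw [hcε]
      calc _ ≤ (1 - ε) * (1 - 3.15 * (0.8 + x0) * u) := mul_le_mul_of_nonneg_left hδ (by linarith)
        _ ≤ _ := mul_le_mul_of_nonneg_right (by linarith) hδ0
    have h2 := mul_le_mul_of_nonneg_right hC1 hu.le
    have h3 : e1 * (3.15 * (0.8 + x0)) * u * u ≤ e1 * (3.15 * (0.8 + x0)) * u * U := by gcongr
    linarith
  have hr0 : 0 ≤ r0 := le_trans (by positivity) hr
  obtain ⟨a1, a2⟩ := finishI (c := c) (κ := (Real.exp (4 * u) - 1) / (4 * u)) (r0 := r0) (V := V) (T := T) (g := g) (EM := EM)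
    hα hq0 hq hu (by linarith) (kappa_nonneg hu) (kappa_le hu hu1) hc0 (le_trans (by gcongr) hr) hV hV45 hg0 (by
      set v := (q * α) ^ 2 * u with hv
      have hv0 : 0 ≤ v := by positivity
      have k1 : v ≤ x1 ^ 2 * u := by rw [hv]; gcongr
      have k2 : x0 ^ 2 * u ≤ v := by rw [hv]; gcongr
      have k3 := mul_le_mul_of_nonneg_right hg hv0
      have k4 : (0.73 * r0 * C1 + 0.8 * j) / x1 ^ 2 * v ≤ (0.73 * r0 * C1 + 0.8 * j) * u := by
        rw [div_mul_eq_mul_div, div_le_iff₀ (by positivity)]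
        have : 0 ≤ 0.73 * r0 * C1 + 0.8 * j := by positivity
        linarith [mul_le_mul_of_nonneg_left k1 this]
      have k5 : 2.05 * u ≤ 2.05 / x0 ^ 2 * v := by
        rw [div_mul_eq_mul_div, le_div_iff₀ (by positivity)]
        linarith
      have k6 : 0.73 * c * r0 ≤ 0.73 * r0 * (1 + e0) - 0.73 * r0 * C1 * u := by
        linarith [mul_le_mul_of_nonneg_left hcC hr0]
      linarith) hEM hmono hfin
  refine ⟨a1, a2, ?_⟩
  exact finishII (X := x1) (V := U) (t := u) (T := T2) (g := g2) (EM := EM2) (kappa_nonneg hu) (kappa_le hu hu1) hu.le hU hg20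
    (by gcongr) (by positivity) hx1p.le (by
      linarith [mul_le_mul_of_nonneg_right hg2 hu.le]) hEM2 hmono2 hfin2

end

end PartM7d

section PartM7e

lemma num_exp {T E : ℝ} (h0 : 0 ≤ T) (h2 : T ≤ 2)
    (hE : (1 + T / 2 + (T / 2) ^ 2 / 2 + (T / 2) ^ 3 / 6 + (T / 2) ^ 4 * (5 / 96)) ^ 2 ≤ E) :
    Real.exp T ≤ E := exp_num' le_rfl h0 h2 hE

lemma v_le_of {x x1 u V : ℝ} (hx1 : x ≤ x1) (hx0 : 0 ≤ x) (hu : 0 ≤ u) (hu1 : u ≤ 1 / 16)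
    (h : x1 ^ 2 * (1 / 16) ≤ V) : x ^ 2 * u ≤ V := by
  refine le_trans ?_ h
  gcongr

lemma u_le_of {x x0 u V U : ℝ} (hx0 : x0 ≤ x) (h0 : 0 < x0) (hu : 0 ≤ u) (hv : x ^ 2 * u ≤ V)
    (h : V ≤ U * x0 ^ 2) : u ≤ U := by
  have : x0 ^ 2 * u ≤ x ^ 2 * u := by gcongr
  have h2 : u * x0 ^ 2 ≤ U * x0 ^ 2 := by linarith
  exact le_of_mul_le_mul_right h2 (by positivity)

section
variable {α q u A : ℝ}

set_option maxHeartbeats 1600000 in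
lemma big_mid (hα : 3 ≤ α) (hq0 : 0 < q) (hq : q ≤ 1 / 5) (hu : 0 < u) (hu1 : u ≤ 1 / 16)
    (hA : A = Real.log (1 + 1 / (q * (α - 1)))) (hC2 : 2 * u * (α + 1) ≤ A - 3.545 * u)
    (hx0 : 0.2 ≤ q * α) (hx1 : q * α ≤ 1) (hv : (q * α) ^ 2 * u ≤ 0.044) : BigGoal α q u := by
  rcases le_total (q * α) 0.27 with h0 | h0
  · refine cell (x0 := 0.2) (x1 := 0.27) (V := 0.00456) (U := 0.0625) (j := 0) (e0 := 0.0001) (e1 := 0) (C1 := 3.15) (r0 := 2) (T := 1.6063) (g := 11.83) (EM := 4.99) (g2 := 2.54) (T2 := 1.3014) (EM2 := 3.678)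
      hα hq0 hq hu hu1 hA hC2 hx0 h0 (by norm_num) (by norm_num) ?_ (by norm_num) ?_
      (by norm_num) (by norm_num) (by norm_num) (by norm_num) (by norm_num) (by norm_num) (by norm_num) (by norm_num)
      (by norm_num) (by norm_num) (by norm_num) (by norm_num) (num_exp (by norm_num) (by norm_num) (by norm_num)) (by norm_num)
      (by norm_num) (by norm_num) (by norm_num) (by norm_num) (num_exp (by norm_num) (by norm_num) (by norm_num)) (by norm_num) (by norm_num)
    · exact v_le_of h0 (by linarith) hu.le hu1 (by norm_num)
    · linarith
  rcases le_total (q * α) 0.36 with h1 | h1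
  · refine cell (x0 := 0.27) (x1 := 0.36) (V := 0.0081) (U := 0.0625) (j := 0.273) (e0 := 0.0058) (e1 := 0.71) (C1 := 3.95) (r0 := 1.7408) (T := 1.3787) (g := 12.29) (EM := 3.974) (g2 := 3.71) (T2 := 1.2366) (EM2 := 3.447)
      hα hq0 hq hu hu1 hA hC2 h0 h1 (by norm_num) (by norm_num) ?_ (by norm_num) ?_
      (by norm_num) (by norm_num) (by norm_num) (by norm_num) (by norm_num) (by norm_num) (by norm_num) (by norm_num)
      (by norm_num) (by norm_num) (by norm_num) (by norm_num) (num_exp (by norm_num) (by norm_num) (by norm_num)) (by norm_num)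
      (by norm_num) (by norm_num) (by norm_num) (by norm_num) (num_exp (by norm_num) (by norm_num) (by norm_num)) (by norm_num) (by norm_num)
    · exact v_le_of h1 (by linarith) hu.le hu1 (by norm_num)
    · linarith
  rcases le_total (q * α) 0.45 with h2 | h2
  · refine cell (x0 := 0.36) (x1 := 0.45) (V := 0.01266) (U := 0.0625) (j := 0.43) (e0 := 0.0172) (e1 := 1.35) (C1 := 4.758) (r0 := 1.5556) (T := 1.1962) (g := 12.56) (EM := 3.31) (g2 := 4.89) (T2 := 1.1795) (EM2 := 3.255)
      hα hq0 hq hu hu1 hA hC2 h1 h2 (by norm_num) (by norm_num) ?_ (by norm_num) ?_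
      (by norm_num) (by norm_num) (by norm_num) (by norm_num) (by norm_num) (by norm_num) (by norm_num) (by norm_num)
      (by norm_num) (by norm_num) (by norm_num) (by norm_num) (num_exp (by norm_num) (by norm_num) (by norm_num)) (by norm_num)
      (by norm_num) (by norm_num) (by norm_num) (by norm_num) (num_exp (by norm_num) (by norm_num) (by norm_num)) (by norm_num) (by norm_num)
    · exact v_le_of h2 (by linarith) hu.le hu1 (by norm_num)
    · linarith
  rcases le_total (q * α) 0.54 with h3 | h3
  · refine cell (x0 := 0.45) (x1 := 0.54) (V := 0.01823) (U := 0.0625) (j := 0.559) (e0 := 0.034) (e1 := 2.06) (C1 := 5.624) (r0 := 1.4445) (T := 1.0764) (g := 11.74) (EM := 2.936) (g2 := 6.16) (T2 := 1.1247) (EM2 := 3.082)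
      hα hq0 hq hu hu1 hA hC2 h2 h3 (by norm_num) (by norm_num) ?_ (by norm_num) ?_
      (by norm_num) (by norm_num) (by norm_num) (by norm_num) (by norm_num) (by norm_num) (by norm_num) (by norm_num)
      (by norm_num) (by norm_num) (by norm_num) (by norm_num) (num_exp (by norm_num) (by norm_num) (by norm_num)) (by norm_num)
      (by norm_num) (by norm_num) (by norm_num) (by norm_num) (num_exp (by norm_num) (by norm_num) (by norm_num)) (by norm_num) (by norm_num)
    · exact v_le_of h3 (by linarith) hu.le hu1 (by norm_num)
    · linarith
  rcases le_total (q * α) 0.61 with h4 | h4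
  · refine cell (x0 := 0.54) (x1 := 0.61) (V := 0.02326) (U := 0.0625) (j := 0.674) (e0 := 0.0576) (e1 := 2.89) (C1 := 6.591) (r0 := 1.3704) (T := 0.9759) (g := 12.13) (EM := 2.655) (g2 := 7.57) (T2 := 1.071) (EM2 := 2.92)
      hα hq0 hq hu hu1 hA hC2 h3 h4 (by norm_num) (by norm_num) ?_ (by norm_num) ?_
      (by norm_num) (by norm_num) (by norm_num) (by norm_num) (by norm_num) (by norm_num) (by norm_num) (by norm_num)
      (by norm_num) (by norm_num) (by norm_num) (by norm_num) (num_exp (by norm_num) (by norm_num) (by norm_num)) (by norm_num)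
      (by norm_num) (by norm_num) (by norm_num) (by norm_num) (num_exp (by norm_num) (by norm_num) (by norm_num)) (by norm_num) (by norm_num)
    · exact v_le_of h4 (by linarith) hu.le hu1 (by norm_num)
    · linarith
  rcases le_total (q * α) 0.67 with h5 | h5
  · refine cell (x0 := 0.61) (x1 := 0.67) (V := 0.02806) (U := 0.0625) (j := 0.76) (e0 := 0.0828) (e1 := 3.69) (C1 := 7.474) (r0 := 1.3279) (T := 0.9135) (g := 11.98) (EM := 2.494) (g2 := 8.86) (T2 := 1.0272) (EM2 := 2.795)
      hα hq0 hq hu hu1 hA hC2 h4 h5 (by norm_num) (by norm_num) ?_ (by norm_num) ?_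
      (by norm_num) (by norm_num) (by norm_num) (by norm_num) (by norm_num) (by norm_num) (by norm_num) (by norm_num)
      (by norm_num) (by norm_num) (by norm_num) (by norm_num) (num_exp (by norm_num) (by norm_num) (by norm_num)) (by norm_num)
      (by norm_num) (by norm_num) (by norm_num) (by norm_num) (num_exp (by norm_num) (by norm_num) (by norm_num)) (by norm_num) (by norm_num)
    · exact v_le_of h5 (by linarith) hu.le hu1 (by norm_num)
    · linarith
  rcases le_total (q * α) 0.72 with h6 | h6
  · refine cell (x0 := 0.67) (x1 := 0.72) (V := 0.0324) (U := 0.0625) (j := 0.831) (e0 := 0.1101) (e1 := 4.49) (C1 := 8.33) (r0 := 1.2986) (T := 0.8655) (g := 11.94) (EM := 2.377) (g2 := 10.11) (T2 := 0.9889) (EM2 := 2.69)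
      hα hq0 hq hu hu1 hA hC2 h5 h6 (by norm_num) (by norm_num) ?_ (by norm_num) ?_
      (by norm_num) (by norm_num) (by norm_num) (by norm_num) (by norm_num) (by norm_num) (by norm_num) (by norm_num)
      (by norm_num) (by norm_num) (by norm_num) (by norm_num) (num_exp (by norm_num) (by norm_num) (by norm_num)) (by norm_num)
      (by norm_num) (by norm_num) (by norm_num) (by norm_num) (num_exp (by norm_num) (by norm_num) (by norm_num)) (by norm_num) (by norm_num)
    · exact v_le_of h6 (by linarith) hu.le hu1 (by norm_num)
    · linarith
  rcases le_total (q * α) 0.76 with h7 | h7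
  · refine cell (x0 := 0.72) (x1 := 0.76) (V := 0.0361) (U := 0.0625) (j := 0.889) (e0 := 0.1382) (e1 := 5.27) (C1 := 9.142) (r0 := 1.2778) (T := 0.8271) (g := 12.04) (EM := 2.288) (g2 := 11.29) (T2 := 0.9562) (EM2 := 2.603)
      hα hq0 hq hu hu1 hA hC2 h6 h7 (by norm_num) (by norm_num) ?_ (by norm_num) ?_
      (by norm_num) (by norm_num) (by norm_num) (by norm_num) (by norm_num) (by norm_num) (by norm_num) (by norm_num)
      (by norm_num) (by norm_num) (by norm_num) (by norm_num) (num_exp (by norm_num) (by norm_num) (by norm_num)) (by norm_num)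
      (by norm_num) (by norm_num) (by norm_num) (by norm_num) (num_exp (by norm_num) (by norm_num) (by norm_num)) (by norm_num) (by norm_num)
    · exact v_le_of h7 (by linarith) hu.le hu1 (by norm_num)
    · linarith
  rcases le_total (q * α) 0.79 with h8 | h8
  · refine cell (x0 := 0.76) (x1 := 0.79) (V := 0.03901) (U := 0.0625) (j := 0.934) (e0 := 0.1643) (e1 := 5.96) (C1 := 9.85) (r0 := 1.2632) (T := 0.7978) (g := 12.2) (EM := 2.222) (g2 := 12.33) (T2 := 0.9293) (EM2 := 2.534)
      hα hq0 hq hu hu1 hA hC2 h7 h8 (by norm_num) (by norm_num) ?_ (by norm_num) ?_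
      (by norm_num) (by norm_num) (by norm_num) (by norm_num) (by norm_num) (by norm_num) (by norm_num) (by norm_num)
      (by norm_num) (by norm_num) (by norm_num) (by norm_num) (num_exp (by norm_num) (by norm_num) (by norm_num)) (by norm_num)
      (by norm_num) (by norm_num) (by norm_num) (by norm_num) (num_exp (by norm_num) (by norm_num) (by norm_num)) (by norm_num) (by norm_num)
    · exact v_le_of h8 (by linarith) hu.le hu1 (by norm_num)
    · linarith
  rcases le_total (q * α) 0.82 with h9 | h9
  · refine cell (x0 := 0.79) (x1 := 0.82) (V := 0.04203) (U := 0.0625) (j := 0.968) (e0 := 0.187) (e1 := 6.55) (C1 := 10.444) (r0 := 1.2532) (T := 0.7787) (g := 12.07) (EM := 2.18) (g2 := 13.19) (T2 := 0.9087) (EM2 := 2.482)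
      hα hq0 hq hu hu1 hA hC2 h8 h9 (by norm_num) (by norm_num) ?_ (by norm_num) ?_
      (by norm_num) (by norm_num) (by norm_num) (by norm_num) (by norm_num) (by norm_num) (by norm_num) (by norm_num)
      (by norm_num) (by norm_num) (by norm_num) (by norm_num) (num_exp (by norm_num) (by norm_num) (by norm_num)) (by norm_num)
      (by norm_num) (by norm_num) (by norm_num) (by norm_num) (num_exp (by norm_num) (by norm_num) (by norm_num)) (by norm_num) (by norm_num)
    · exact v_le_of h9 (by linarith) hu.le hu1 (by norm_num)
    · linarith
  rcases le_total (q * α) 0.84 with h10 | h10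
  · refine cell (x0 := 0.82) (x1 := 0.84) (V := 0.044) (U := 0.0625) (j := 1.002) (e0 := 0.2127) (e1 := 7.2) (C1 := 11.092) (r0 := 1.244) (T := 0.7575) (g := 12.36) (EM := 2.134) (g2 := 14.14) (T2 := 0.8868) (EM2 := 2.429)
      hα hq0 hq hu hu1 hA hC2 h9 h10 (by norm_num) (by norm_num) ?_ (by norm_num) ?_
      (by norm_num) (by norm_num) (by norm_num) (by norm_num) (by norm_num) (by norm_num) (by norm_num) (by norm_num)
      (by norm_num) (by norm_num) (by norm_num) (by norm_num) (num_exp (by norm_num) (by norm_num) (by norm_num)) (by norm_num)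
      (by norm_num) (by norm_num) (by norm_num) (by norm_num) (num_exp (by norm_num) (by norm_num) (by norm_num)) (by norm_num) (by norm_num)
    · exact hv
    · linarith
  rcases le_total (q * α) 0.86 with h11 | h11
  · refine cell (x0 := 0.84) (x1 := 0.86) (V := 0.044) (U := 0.06236) (j := 1.024) (e0 := 0.2292) (e1 := 7.62) (C1 := 11.515) (r0 := 1.2381) (T := 0.7711) (g := 12.27) (EM := 2.163) (g2 := 14.36) (T2 := 0.8992) (EM2 := 2.459)
      hα hq0 hq hu hu1 hA hC2 h10 h11 (by norm_num) (by norm_num) ?_ (by norm_num) ?_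
      (by norm_num) (by norm_num) (by norm_num) (by norm_num) (by norm_num) (by norm_num) (by norm_num) (by norm_num)
      (by norm_num) (by norm_num) (by norm_num) (by norm_num) (num_exp (by norm_num) (by norm_num) (by norm_num)) (by norm_num)
      (by norm_num) (by norm_num) (by norm_num) (by norm_num) (num_exp (by norm_num) (by norm_num) (by norm_num)) (by norm_num) (by norm_num)
    · exact hv
    · exact u_le_of h10 (by norm_num) hu.le hv (by norm_num)
  rcases le_total (q * α) 0.88 with h12 | h12
  · refine cell (x0 := 0.86) (x1 := 0.88) (V := 0.044) (U := 0.0595) (j := 1.046) (e0 := 0.2077) (e1 := 7.43) (C1 := 11.433) (r0 := 1.2326) (T := 0.7768) (g := 11.59) (EM := 2.175) (g2 := 14.64) (T2 := 0.8922) (EM2 := 2.442)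
      hα hq0 hq hu hu1 hA hC2 h11 h12 (by norm_num) (by norm_num) ?_ (by norm_num) ?_
      (by norm_num) (by norm_num) (by norm_num) (by norm_num) (by norm_num) (by norm_num) (by norm_num) (by norm_num)
      (by norm_num) (by norm_num) (by norm_num) (by norm_num) (num_exp (by norm_num) (by norm_num) (by norm_num)) (by norm_num)
      (by norm_num) (by norm_num) (by norm_num) (by norm_num) (num_exp (by norm_num) (by norm_num) (by norm_num)) (by norm_num) (by norm_num)
    · exact hv
    · exact u_le_of h11 (by norm_num) hu.le hv (by norm_num)
  rcases le_total (q * α) 0.91 with h13 | h13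
  · refine cell (x0 := 0.88) (x1 := 0.91) (V := 0.044) (U := 0.05682) (j := 1.068) (e0 := 0.1891) (e1 := 7.26) (C1 := 11.369) (r0 := 1.2273) (T := 0.7955) (g := 10.68) (EM := 2.217) (g2 := 14.54) (T2 := 0.91) (EM2 := 2.486)
      hα hq0 hq hu hu1 hA hC2 h12 h13 (by norm_num) (by norm_num) ?_ (by norm_num) ?_
      (by norm_num) (by norm_num) (by norm_num) (by norm_num) (by norm_num) (by norm_num) (by norm_num) (by norm_num)
      (by norm_num) (by norm_num) (by norm_num) (by norm_num) (num_exp (by norm_num) (by norm_num) (by norm_num)) (by norm_num)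
      (by norm_num) (by norm_num) (by norm_num) (by norm_num) (num_exp (by norm_num) (by norm_num) (by norm_num)) (by norm_num) (by norm_num)
    · exact hv
    · exact u_le_of h12 (by norm_num) hu.le hv (by norm_num)
  rcases le_total (q * α) 0.94 with h14 | h14
  · refine cell (x0 := 0.91) (x1 := 0.94) (V := 0.044) (U := 0.05314) (j := 1.101) (e0 := 0.1655) (e1 := 7.05) (C1 := 11.309) (r0 := 1.2198) (T := 0.8018) (g := 9.91) (EM := 2.231) (g2 := 14.46) (T2 := 0.9333) (EM2 := 2.544)
      hα hq0 hq hu hu1 hA hC2 h13 h14 (by norm_num) (by norm_num) ?_ (by norm_num) ?_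
      (by norm_num) (by norm_num) (by norm_num) (by norm_num) (by norm_num) (by norm_num) (by norm_num) (by norm_num)
      (by norm_num) (by norm_num) (by norm_num) (by norm_num) (num_exp (by norm_num) (by norm_num) (by norm_num)) (by norm_num)
      (by norm_num) (by norm_num) (by norm_num) (by norm_num) (num_exp (by norm_num) (by norm_num) (by norm_num)) (by norm_num) (by norm_num)
    · exact hv
    · exact u_le_of h13 (by norm_num) hu.le hv (by norm_num)
  rcases le_total (q * α) 0.98 with h15 | h15
  · refine cell (x0 := 0.94) (x1 := 0.98) (V := 0.044) (U := 0.0498) (j := 1.134) (e0 := 0.1461) (e1 := 6.88) (C1 := 11.283) (r0 := 1.2128) (T := 0.8179) (g := 9.02) (EM := 2.267) (g2 := 14.42) (T2 := 0.9552) (EM2 := 2.601)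
      hα hq0 hq hu hu1 hA hC2 h14 h15 (by norm_num) (by norm_num) ?_ (by norm_num) ?_
      (by norm_num) (by norm_num) (by norm_num) (by norm_num) (by norm_num) (by norm_num) (by norm_num) (by norm_num)
      (by norm_num) (by norm_num) (by norm_num) (by norm_num) (num_exp (by norm_num) (by norm_num) (by norm_num)) (by norm_num)
      (by norm_num) (by norm_num) (by norm_num) (by norm_num) (num_exp (by norm_num) (by norm_num) (by norm_num)) (by norm_num) (by norm_num)
    · exact hv
    · exact u_le_of h14 (by norm_num) hu.le hv (by norm_num)
  refine cell (x0 := 0.98) (x1 := 1) (V := 0.044) (U := 0.04582) (j := 1.178) (e0 := 0.1251) (e1 := 6.7) (C1 := 11.287) (r0 := 1.2041) (T := 0.8053) (g := 8.72) (EM := 2.238) (g2 := 14.42) (T2 := 0.982) (EM2 := 2.671)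
      hα hq0 hq hu hu1 hA hC2 h15 hx1 (by norm_num) (by norm_num) ?_ (by norm_num) ?_
      (by norm_num) (by norm_num) (by norm_num) (by norm_num) (by norm_num) (by norm_num) (by norm_num) (by norm_num)
      (by norm_num) (by norm_num) (by norm_num) (by norm_num) (num_exp (by norm_num) (by norm_num) (by norm_num)) (by norm_num)
      (by norm_num) (by norm_num) (by norm_num) (by norm_num) (num_exp (by norm_num) (by norm_num) (by norm_num)) (by norm_num) (by norm_num)
  · exact hv
  · exact u_le_of h15 (by norm_num) hu.le hv (by norm_num)

/-- `N = xA` bound and cond3 multiplied by `x²`. -/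
lemma cond3_N {x : ℝ} (hα : 3 ≤ α) (hq0 : 0 < q) (hq : q ≤ 1 / 5) (hx : x = q * α) (hx0 : 0.5 ≤ x)
    (hA : A = Real.log (1 + 1 / (q * (α - 1)))) (hu : 0 < u)
    (hC3 : 2 * u * (4.38 + 5 * x * (A + Real.log x)) ≤ A ^ 2) :
    0 ≤ x * A ∧ (x * A) ^ 2 * ((x - 0.2) * (x + 0.8)) ≤ x ^ 2 ∧
      2 * (x ^ 2 * u) * (4.38 + 5 * (x * A) + 5 * (x - 1)) ≤ (x * A) ^ 2 := by
  have hs : 0 < q * (α - 1) := mul_pos hq0 (by linarith)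
  have hA2 := log_sq_le hs
  rw [← hA] at hA2
  have hA0 : 0 ≤ A := by
    rw [hA]; apply Real.log_nonneg
    have : 0 < 1 / (q * (α - 1)) := by positivity
    linarith
  have hxp : 0 < x := by linarith
  refine ⟨by positivity, ?_, ?_⟩
  · have h1 : (x - 0.2) * (x + 0.8) ≤ q * (α - 1) * (q * (α - 1) + 1) := by
      apply mul_le_mul <;> nlinarith
    have h2 := mul_le_mul_of_nonneg_left h1 (sq_nonneg A)
    have h3 := mul_le_mul_of_nonneg_left (h2.trans hA2) (sq_nonneg x)
    linarith
  · have hl : x - 1 ≤ x * Real.log x := by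
      have := Real.one_sub_inv_le_log_of_pos hxp
      have := mul_le_mul_of_nonneg_left this hxp.le
      have h4 : x * (1 - x⁻¹) = x - 1 := by field_simp
      linarith
    have h5 := mul_le_mul_of_nonneg_left hC3 (sq_nonneg x)
    have h6 : 0 ≤ 10 * (x ^ 2 * u) * (x * Real.log x - (x - 1)) := by
      have : 0 ≤ x * Real.log x - (x - 1) := by linarith
      positivity
    linarith

lemma v044 {x v N : ℝ} (hx0 : 0.839 ≤ x) (hx1 : x ≤ 1) (hN0 : 0 ≤ N)
    (hN : N ^ 2 * ((x - 0.2) * (x + 0.8)) ≤ x ^ 2)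
    (h : 2 * v * (4.38 + 5 * N + 5 * (x - 1)) ≤ N ^ 2) : v ≤ 0.044 := by
  have hD : 0 < (x - 0.2) * (x + 0.8) := by apply mul_pos <;> linarith
  set l := 0.8199 + 0.2 * (x - 0.839) with hl
  have hl0 : 0 ≤ l := by linarith
  have hNl : N ≤ l := by
    have h1 : x ^ 2 ≤ l ^ 2 * ((x - 0.2) * (x + 0.8)) := by
      rw [hl]
      obtain ⟨y, hy⟩ : ∃ y, y = x - 0.839 := ⟨_, rfl⟩
      have hy0 : 0 ≤ y := by linarith
      have hxy : x = y + 0.839 := by linarith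
      have hy1 : y ≤ 0.161 := by linarith
      rw [hxy]
      nlinarith [mul_nonneg hy0 (by linarith : 0 ≤ 0.161 - y), mul_nonneg hy0 (mul_nonneg hy0 hy0), mul_nonneg (mul_nonneg hy0 hy0) (mul_nonneg hy0 hy0)]
    have h2 : N ^ 2 ≤ l ^ 2 := le_of_mul_le_mul_right (hN.trans h1) hD
    exact abs_le_of_sq_le_sq h2 hl0 |> fun h => (le_abs_self _).trans h
  by_contra hc
  push Not at hc
  have h3 : 0 < 4.38 + 5 * N + 5 * (x - 1) := by linarith
  have h4 := mul_le_mul_of_nonneg_right hc.le h3.le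
  nlinarith [mul_nonneg (by linarith : 0 ≤ l - N) (by linarith : 0 ≤ l + N - 0.44)]

lemma v045 {x v N : ℝ} (hx1 : 1 ≤ x) (hN0 : 0 ≤ N)
    (hN : N ^ 2 * ((x - 0.2) * (x + 0.8)) ≤ x ^ 2)
    (h : 2 * v * (4.38 + 5 * N + 5 * (x - 1)) ≤ N ^ 2) : v ≤ 0.045 := by
  have hD : 0 < (x - 0.2) * (x + 0.8) := by apply mul_pos <;> linarith
  by_contra hc
  push Not at hc
  have h3 : 0 < 4.38 + 5 * N + 5 * (x - 1) := by linarith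
  have h4 := mul_le_mul_of_nonneg_right hc.le h3.le
  rcases le_total x 1.35 with h35 | h35
  · have h1 : x ^ 2 ≤ 0.8592 ^ 2 * ((x - 0.2) * (x + 0.8)) := by nlinarith
    have h2 : N ^ 2 ≤ 0.8592 ^ 2 := le_of_mul_le_mul_right (hN.trans h1) hD
    have h5 : N ≤ 0.8592 := abs_le_of_sq_le_sq h2 (by norm_num) |> fun h => (le_abs_self _).trans h
    nlinarith
  · have h1 : x ^ 2 ≤ 1 ^ 2 * ((x - 0.2) * (x + 0.8)) := by nlinarith
    have h2 : N ^ 2 ≤ 1 ^ 2 := le_of_mul_le_mul_right (hN.trans h1) hD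
    have h5 : N ≤ 1 := abs_le_of_sq_le_sq h2 (by norm_num) |> fun h => (le_abs_self _).trans h
    nlinarith

end

end PartM7e

section PartM7f

section
variable {α q u A : ℝ}

lemma big_large (hα : 3 ≤ α) (hq0 : 0 < q) (hq : q ≤ 1 / 5) (hu : 0 < u) (hu1 : u ≤ 1 / 16)
    (hA : A = Real.log (1 + 1 / (q * (α - 1)))) (hC2 : 2 * u * (α + 1) ≤ A - 3.545 * u)
    (hC3 : 2 * u * (4.38 + α * A) ≤ A ^ 2)
    (hx1 : 1 ≤ q * α) (hv : (q * α) ^ 2 * u ≤ 0.045) : BigGoal α q u := by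
  have hc0 := c_nonneg hα hq0 hu
  have hα1 : 0 < α - 1 := by linarith
  have hα0 : 0 < α := by linarith
  have hs : 0 < q * (α - 1) := by positivity
  have hA2 := log_sq_le hs
  have e1 : Real.exp A = 1 + 1 / (q * (α - 1)) := by rw [hA, Real.exp_log (by positivity)]
  rw [← hA] at hA2
  have hτ0 : 0 < 2 * u * (α + 1) := by positivity
  have hA0 : 0 < A := by linarith
  set x := q * α with hx
  set v := x ^ 2 * u with hvd
  have hv0 : 0 ≤ v := by positivity
  set c := (α - 2) * q * (Real.exp (2 * u * (α + 1)) - 1) with hc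
  have hch : Real.exp (2 * u * (α + 1)) - 1 ≤ 2 * u * (α + 1) / A * (1 / (q * (α - 1))) := by
    have hle : 2 * u * (α + 1) / A ≤ 1 := by rw [div_le_one hA0]; linarith
    have h := convexOn_exp.2 (Set.mem_univ (0:ℝ)) (Set.mem_univ A)
        (by linarith : 0 ≤ 1 - 2 * u * (α + 1) / A) (by positivity : 0 ≤ 2 * u * (α + 1) / A) (by ring)
    simp only [smul_eq_mul, mul_zero, zero_add, Real.exp_zero, mul_one] at h
    have h7 : 2 * u * (α + 1) / A * A = 2 * u * (α + 1) := by field_simp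
    rw [h7, e1] at h
    linarith
  have hc1 : c ≤ 2 * u * α / A := by
    have hα2 : 0 ≤ (α - 2) * q := mul_nonneg (by linarith) hq0.le
    calc c ≤ (α - 2) * q * (2 * u * (α + 1) / A * (1 / (q * (α - 1)))) := mul_le_mul_of_nonneg_left hch hα2
      _ = (2 * u / A) * ((α - 2) * (α + 1) / (α - 1)) := by field_simp
      _ ≤ (2 * u / A) * α := by
        apply mul_le_mul_of_nonneg_left _ (by positivity)
        rw [div_le_iff₀ hα1]; nlinarith
      _ = _ := by ring
  have hc2 : 2 * u * α / A ≤ 1 - 8.76 * v := by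
    rw [div_le_iff₀ hA0]
    have h1 : x ^ 2 ≤ q * (α - 1) * (q * (α - 1) + 1) := by
      have hh : q * (α - 1) = x - q := by rw [hx]; ring
      rw [hh]; nlinarith
    have h2 : A ^ 2 * x ^ 2 ≤ 1 := (mul_le_mul_of_nonneg_left h1 (sq_nonneg A)).trans hA2
    have h3 : A ^ 2 * v ≤ u := by
      have := mul_le_mul_of_nonneg_right h2 hu.le
      rw [hvd]; linarith
    have h4 : 2 * u * α * A ≤ (1 - 8.76 * v) * A * A := by linarith
    exact le_of_mul_le_mul_right h4 hA0
  have hcv : c ≤ 1 - 8.76 * v := hc1.trans hc2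
  have hxx : x ≤ x ^ 2 := by nlinarith
  have hxu : x * u ≤ v := by rw [hvd]; gcongr
  have huv : u ≤ v := by nlinarith
  have h04 : 0 ≤ 0.4 / α := by positivity
  obtain ⟨a1, a2⟩ := finishI (c := c) (κ := (Real.exp (4 * u) - 1) / (4 * u)) (r0 := 1.2) (V := 0.045) (T := 0.8231) (g := 5.62) (EM := 2.279)
    hα hq0 hq hu (by linarith) (kappa_nonneg hu) (kappa_le hu hu1) hc0 (by
      have : 0.2 / x ≤ 0.2 := by rw [div_le_iff₀ (by linarith)]; linarith
      linarith) hv le_rfl (by norm_num) (by linarith) (num_exp (by norm_num) (by norm_num) (by norm_num)) (by norm_num) (by norm_num)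
  refine ⟨a1, a2, ?_⟩
  exact finishII (X := 1) (V := 0.045) (t := v) (T := 0.9773) (g := 10.73) (EM := 2.66) (kappa_nonneg hu) (kappa_le hu hu1) hv0 hv (by norm_num)
    (by linarith) (by positivity) (by norm_num) (by linarith) (num_exp (by norm_num) (by norm_num) (by norm_num)) (by norm_num) (by norm_num)

lemma A_log_pos (hα : 1 < α) (hq0 : 0 < q) (hA : A = Real.log (1 + 1 / (q * (α - 1)))) :
    0 < A + Real.log (q * α) := by
  have hα1 : 0 < α - 1 := by linarith
  have hs : 0 < q * (α - 1) := by positivity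
  have hα0 : 0 < α := by linarith
  rw [hA, ← Real.log_mul (by positivity) (by positivity)]
  apply Real.log_pos
  have : 1 < 1 / (q * (α - 1)) * (q * α) := by
    rw [one_div_mul_eq_div, lt_div_iff₀ hs]; nlinarith
  have h2 : 0 < q * α := by positivity
  linarith

lemma big_all (hα : 3 ≤ α) (hq0 : 0 < q) (hq : q ≤ 1 / 5) (hu : 0 < u) (hu1 : u ≤ 1 / 16)
    (hA : A = Real.log (1 + 1 / (q * (α - 1)))) (hC2 : 2 * u * (α + 1) ≤ A - 3.545 * u)
    (hC3 : 2 * u * (4.38 + α * (A + Real.log (q * α))) ≤ A ^ 2)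
    (hx0 : 0.2 ≤ q * α) : BigGoal α q u := by
  have hAl := A_log_pos (by linarith) hq0 hA
  have hC3' : 2 * u * (4.38 + 5 * (q * α) * (A + Real.log (q * α))) ≤ A ^ 2 := by
    refine le_trans ?_ hC3
    have : 5 * (q * α) ≤ α := by nlinarith
    gcongr
  rcases le_total (q * α) 1 with h1 | h1
  · apply big_mid hα hq0 hq hu hu1 hA hC2 hx0 h1
    rcases le_total (q * α) 0.839 with h2 | h2
    · exact v_le_of h2 (by linarith) hu.le hu1 (by norm_num)
    · obtain ⟨a1, a2, a3⟩ := cond3_N hα hq0 hq rfl (by linarith) hA hu hC3'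
      exact v044 h2 h1 a1 a2 a3
  · obtain ⟨a1, a2, a3⟩ := cond3_N hα hq0 hq rfl (by linarith) hA hu hC3'
    refine big_large hα hq0 hq hu hu1 hA hC2 ?_ h1 (v045 h1 a1 a2 a3)
    refine le_trans ?_ hC3
    have := Real.log_nonneg h1
    gcongr
    linarith

lemma exp_small_quot {x : ℝ} (hx0 : 0 < x) (hx : x ≤ 0.2) : (Real.exp x - 1 - x) / x ≤ 0.11 := by
  have h := Real.exp_bound' (x := x) (by linarith) (by linarith) (n := 3) (by norm_num)
  simp [Finset.sum_range_succ, Nat.factorial] at h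
  norm_num at h
  rw [div_le_iff₀ hx0]
  nlinarith [mul_nonneg hx0.le (by linarith : 0 ≤ 0.2 - x), mul_nonneg (sq_nonneg x) (by linarith : 0 ≤ 0.2 - x)]

/-- the analytic core of the second direction -/
theorem core_dir2 {Ω : Type*} [MeasurableSpace Ω] {ρ : ℝ} (hα : 1 < α) (hq0 : 0 < q) (hq : q ≤ 1 / 5) (hu : 0 < u) (hu1 : u ≤ 1 / 16)
    (hA : A = Real.log (1 + 1 / (q * (α - 1)))) (hC2 : 2 * u * (α + 1) ≤ A - 3.545 * u)
    (hC3 : 2 * u * (4.38 + α * (A + Real.log (q * α))) ≤ A ^ 2) (hρ0 : 0 ≤ ρ) (hρ1 : ρ ≤ 1) :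
    ∃ β B1 B2 : ℝ, 0 < β ∧ ρ ≤ β ∧
      (∀ (μ : Measure Ω) (S : Ω → ℝ) (v : ℝ), TiltPair μ S v → 0 ≤ v → v ≤ u →
        ∫ ω, ((1 - q) + q * S ω) ^ α ∂μ ≤ B1) ∧
      (∀ (μ : Measure Ω) (S : Ω → ℝ) (v : ℝ), TiltPair μ S v → 0 ≤ v → v ≤ 4 * u →
        ∫ ω, ((1 - q) + q * (1 + β) * S ω) ^ α ∂μ ≤ B2) ∧
      (1 - ρ / β) * B1 + ρ / β * B2 ≤
        (1 + q * ρ) ^ α * Real.exp ((α - 1) * q * ρ + 2 * α * (α - 1) * q ^ 2 * u) := by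
  have hκ0 := kappa_nonneg hu
  have hκ := kappa_num hu hu1
  have hx0 : 0 < q * α := mul_pos hq0 (by linarith)
  have hα1 : 0 < α - 1 := by linarith
  have e02 : Real.exp 0.2 ≤ 1.22142 := num_exp (by norm_num) (by norm_num) (by norm_num)
  rcases le_total 3 α with h3 | h3
  · have hc0 := c_nonneg h3 hq0 hu
    have hc1 := c_le_one h3 hq0 hu hu1 hA hC2
    suffices hcomb : ∃ β, 0 < β ∧ β ≤ 1 ∧ ρ ≤ β ∧ ∀ B1 B2 : ℝ, B1 ≤ 1 + 2 * α * (α - 1) * q ^ 2 * u →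
      B2 ≤ (1 + q * β) ^ α + (1 + q * β) ^ (α - 2) * (2 * α * (α - 1) * q ^ 2 * u) *
        profF ((Real.exp (4 * u) - 1) / (4 * u)) (0.73 * ((α - 2) * q * (Real.exp (2 * u * (α + 1)) - 1))) β →
      (1 - ρ / β) * B1 + ρ / β * B2 ≤
        (1 + q * ρ) ^ α * Real.exp ((α - 1) * q * ρ + 2 * α * (α - 1) * q ^ 2 * u) by
      obtain ⟨β, b1, b2, b3, b4⟩ := hcomb
      exact ⟨β, _, _, b1, b3, fun μ S v h hv hvu => h.B1_big hv hu hu1 hvu h3 hq0 hq hc1,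
        fun μ S v h hv hvu => h.B2_big hv hu hvu h3 hq0 hq b1 b2 hc1, b4 _ _ le_rfl le_rfl⟩
    have hG : ∀ b : ℝ, 0 ≤ b → (1 + b) ^ (α - 2) ≤ Real.exp (b * (α - 2)) := by
      intro b hb
      rw [Real.exp_mul]
      exact Real.rpow_le_rpow (by linarith) (by linarith [Real.add_one_le_exp b]) (by linarith)
    rcases le_total (q * α) 0.2 with hx | hx
    · refine combine (β0 := 1) (G := Real.exp 0.2) hα hq0 hu.le hρ0 hρ1 hκ0 (by positivity) one_pos le_rfl ?_ ?_
        (fun h => absurd h (lt_irrefl _)) (fun h => absurd h (lt_irrefl _))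
      · refine (hG _ (by linarith)).trans (Real.exp_le_exp.2 ?_)
        nlinarith
      · simp only [mul_one, one_mul]
        have hq1 := exp_small_quot hx0 hx
        set c := (α - 2) * q * (Real.exp (2 * u * (α + 1)) - 1) with hc
        have hF : profF ((Real.exp (4 * u) - 1) / (4 * u)) (0.73 * c) 1 ≤ 1.137 * ((1 + 1) ^ 2 * 4.32) := by
          have : Real.exp (0.73 * c * (1 + 1)) ≤ 4.32 :=
            exp_num' (T := 1.46) (by linarith) (by norm_num) (by norm_num) (by norm_num)
          unfold profF
          gcongr
        have hF0 : 0 ≤ profF ((Real.exp (4 * u) - 1) / (4 * u)) (0.73 * c) 1 := by unfold profF; positivity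
        set F := profF ((Real.exp (4 * u) - 1) / (4 * u)) (0.73 * c) 1
        have hEF : Real.exp 0.2 * F ≤ 1.22142 * (1.137 * ((1 + 1) ^ 2 * 4.32)) := by gcongr
        have hs : 0 ≤ q * (α - 1) := by positivity
        have hxu : 2 * (q * α) * u ≤ 2 * 0.2 * (1 / 16) := by gcongr
        have hxu0 : 0 ≤ 2 * (q * α) * u := by positivity
        calc _ ≤ 2 * (q * α) * u * (1.22142 * (1.137 * ((1 + 1) ^ 2 * 4.32))) := by
              apply mul_le_mul_of_nonneg_left _ hxu0; linarith
          _ ≤ 2 * 0.2 * (1 / 16) * (1.22142 * (1.137 * ((1 + 1) ^ 2 * 4.32))) := by gcongr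
          _ ≤ 1 - 0.11 := by norm_num
          _ ≤ _ := by linarith
    · obtain ⟨a1, a2, a3⟩ := big_all h3 hq0 hq hu hu1 hA hC2 hC3 hx
      have hα0 : 0 < α := by linarith
      refine combine (β0 := 0.2 / (q * α)) (G := Real.exp (0.2 - 0.4 / α)) hα hq0 hu.le hρ0 hρ1 hκ0 (by positivity) (by positivity)
        (by rw [div_le_one hx0]; exact hx) ?_ a1 (fun _ => a2) (fun _ => a3)
      refine (hG _ (by positivity)).trans (Real.exp_le_exp.2 (le_of_eq ?_))
      field_simp
      ring
  · suffices hcomb : ∃ β, 0 < β ∧ β ≤ 1 ∧ ρ ≤ β ∧ ∀ B1 B2 : ℝ, B1 ≤ 1 + 2 * α * (α - 1) * q ^ 2 * u →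
      B2 ≤ (1 + q * β) ^ α + (1 + q * β) ^ (α - 2) * (2 * α * (α - 1) * q ^ 2 * u) *
        profF (2 * ((Real.exp (4 * u) - 1) / (4 * u))) 0 β →
      (1 - ρ / β) * B1 + ρ / β * B2 ≤
        (1 + q * ρ) ^ α * Real.exp ((α - 1) * q * ρ + 2 * α * (α - 1) * q ^ 2 * u) by
      obtain ⟨β, b1, b2, b3, b4⟩ := hcomb
      exact ⟨β, _, _, b1, b3, fun μ S v h hv hvu => h.B1_small hv hu1 hvu hα.le h3 hq0 hq,
        fun μ S v h hv hvu => h.B2_small hv hu hu1 hvu hα.le h3 hq0 hq b1 b2, b4 _ _ le_rfl le_rfl⟩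
    have hG : ∀ b : ℝ, 0 ≤ b → (1 + b) ^ (α - 2) ≤ Real.exp (b * α) := by
      intro b hb
      rw [Real.exp_mul]
      refine (Real.rpow_le_rpow_of_exponent_le (by linarith) (by linarith : α - 2 ≤ α)).trans ?_
      exact Real.rpow_le_rpow (by linarith) (by linarith [Real.add_one_le_exp b]) (by linarith)
    have hx6 : q * α ≤ 0.6 := by nlinarith
    set κ := (Real.exp (4 * u) - 1) / (4 * u) with hκd
    have hprof : ∀ β, profF (2 * κ) 0 β = 2 * κ * (1 + β) ^ 2 := by
      intro β; unfold profF; rw [zero_mul, Real.exp_zero, mul_one]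
    rcases le_total (q * α) 0.2 with hx | hx
    · refine combine (β0 := 1) (G := Real.exp 0.2) hα hq0 hu.le hρ0 hρ1 (by positivity) le_rfl one_pos le_rfl ?_ ?_
        (fun h => absurd h (lt_irrefl _)) (fun h => absurd h (lt_irrefl _))
      · refine (hG _ (by linarith)).trans (Real.exp_le_exp.2 ?_)
        linarith
      · simp only [mul_one, one_mul]
        have hq1 := exp_small_quot hx0 hx
        rw [hprof]
        have hEF : Real.exp 0.2 * (2 * κ * (1 + 1) ^ 2) ≤ 1.22142 * (2 * 1.137 * (1 + 1) ^ 2) := by gcongr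
        have hs : 0 ≤ q * (α - 1) := by positivity
        have hxu : 2 * (q * α) * u ≤ 2 * 0.2 * (1 / 16) := by gcongr
        have hxu0 : 0 ≤ 2 * (q * α) * u := by positivity
        calc _ ≤ 2 * (q * α) * u * (1.22142 * (2 * 1.137 * (1 + 1) ^ 2)) := by
              apply mul_le_mul_of_nonneg_left _ hxu0; linarith
          _ ≤ 2 * 0.2 * (1 / 16) * (1.22142 * (2 * 1.137 * (1 + 1) ^ 2)) := by gcongr
          _ ≤ 1 - 0.11 := by norm_num
          _ ≤ _ := by linarith
    · have hα0 : 0 < α := by linarith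
      have e1 : q * α * (0.2 / (q * α)) = 0.2 := by field_simp
      have e2 : q * (α - 1) * (0.2 / (q * α)) = 0.2 * (1 - 1 / α) := by field_simp
      have hh : 0 ≤ 0.2 * (1 - 1 / α) := by
        have : 1 / α ≤ 1 := by rw [div_le_one hα0]; exact hα.le
        linarith
      refine combine (β0 := 0.2 / (q * α)) (G := Real.exp 0.2) hα hq0 hu.le hρ0 hρ1 (by positivity) le_rfl (by positivity)
        (by rw [div_le_one hx0]; exact hx) ?_ ?_ (fun _ => ?_) (fun _ => ?_)
      · refine (hG _ (by positivity)).trans (Real.exp_le_exp.2 (le_of_eq ?_))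
        field_simp
      · rw [e1, e2, hprof]
        set x := q * α
        have hscale : ∀ W : ℝ, 2 * x * u * W = 0.2 / x * (10 * u * (x ^ 2 * W)) := by
          intro W; field_simp; ring
        rw [hscale]
        apply mul_le_mul_of_nonneg_left _ (by positivity)
        have h1 : x ^ 2 * (Real.exp 0.2 * (2 * κ * (1 + 0.2 / x) ^ 2) - 1 - 0.2 - 0.2 * (1 - 1 / α)) ≤
            1.22142 * (2 * 1.137) * (x + 0.2) ^ 2 - 1.2 * x ^ 2 := by
          have i1 : x ^ 2 * (Real.exp 0.2 * (2 * κ * (1 + 0.2 / x) ^ 2)) = Real.exp 0.2 * (2 * κ) * (x + 0.2) ^ 2 := by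
            field_simp
          have i2 : Real.exp 0.2 * (2 * κ) * (x + 0.2) ^ 2 ≤ 1.22142 * (2 * 1.137) * (x + 0.2) ^ 2 := by gcongr
          have i3 : 0 ≤ x ^ 2 * (0.2 * (1 - 1 / α)) := by positivity
          linarith
        have h2 : 1.22142 * (2 * 1.137) * (x + 0.2) ^ 2 - 1.2 * x ^ 2 ≤ 1.37 := by nlinarith
        calc _ ≤ 10 * u * 1.37 := by
              apply mul_le_mul_of_nonneg_left (h1.trans h2) (by positivity)
          _ ≤ 10 * (1 / 16) * 1.37 := by gcongr
          _ ≤ _ := by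
            rw [le_sub_comm, div_le_iff₀ (by norm_num)]
            linarith
      · rw [hprof]
        set x := q * α
        have hscale : ∀ W : ℝ, 2 * x * u * W = 0.2 / x * (10 * u * (x ^ 2 * W)) := by
          intro W; field_simp; ring
        rw [hscale]
        have h1 : x ^ 2 * (2 * κ * (1 + 0.2 / x) ^ 2 - 1) ≤ 2 * 1.137 * (x + 0.2) ^ 2 - x ^ 2 := by
          have i1 : x ^ 2 * (2 * κ * (1 + 0.2 / x) ^ 2) = 2 * κ * (x + 0.2) ^ 2 := by
            field_simp
          have i2 : 2 * κ * (x + 0.2) ^ 2 ≤ 2 * 1.137 * (x + 0.2) ^ 2 := by gcongr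
          linarith
        have h2 : 2 * 1.137 * (x + 0.2) ^ 2 - x ^ 2 ≤ 1.2 := by nlinarith
        have h3 : 10 * u * (x ^ 2 * (2 * κ * (1 + 0.2 / x) ^ 2 - 1)) ≤ 1 := by
          calc _ ≤ 10 * u * 1.2 := mul_le_mul_of_nonneg_left (h1.trans h2) (by positivity)
            _ ≤ 1 := by linarith
        have := mul_le_mul_of_nonneg_left h3 (by positivity : 0 ≤ 0.2 / x)
        linarith
      · rw [hprof]
        have hxu : 2 * (q * α) * u ≤ 2 * 0.6 * (1 / 16) := by gcongr
        have hxu0 : 0 ≤ 2 * (q * α) * u := by positivity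
        calc _ ≤ 2 * (q * α) * u * (2 * 1.137 * (1 + 1) ^ 2) := by
              apply mul_le_mul_of_nonneg_left _ hxu0; linarith
          _ ≤ 2 * 0.6 * (1 / 16) * (2 * 1.137 * (1 + 1) ^ 2) := by gcongr
          _ ≤ 1 := by norm_num

end

end PartM7f


lemma log_bound {I B α : ℝ} (hα : 1 < α) (hI0 : 0 ≤ I) (hB : 0 ≤ B) (hI : I ≤ Real.exp ((α - 1) * B)) :
    (α - 1)⁻¹ * Real.log I ≤ B := by
  have hα1 : 0 < α - 1 := by linarith
  have h : Real.log I ≤ (α - 1) * B := by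
    rcases eq_or_lt_of_le hI0 with h0 | h0
    · rw [← h0, Real.log_zero]; positivity
    · rw [Real.log_le_iff_le_exp h0]; exact hI
  rw [inv_mul_le_iff₀ hα1]; exact h

lemma srgmDensity_nonneg {ι : Type*} [DecidableEq ι] {d : ℕ} (f : Finset ι → EuclideanSpace ℝ (Fin d))
    {σ q : ℝ} (hσ : 0 < σ) (hq0 : 0 < q) (hq1 : q < 1) (NB : ℕ) (D : Finset ι) (ω : EuclideanSpace ℝ (Fin d)) :
    0 ≤ srgmDensity d f σ q NB D ω := by
  have hp : 0 < 1 - q := by linarith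
  unfold srgmDensity
  refine mul_nonneg (inv_nonneg.2 (Finset.sum_nonneg fun J _ => by positivity))
    (Finset.sum_nonneg fun J _ => mul_nonneg (by positivity) (gaussDensity_pos hσ _).le)

/-- SRGM privacy bound: under the stated conditions on `q`, `σ`, `N_B`, `α`, the
Sampled-with-Rejection Gaussian Mechanism applied to a function `f` of `ℓ₂`-sensitivity 1
satisfies `(α, γ)`-RDP with
`γ = q·p(N_B−1; N̄, q)/(1 − P(N_B−1; N̄, q)) + 2q²α/σ²`. -/
theorem srgm_rdp {ι : Type*} [DecidableEq ι] {d : ℕ}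
    (f : Finset ι → EuclideanSpace ℝ (Fin d))
    (hsens : ∀ (S : Finset ι) (a : ι), a ∉ S → ‖f (insert a S) - f S‖ ≤ 1)
    (σ q A α : ℝ) (NB Nbar : ℕ)
    (hq0 : 0 < q) (hq : q ≤ 1 / 5) (hσ : 4 ≤ σ)
    (hNB1 : 1 ≤ NB) (hNBq : (NB : ℝ) ≤ q * Nbar)
    (hA : A = Real.log (1 + 1 / (q * (α - 1))))
    (hα1 : 1 < α)
    (hα2 : α ≤ (1 / 2) * σ ^ 2 * A - 2 * Real.log σ)
    (hα3 : α ≤ ((1 / 2) * σ ^ 2 * A ^ 2 - Real.log 5 - 2 * Real.log σ) /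
      (A + Real.log (q * α) + 1 / (2 * σ ^ 2)))
    (D : Finset ι) (a : ι) (ha : a ∉ D) (hDsize : Nbar ≤ D.card) :
    (α - 1)⁻¹ * Real.log (∫ ω,
        (srgmDensity d f σ q NB D ω / srgmDensity d f σ q NB (insert a D) ω) ^ α *
          srgmDensity d f σ q NB (insert a D) ω) ≤
      q * binPMF q Nbar (NB - 1) / (1 - binCDF q Nbar (NB - 1)) + 2 * q ^ 2 * α / σ ^ 2 ∧
    (α - 1)⁻¹ * Real.log (∫ ω,
        (srgmDensity d f σ q NB (insert a D) ω / srgmDensity d f σ q NB D ω) ^ α *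
          srgmDensity d f σ q NB D ω) ≤
      q * binPMF q Nbar (NB - 1) / (1 - binCDF q Nbar (NB - 1)) + 2 * q ^ 2 * α / σ ^ 2 := by
  obtain ⟨k, rfl⟩ : ∃ k, NB = k + 1 := ⟨NB - 1, by omega⟩
  have hq1 : q < 1 := by linarith
  have hσ0 : 0 < σ := by linarith
  have hαm : 0 < α - 1 := by linarith
  have hα0 : 0 < α := by linarith
  push_cast at hNBq
  have hkN : k + 1 ≤ Nbar := by
    have : (k + 1 : ℝ) ≤ Nbar := by nlinarith [(Nat.cast_nonneg Nbar : (0:ℝ) ≤ Nbar)]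
    exact_mod_cast this
  have hkD : k + 1 ≤ D.card := hkN.trans hDsize
  have htail := binTail_eq q hNB1 hkN
  rw [htail]
  simp only [Nat.add_sub_cancel]
  have hmono := rho_mono hq0 hq1 hNBq hDsize
  set ρ := binPMF q D.card k / binTail q D.card (k + 1) with hρ
  have hZ : 0 < binTail q D.card (k + 1) := binTail_pos hq0 hq1 hkD
  have hρ0 : 0 ≤ ρ := div_nonneg (binPMF_nonneg hq0 hq1 _ _) hZ.le
  have hρ1 : ρ ≤ 1 := by
    rw [hρ, div_le_one hZ, binTail_head q hkD]
    have h1 := binPMF_le_succ hq0 hq1 (n := D.card) (k := k) (hNBq.trans (by gcongr))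
    have h2 : 0 ≤ binTail q D.card (k + 1 + 1) := by
      unfold binTail
      exact Finset.sum_nonneg fun j _ => binPMF_nonneg hq0 hq1 _ _
    linarith
  set u := 1 / σ ^ 2 with hu
  have hu0 : 0 < u := by positivity
  have hσ16 : 16 ≤ σ ^ 2 := by nlinarith
  have hu1 : u ≤ 1 / 16 := by rw [hu]; gcongr
  have hσu : σ ^ 2 * u = 1 := by rw [hu]; field_simp
  have hB : q * ρ + 2 * q ^ 2 * α * u ≤
      q * binPMF q Nbar k / binTail q Nbar (k + 1) + 2 * q ^ 2 * α / σ ^ 2 := by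
    have h1 := mul_le_mul_of_nonneg_left hmono hq0.le
    have h2 : 2 * q ^ 2 * α / σ ^ 2 = 2 * q ^ 2 * α * u := by rw [hu]; ring
    rw [h2, mul_div_assoc]
    linarith
  have hB0 : 0 ≤ q * ρ + 2 * q ^ 2 * α * u := by positivity
  have hI0 : ∀ D₁ D₂ : Finset ι, 0 ≤ ∫ ω, persp α (srgmDensity d f σ q (k + 1) D₁ ω) (srgmDensity d f σ q (k + 1) D₂ ω) :=
    fun D₁ D₂ => integral_nonneg fun ω => persp_nonneg (srgmDensity_nonneg f hσ0 hq0 hq1 _ _ _)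
      (srgmDensity_nonneg f hσ0 hq0 hq1 _ _ _)
  constructor
  · refine le_trans ?_ hB
    refine log_bound hα1 (hI0 D (insert a D)) hB0 ?_
    refine (dir1_struct f hsens hσ hq0 hq hα1 k D a ha hkD).trans ?_
    rw [← hρ]
    have h1 : (1 + q * ρ) ^ (α - 1) ≤ Real.exp ((α - 1) * (q * ρ)) := by
      rw [mul_comm (α - 1), Real.exp_mul]
      exact Real.rpow_le_rpow (by positivity) (by linarith [Real.add_one_le_exp (q * ρ)]) hαm.le
    calc _ ≤ Real.exp ((α - 1) * (q * ρ)) * Real.exp (2 * α * (α - 1) * q ^ 2 * (1 / σ ^ 2)) := by gcongr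
      _ = _ := by rw [← Real.exp_add]; congr 1; ring
  · refine le_trans ?_ hB
    refine log_bound hα1 (hI0 (insert a D) D) hB0 ?_
    -- parameter conditions
    have hlog2 := Real.log_two_gt_d9
    have hlogσ' : 2.7725 ≤ 2 * Real.log σ := by
      have h4 : Real.log 4 ≤ Real.log σ := Real.log_le_log (by norm_num) hσ
      have h5 : Real.log 4 = 2 * Real.log 2 := by
        rw [show (4:ℝ) = 2 ^ 2 by norm_num, Real.log_pow]; push_cast; ring
      linarith
    have hlog5 : 1.6085 ≤ Real.log 5 := by
      have h1 : 0.2229 ≤ Real.log (5 / 4) := by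
        rw [Real.le_log_iff_exp_le (by norm_num)]
        exact num_exp (by norm_num) (by norm_num) (by norm_num)
      have h2 : Real.log 5 = 2 * Real.log 2 + Real.log (5 / 4) := by
        rw [show (5:ℝ) = 2 ^ 2 * (5 / 4) by norm_num, Real.log_mul (by norm_num) (by norm_num),
          Real.log_pow]
        norm_num
      linarith
    have hC2 : 2 * u * (α + 1) ≤ A - 3.545 * u := by
      have h1 := mul_le_mul_of_nonneg_left hα2 (by positivity : 0 ≤ 2 * u)
      have h2 : 2 * u * (1 / 2 * σ ^ 2 * A - 2 * Real.log σ) = A - 2 * u * (2 * Real.log σ) := by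
        linear_combination A * hσu
      have h3 := mul_le_mul_of_nonneg_left hlogσ' (by positivity : 0 ≤ 2 * u)
      linarith
    have hC3 : 2 * u * (4.38 + α * (A + Real.log (q * α))) ≤ A ^ 2 := by
      have hpos := A_log_pos hα1 hq0 hA
      have hden : 0 < A + Real.log (q * α) + 1 / (2 * σ ^ 2) := by positivity
      rw [le_div_iff₀ hden] at hα3
      have h1 := mul_le_mul_of_nonneg_left hα3 (by positivity : 0 ≤ 2 * u)
      have h2 : 2 * u * (1 / 2 * σ ^ 2 * A ^ 2 - Real.log 5 - 2 * Real.log σ) = A ^ 2 - 2 * u * (Real.log 5 + 2 * Real.log σ) := by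
        linear_combination A ^ 2 * hσu
      rw [h2] at h1
      have h3 := mul_le_mul_of_nonneg_left (by linarith : 4.38 ≤ Real.log 5 + 2 * Real.log σ) (by positivity : 0 ≤ 2 * u)
      have h4 : 0 ≤ 2 * u * (α * (1 / (2 * σ ^ 2))) := by positivity
      linarith
    obtain ⟨β, B1, B2, b1, b2, b3, b4, b5⟩ := core_dir2 (Ω := EuclideanSpace ℝ (Fin d)) hα1 hq0 hq hu0 hu1 hA hC2 hC3 hρ0 hρ1
    refine (dir2_struct f hsens hσ0 hq0 hq1 hα1 k D a ha hkD b1 (B1 := B1) (B2 := B2) b2 ?_ ?_).trans ?_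
    · intro x w hw
      rw [persp_gauss_integral hσ0]
      refine b3 _ _ _ (gaussMeas_tiltPair hσ0 x w) (by positivity) ?_
      rw [hu]
      gcongr
      exact pow_le_one₀ (norm_nonneg _) hw
    · intro x w hw
      rw [persp_gauss_integral hσ0]
      refine b4 _ _ _ (gaussMeas_tiltPair hσ0 x w) (by positivity) ?_
      have h1 : ‖w - x‖ ^ 2 ≤ 2 ^ 2 := pow_le_pow_left₀ (norm_nonneg _) hw 2
      rw [hu, mul_one_div]
      gcongr
      linarith
    · rw [← hρ]
      have hp : 0 < (1 + q * ρ) ^ α := by positivity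
      rw [inv_mul_le_iff₀ hp]
      refine b5.trans (le_of_eq ?_)
      congr 2
      ring
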